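/- Relative Brieskorn–Greuel theorem: let f ∈ 𝒪₂ with f(0) = 0 and an isolated critical point at 0, with Milnor number μ(f) < ∞, and let F : (ℂ^k×ℂ²,0) → (ℂ,0) be a holomorphic germ with F(0,·) = f (a deformation of f, with parameters λ = (λ₁,…,λ_k) and coordinates (x,y) on ℂ²). Then the relative Brieskorn lattice H''_F = 𝒪_{k+2} / {∂_x F·∂_y G − ∂_y F·∂_x G : G ∈ 𝒪_{k+2}} is a free module of rank μ(f) over the ring 𝒪_{k+1} = ℂ{λ₁,…,λ_k,t}, where λ_i acts by multiplication by λ_i and t acts by multiplication by F. -/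

import Mathlib

open Filter Topology
open scoped Classical

/-- The ring of germs at `0` of holomorphic (analytic) functions on `E`. -/
def Og (E : Type*) [NormedAddCommGroup E] [NormedSpace ℂ E] :
    Subring (Germ (𝓝 (0 : E)) ℂ) where
  carrier := {F | ∃ g : E → ℂ, AnalyticAt ℂ g 0 ∧ F = ↑g}
  one_mem' := ⟨fun _ => 1, analyticAt_const, rfl⟩
  zero_mem' := ⟨fun _ => 0, analyticAt_const, rfl⟩
  mul_mem' := by
    rintro F G ⟨f, hf, rfl⟩ ⟨g, hg, rfl⟩
    exact ⟨f * g, hf.mul hg, (Germ.coe_mul _ _).symm⟩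
  add_mem' := by
    rintro F G ⟨f, hf, rfl⟩ ⟨g, hg, rfl⟩
    exact ⟨f + g, hf.add hg, (Germ.coe_add _ _).symm⟩
  neg_mem' := by
    rintro F ⟨f, hf, rfl⟩
    exact ⟨-f, hf.neg, (Germ.coe_neg _).symm⟩

variable {E F G : Type*} [NormedAddCommGroup E] [NormedSpace ℂ E]
  [NormedAddCommGroup F] [NormedSpace ℂ F] [NormedAddCommGroup G] [NormedSpace ℂ G]

/-- A canonical analytic representative of a germ in `Og E`. -/
noncomputable def Og.rep (f : Og E) : E → ℂ :=
  Classical.choose (f.2 : ∃ g : E → ℂ, AnalyticAt ℂ g 0 ∧ f.1 = ↑g)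

lemma Og.rep_spec (f : Og E) : AnalyticAt ℂ (Og.rep f) 0 ∧ f.1 = ↑(Og.rep f) :=
  Classical.choose_spec (f.2 : ∃ g : E → ℂ, AnalyticAt ℂ g 0 ∧ f.1 = ↑g)

/-- Evaluation at the origin. -/
noncomputable def Og.ev0 (f : Og E) : ℂ := Og.rep f 0

/-- The germ of an analytic function (junk value `0` if not analytic at `0`). -/
noncomputable def Og.mk (g : E → ℂ) : Og E :=
  if h : AnalyticAt ℂ g 0 then ⟨↑g, g, h, rfl⟩ else 0

/-- The constant germ. -/
noncomputable def Og.const (c : ℂ) : Og E := Og.mk (fun _ => c)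

/-- Directional derivative of a germ along the vector `v`. -/
noncomputable def Og.pd (v : E) (f : Og E) : Og E :=
  ⟨↑(fun z => fderiv ℂ (Og.rep f) z v),
   fun z => fderiv ℂ (Og.rep f) z v,
   ((ContinuousLinearMap.apply ℂ ℂ v).analyticAt _).comp (Og.rep_spec f).1.fderiv, rfl⟩

/-- Pull-back of a germ under an analytic map preserving the origin
(junk value `0` otherwise). -/
noncomputable def Og.pull (u : E → F) (f : Og F) : Og E :=
  if h : AnalyticAt ℂ u 0 ∧ u 0 = 0 then
    ⟨↑(fun z => Og.rep f (u z)), fun z => Og.rep f (u z),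
      ((h.2.symm ▸ (Og.rep_spec f).1 : AnalyticAt ℂ (Og.rep f) (u 0))).comp h.1, rfl⟩
  else 0

/-- Composition `ψ ∘ f` of a one-variable germ `ψ` with a germ `f` such that `f(0) = 0`
(junk value `0` if `f(0) ≠ 0`). -/
noncomputable def Og.comp (ψ : Og ℂ) (f : Og E) : Og E :=
  if h : Og.ev0 f = 0 then
    have hψ0 : AnalyticAt ℂ (Og.rep ψ) (0 : ℂ) := (Og.rep_spec ψ).1
    ⟨↑(fun z => Og.rep ψ (Og.rep f z)), fun z => Og.rep ψ (Og.rep f z),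
      (by
        have : Og.rep f 0 = 0 := h
        rw [← this] at hψ0
        exact hψ0.comp (Og.rep_spec f).1 : AnalyticAt ℂ (fun z => Og.rep ψ (Og.rep f z)) 0),
      rfl⟩
  else 0

/-- Composition `ψ(λ, F(λ,·))` of a germ `ψ ∈ 𝒪_{k+1} = ℂ{λ,t}` with the unfolding of
a germ `F ∈ 𝒪_{k+2}` with `F(0) = 0` (junk value `0` if `F(0) ≠ 0`).  This realizes the
`ℂ{λ,t}`-module structure in which `λ_i` acts as multiplication by `λ_i` and `t` as
multiplication by `F`. -/
noncomputable def Og.compPair {Λ E : Type*} [NormedAddCommGroup Λ] [NormedSpace ℂ Λ]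
    [NormedAddCommGroup E] [NormedSpace ℂ E]
    (ψ : Og (Λ × ℂ)) (F : Og (Λ × E)) : Og (Λ × E) :=
  if h : Og.ev0 F = 0 then
    ⟨↑(fun z : Λ × E => Og.rep ψ (z.1, Og.rep F z)),
      fun z : Λ × E => Og.rep ψ (z.1, Og.rep F z),
      by
        have h1 : AnalyticAt ℂ (fun z : Λ × E => (z.1, Og.rep F z)) 0 :=
          analyticAt_fst.prod (Og.rep_spec F).1
        have h2 : AnalyticAt ℂ (Og.rep ψ) (((0 : Λ), Og.rep F 0)) := by
          have hF0 : Og.rep F 0 = 0 := h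
          rw [hF0]
          exact (Og.rep_spec ψ).1
        exact h2.comp_of_eq h1 rfl, rfl⟩
  else 0

/-- `∂_x F` for a germ on `ℂ^k × ℂ²`, the derivative being taken in the fibre
variables `(x,y)` only. -/
noncomputable abbrev Og.dxP {Λ : Type*} [NormedAddCommGroup Λ] [NormedSpace ℂ Λ]
    (F : Og (Λ × (ℂ × ℂ))) : Og (Λ × (ℂ × ℂ)) := Og.pd (0, (1, 0)) F

/-- `∂_y F` for a germ on `ℂ^k × ℂ²`. -/
noncomputable abbrev Og.dyP {Λ : Type*} [NormedAddCommGroup Λ] [NormedSpace ℂ Λ]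
    (F : Og (Λ × (ℂ × ℂ))) : Og (Λ × (ℂ × ℂ)) := Og.pd (0, (0, 1)) F

/-- The Jacobian ideal of `f ∈ 𝒪₂`, as a set. -/
def jacobianSet (f : Og (ℂ × ℂ)) : Set (Og (ℂ × ℂ)) :=
  {x | ∃ g h : Og (ℂ × ℂ), x = g * Og.pd (1, 0) f + h * Og.pd (0, 1) f}

/-- The Milnor number of `f` is `μ`. -/
def HasMilnorNumber (f : Og (ℂ × ℂ)) (μ : ℕ) : Prop :=
  ∃ b : Fin μ → Og (ℂ × ℂ), ∀ u : Og (ℂ × ℂ),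
    ∃! c : Fin μ → ℂ, u - ∑ i, Og.const (c i) * b i ∈ jacobianSet f

/-- The relations `{∂_x F ∂_y G - ∂_y F ∂_x G : G ∈ 𝒪_{k+2}}` defining the relative
Brieskorn lattice `H''_F`. -/
def relBrieskornRel {Λ : Type*} [NormedAddCommGroup Λ] [NormedSpace ℂ Λ]
    (F : Og (Λ × (ℂ × ℂ))) : Set (Og (Λ × (ℂ × ℂ))) :=
  {x | ∃ G : Og (Λ × (ℂ × ℂ)), x = Og.dxP F * Og.dyP G - Og.dyP F * Og.dxP G}

/-! ### Basic calculus of analytic germs -/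

namespace Og

/-- The germ of a function that is analytic at the origin. -/
noncomputable def ofFun (g : E → ℂ) (h : AnalyticAt ℂ g 0) : Og E := ⟨↑g, g, h, rfl⟩

lemma ofFun_eq_iff {g h : E → ℂ} {hg : AnalyticAt ℂ g 0} {hh : AnalyticAt ℂ h 0} :
    ofFun g hg = ofFun h hh ↔ g =ᶠ[𝓝 0] h := by
  simp [ofFun, Subtype.ext_iff]

lemma analyticAt_rep (u : Og E) : AnalyticAt ℂ (rep u) 0 := (rep_spec u).1

@[simp] lemma ofFun_rep (u : Og E) : ofFun (rep u) (analyticAt_rep u) = u :=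
  Subtype.ext (rep_spec u).2.symm

lemma rep_ofFun {g : E → ℂ} (h : AnalyticAt ℂ g 0) : rep (ofFun g h) =ᶠ[𝓝 0] g := by
  rw [← ofFun_eq_iff (hg := analyticAt_rep _) (hh := h), ofFun_rep]

lemma exists_ofFun (u : Og E) : ∃ g hg, u = ofFun g hg := ⟨_, _, (ofFun_rep u).symm⟩

lemma ext_rep {u v : Og E} (h : (rep u) =ᶠ[𝓝 0] (rep v)) : u = v := by
  rw [← ofFun_rep u, ← ofFun_rep v]; exact ofFun_eq_iff.2 h

lemma ofFun_add {g h : E → ℂ} (hg : AnalyticAt ℂ g 0) (hh : AnalyticAt ℂ h 0) :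
    ofFun g hg + ofFun h hh = ofFun (g + h) (hg.add hh) := rfl

lemma ofFun_mul {g h : E → ℂ} (hg : AnalyticAt ℂ g 0) (hh : AnalyticAt ℂ h 0) :
    ofFun g hg * ofFun h hh = ofFun (g * h) (hg.mul hh) := rfl

lemma rep_add (u v : Og E) : rep (u + v) =ᶠ[𝓝 0] (rep u) + (rep v) := by
  conv_lhs => rw [← ofFun_rep u, ← ofFun_rep v, ofFun_add]
  exact rep_ofFun _

lemma rep_mul (u v : Og E) : rep (u * v) =ᶠ[𝓝 0] (rep u) * (rep v) := by
  conv_lhs => rw [← ofFun_rep u, ← ofFun_rep v, ofFun_mul]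
  exact rep_ofFun _

/-- Pull-back of germs under an analytic map preserving the origin, as a ring homomorphism. -/
noncomputable def pb (φ : E → F) (hφ : AnalyticAt ℂ φ 0) (h0 : φ 0 = 0) : Og F →+* Og E where
  toFun u := ofFun (fun z => (rep u) (φ z))
    ((analyticAt_rep u).comp_of_eq hφ h0)
  map_one' := by
    refine (ofFun_eq_iff (hh := analyticAt_const (v := (1 : ℂ)))).2 ?_
    have : rep (1 : Og F) =ᶠ[𝓝 0] fun _ => 1 := rep_ofFun (g := fun _ => (1 : ℂ)) analyticAt_const
    have ht : Tendsto φ (𝓝 0) (𝓝 0) := by simpa [ContinuousAt, h0] using hφ.continuousAt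
    exact ht.eventually this
  map_zero' := by
    refine (ofFun_eq_iff (hh := analyticAt_const (v := (0 : ℂ)))).2 ?_
    have : rep (0 : Og F) =ᶠ[𝓝 0] fun _ => 0 := rep_ofFun (g := fun _ => (0 : ℂ)) analyticAt_const
    have ht : Tendsto φ (𝓝 0) (𝓝 0) := by simpa [ContinuousAt, h0] using hφ.continuousAt
    exact ht.eventually this
  map_mul' u v := by
    rw [ofFun_mul]
    refine ofFun_eq_iff.2 ?_
    have ht : Tendsto φ (𝓝 0) (𝓝 0) := by simpa [ContinuousAt, h0] using hφ.continuousAt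
    exact ht.eventually (rep_mul u v)
  map_add' u v := by
    rw [ofFun_add]
    refine ofFun_eq_iff.2 ?_
    have ht : Tendsto φ (𝓝 0) (𝓝 0) := by simpa [ContinuousAt, h0] using hφ.continuousAt
    exact ht.eventually (rep_add u v)

lemma tendsto_of_map_zero {φ : E → F} (hφ : AnalyticAt ℂ φ 0) (h0 : φ 0 = 0) :
    Tendsto φ (𝓝 0) (𝓝 0) := by simpa [ContinuousAt, h0] using hφ.continuousAt

lemma pb_apply {φ : E → F} (hφ : AnalyticAt ℂ φ 0) (h0 : φ 0 = 0) (u : Og F) :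
    pb φ hφ h0 u = ofFun (fun z => rep u (φ z)) ((analyticAt_rep u).comp_of_eq hφ h0) := rfl

lemma pb_ofFun {φ : E → F} (hφ : AnalyticAt ℂ φ 0) (h0 : φ 0 = 0) {g : F → ℂ}
    (hg : AnalyticAt ℂ g 0) :
    pb φ hφ h0 (ofFun g hg) = ofFun (g ∘ φ) (hg.comp_of_eq hφ h0) :=
  (ofFun_eq_iff (hg := (analyticAt_rep _).comp_of_eq hφ h0)).2
    ((tendsto_of_map_zero hφ h0).eventually (rep_ofFun hg))

lemma rep_pb {φ : E → F} (hφ : AnalyticAt ℂ φ 0) (h0 : φ 0 = 0) (u : Og F) :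
    rep (pb φ hφ h0 u) =ᶠ[𝓝 0] fun z => (rep u) (φ z) :=
  rep_ofFun ((analyticAt_rep u).comp_of_eq hφ h0)

lemma pb_pb {φ : E → F} (hφ : AnalyticAt ℂ φ 0) (h0 : φ 0 = 0) {ψ : F → G}
    (hψ : AnalyticAt ℂ ψ 0) (h0' : ψ 0 = 0) (u : Og G) :
    pb φ hφ h0 (pb ψ hψ h0' u) =
      pb (ψ ∘ φ) (hψ.comp_of_eq hφ h0) (by simp [h0, h0']) u :=
  pb_ofFun hφ h0 ((analyticAt_rep u).comp_of_eq hψ h0')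

/-- Pull-back under a continuous linear map. -/
noncomputable abbrev lpb (φ : E →L[ℂ] F) : Og F →+* Og E := pb φ (φ.analyticAt 0) φ.map_zero

lemma lpb_lpb (φ : E →L[ℂ] F) (ψ : F →L[ℂ] G) (u : Og G) :
    lpb φ (lpb ψ u) = lpb (ψ.comp φ) u := pb_pb _ _ _ _ _

lemma lpb_id (u : Og E) : lpb (ContinuousLinearMap.id ℂ E) u = u := by
  conv_rhs => rw [← ofFun_rep u]
  rfl

/-- Constant germs, as a ring homomorphism. -/
noncomputable def constHom : ℂ →+* Og E where
  toFun c := ofFun (fun _ => c) analyticAt_const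
  map_one' := rfl
  map_zero' := rfl
  map_mul' _ _ := rfl
  map_add' _ _ := rfl

noncomputable instance : Algebra ℂ (Og E) := constHom.toAlgebra

lemma const_eq (c : ℂ) : (Og.const c : Og E) = algebraMap ℂ (Og E) c := by
  rw [Og.const, Og.mk, dif_pos analyticAt_const]; rfl

lemma algebraMap_eq (c : ℂ) : algebraMap ℂ (Og E) c = ofFun (fun _ => c) analyticAt_const := rfl

@[simp] lemma pb_algebraMap {φ : E → F} (hφ : AnalyticAt ℂ φ 0) (h0 : φ 0 = 0) (c : ℂ) :
    pb φ hφ h0 (algebraMap ℂ _ c) = algebraMap ℂ _ c :=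
  pb_ofFun hφ h0 analyticAt_const

/-- Evaluation at the origin, as a ring homomorphism. -/
noncomputable def ev : Og E →+* ℂ where
  toFun := ev0
  map_one' := (rep_ofFun (g := fun _ : E => (1 : ℂ)) analyticAt_const).eq_of_nhds
  map_zero' := (rep_ofFun (g := fun _ : E => (0 : ℂ)) analyticAt_const).eq_of_nhds
  map_mul' u v := (rep_mul u v).eq_of_nhds
  map_add' u v := (rep_add u v).eq_of_nhds

lemma ev_apply (u : Og E) : ev u = (rep u) 0 := rfl

lemma ev_ofFun {g : E → ℂ} (hg : AnalyticAt ℂ g 0) : ev (ofFun g hg) = g 0 :=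
  (rep_ofFun hg).eq_of_nhds

@[simp] lemma ev_pb {φ : E → F} (hφ : AnalyticAt ℂ φ 0) (h0 : φ 0 = 0) (u : Og F) :
    ev (pb φ hφ h0 u) = ev u := by
  rw [ev_apply, (rep_pb hφ h0 u).eq_of_nhds, h0, ev_apply]

@[simp] lemma ev_algebraMap (c : ℂ) : ev (algebraMap ℂ (Og E) c) = c :=
  ev_ofFun (g := fun _ : E => c) analyticAt_const

lemma isUnit_iff {u : Og E} : IsUnit u ↔ ev u ≠ 0 := by
  constructor
  · intro h; exact (h.map ev).ne_zero
  · intro h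
    obtain ⟨g, hg, rfl⟩ := exists_ofFun u
    rw [ev_ofFun] at h
    refine isUnit_iff_exists_inv.2 ⟨ofFun (fun z => (g z)⁻¹) (hg.inv h), ?_⟩
    rw [ofFun_mul]
    refine (ofFun_eq_iff (hh := analyticAt_const (v := (1 : ℂ)))).2 ?_
    filter_upwards [hg.continuousAt.eventually_ne h] with z hz
    exact mul_inv_cancel₀ hz

lemma analyticAt_fderiv_apply {g : E → ℂ} (hg : AnalyticAt ℂ g 0) (v : E) :
    AnalyticAt ℂ (fun z => fderiv ℂ g z v) 0 :=
  ((ContinuousLinearMap.apply ℂ ℂ v).analyticAt _).comp hg.fderiv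

lemma pd_apply (v : E) (u : Og E) :
    pd v u = ofFun (fun z => fderiv ℂ (rep u) z v)
      (analyticAt_fderiv_apply (analyticAt_rep u) v) := rfl

lemma pd_ofFun (v : E) {g : E → ℂ} (hg : AnalyticAt ℂ g 0) :
    pd v (ofFun g hg) = ofFun (fun z => fderiv ℂ g z v)
      (analyticAt_fderiv_apply hg v) := by
  rw [pd_apply]
  refine ofFun_eq_iff.2 ?_
  filter_upwards [(rep_ofFun hg).fderiv (𝕜 := ℂ)] with z hz
  rw [hz]

lemma rep_pd (v : E) (u : Og E) : rep (pd v u) =ᶠ[𝓝 0] fun z => fderiv ℂ (rep u) z v :=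
  rep_ofFun (analyticAt_fderiv_apply (analyticAt_rep u) v)

lemma eventually_differentiableAt {g : E → ℂ} (hg : AnalyticAt ℂ g 0) :
    ∀ᶠ z in 𝓝 (0 : E), DifferentiableAt ℂ g z := by
  filter_upwards [hg.eventually_analyticAt] with z hz using hz.differentiableAt

lemma pd_add (v : E) (a b : Og E) : pd v (a + b) = pd v a + pd v b := by
  obtain ⟨f, hf, rfl⟩ := exists_ofFun a
  obtain ⟨g, hg, rfl⟩ := exists_ofFun b
  rw [ofFun_add]
  simp only [pd_ofFun, ofFun_add]
  refine ofFun_eq_iff.2 ?_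
  filter_upwards [eventually_differentiableAt hf,
    eventually_differentiableAt hg] with z h1 h2
  simp [fderiv_add h1 h2]

lemma pd_mul (v : E) (a b : Og E) : pd v (a * b) = a * pd v b + b * pd v a := by
  obtain ⟨f, hf, rfl⟩ := exists_ofFun a
  obtain ⟨g, hg, rfl⟩ := exists_ofFun b
  rw [ofFun_mul]
  simp only [pd_ofFun, ofFun_add, ofFun_mul]
  refine ofFun_eq_iff.2 ?_
  filter_upwards [eventually_differentiableAt hf,
    eventually_differentiableAt hg] with z h1 h2
  simp [fderiv_mul h1 h2]

@[simp] lemma pd_algebraMap (v : E) (c : ℂ) : pd v (algebraMap ℂ (Og E) c) = 0 := by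
  rw [algebraMap_eq, pd_ofFun]
  refine (ofFun_eq_iff (hh := analyticAt_const (v := (0 : ℂ)))).2 (Eventually.of_forall fun z => ?_)
  simp

/-- The directional derivative, as a derivation. -/
noncomputable def D (v : E) : Derivation ℂ (Og E) (Og E) :=
  Derivation.mk'
    { toFun := pd v
      map_add' := pd_add v
      map_smul' := fun c u => by
        simp [Algebra.smul_def, pd_mul] }
    (fun a b => by simp [pd_mul])

@[simp] lemma D_apply (v : E) (u : Og E) : D v u = pd v u := rfl

lemma pd_pd_comm (v w : E) (u : Og E) : pd v (pd w u) = pd w (pd v u) := by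
  obtain ⟨g, hg, rfl⟩ := exists_ofFun u
  simp only [pd_ofFun]
  refine ofFun_eq_iff.2 ?_
  filter_upwards [hg.eventually_analyticAt] with z hz
  have hs : IsSymmSndFDerivAt ℂ g z :=
    hz.contDiffAt.isSymmSndFDerivAt (n := ⊤) (by simp)
  have hd : DifferentiableAt ℂ (fderiv ℂ g) z := hz.fderiv.differentiableAt
  have key : ∀ a b : E, fderiv ℂ (fun y => fderiv ℂ g y a) z b
      = fderiv ℂ (fderiv ℂ g) z b a := by
    intro a b
    have := (hd.hasFDerivAt.clm_apply (hasFDerivAt_const a z)).fderiv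
    rw [this]; simp
  rw [key, key]
  exact hs v w

lemma pd_lpb (v : E) (φ : E →L[ℂ] F) (u : Og F) : pd v (lpb φ u) = lpb φ (pd (φ v) u) := by
  obtain ⟨g, hg, rfl⟩ := exists_ofFun u
  rw [pb_ofFun, pd_ofFun, pd_ofFun, pb_ofFun]
  refine ofFun_eq_iff.2 ?_
  have ht := tendsto_of_map_zero (φ.analyticAt 0) φ.map_zero
  filter_upwards [ht.eventually (eventually_differentiableAt hg)] with z h1
  rw [fderiv_comp z h1 φ.differentiableAt]
  simp

/-- General chain rule, with the derivative of the substitution given pointwise. -/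
lemma pd_pb [CompleteSpace F] {φ : E → F} (hφ : AnalyticAt ℂ φ 0) (h0 : φ 0 = 0) (v : E) (u : Og F)
    {z₁ z₂ : F}
    {s : Og E} (hs : ∀ᶠ z in 𝓝 0, fderiv ℂ φ z v = z₁ + (rep s) z • z₂) :
    pd v (pb φ hφ h0 u) = pb φ hφ h0 (pd z₁ u) + s * pb φ hφ h0 (pd z₂ u) := by
  obtain ⟨g, hg, rfl⟩ := exists_ofFun u
  obtain ⟨h, hh, rfl⟩ := exists_ofFun s
  rw [pb_ofFun, pd_ofFun, pd_ofFun, pd_ofFun, pb_ofFun, pb_ofFun, ofFun_mul, ofFun_add]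
  refine ofFun_eq_iff.2 ?_
  have ht := tendsto_of_map_zero hφ h0
  filter_upwards [ht.eventually (eventually_differentiableAt hg), hs, rep_ofFun hh,
    hφ.eventually_analyticAt] with z h1 h4 h6 h5
  rw [fderiv_comp z h1 h5.differentiableAt]
  simp [h4, h6]

end Og

/-! ### The Wiener algebra of absolutely convergent power series -/

/-- The Banach space of absolutely summable sequences, regarded as a space of power series. -/
def Wiener : Type := lp (fun _ : ℕ => ℂ) 1

/-- A power series in one complex variable is represented by a formal multilinear series. -/
lemma exists_hasFPowerSeriesAt_of_hasSum {X : Type*} [NormedAddCommGroup X] [NormedSpace ℂ X]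
    {f : ℂ → X} {c : ℕ → X} (h : ∀ᶠ z in 𝓝 0, HasSum (fun n => z ^ n • c n) (f z)) :
    ∃ p : FormalMultilinearSeries ℂ ℂ X, HasFPowerSeriesAt f p 0 ∧ ∀ n, p.coeff n = c n := by
  let p : FormalMultilinearSeries ℂ ℂ X :=
    fun n => ContinuousMultilinearMap.mkPiRing ℂ (Fin n) (c n)
  have hp : ∀ n, p.coeff n = c n := fun n => by simp [p, FormalMultilinearSeries.coeff]
  exact ⟨p, hasFPowerSeriesAt_iff.2 (by simpa [hp] using h), hp⟩

namespace Wiener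

noncomputable instance : NormedAddCommGroup Wiener :=
  inferInstanceAs (NormedAddCommGroup (lp (fun _ : ℕ => ℂ) 1))

noncomputable instance : NormedSpace ℂ Wiener :=
  inferInstanceAs (NormedSpace ℂ (lp (fun _ : ℕ => ℂ) 1))

instance : CompleteSpace Wiener :=
  inferInstanceAs (CompleteSpace (lp (fun _ : ℕ => ℂ) 1))

/-- The `n`-th coefficient. -/
def coeff (a : Wiener) (n : ℕ) : ℂ := (show lp (fun _ : ℕ => ℂ) 1 from a).1 n

lemma summable_norm_coeff (a : Wiener) : Summable fun n => ‖a.coeff n‖ := by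
  have := (show lp (fun _ : ℕ => ℂ) 1 from a).2
  simpa [coeff] using this.summable (p := 1) (by simp)

/-- The element with given coefficients. -/
def mk (c : ℕ → ℂ) (h : Summable fun n => ‖c n‖) : Wiener :=
  (⟨c, memℓp_gen (by simpa using h)⟩ : lp (fun _ : ℕ => ℂ) 1)

@[simp] lemma coeff_mk (c : ℕ → ℂ) (h : Summable fun n => ‖c n‖) (n : ℕ) :
    (mk c h).coeff n = c n := rfl

@[ext] lemma ext {a b : Wiener} (h : ∀ n, a.coeff n = b.coeff n) : a = b :=
  lp.ext (funext h)

@[simp] lemma coeff_add (a b : Wiener) (n : ℕ) : (a + b).coeff n = a.coeff n + b.coeff n := rfl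
@[simp] lemma coeff_sub (a b : Wiener) (n : ℕ) : (a - b).coeff n = a.coeff n - b.coeff n := rfl
@[simp] lemma coeff_neg (a : Wiener) (n : ℕ) : (-a).coeff n = -a.coeff n := rfl
@[simp] lemma coeff_zero (n : ℕ) : (0 : Wiener).coeff n = 0 := rfl
@[simp] lemma coeff_smul (c : ℂ) (a : Wiener) (n : ℕ) : (c • a).coeff n = c * a.coeff n := rfl

lemma norm_eq (a : Wiener) : ‖a‖ = ∑' n, ‖a.coeff n‖ := by
  have := lp.norm_eq_tsum_rpow (p := 1) (E := fun _ : ℕ => ℂ) (by simp) a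
  simp only [ENNReal.toReal_one, Real.rpow_one, div_one] at this
  exact this

lemma norm_coeff_le (a : Wiener) (n : ℕ) : ‖a.coeff n‖ ≤ ‖a‖ := by
  rw [norm_eq]
  exact a.summable_norm_coeff.le_tsum n (fun _ _ => norm_nonneg _)

lemma norm_le_of_le (a b : Wiener) (C : ℝ) (h : ∀ n, ‖a.coeff n‖ ≤ C * ‖b.coeff n‖) :
    ‖a‖ ≤ C * ‖b‖ := by
  rw [norm_eq, norm_eq, ← tsum_mul_left]
  exact a.summable_norm_coeff.tsum_le_tsum h (b.summable_norm_coeff.mul_left C)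

/-- The underlying formal power series. -/
noncomputable def toPS (a : Wiener) : PowerSeries ℂ := PowerSeries.mk a.coeff

@[simp] lemma coeff_toPS (a : Wiener) (n : ℕ) : PowerSeries.coeff n a.toPS = a.coeff n := by
  simp [toPS]

lemma toPS_injective : Function.Injective toPS := fun a b h => by
  ext n; rw [← coeff_toPS, h, coeff_toPS]

lemma summable_antidiagonal (a b : Wiener) :
    Summable fun n => ‖PowerSeries.coeff n (a.toPS * b.toPS)‖ := by
  simp only [PowerSeries.coeff_mul, coeff_toPS]
  exact summable_norm_sum_mul_antidiagonal_of_summable_norm a.summable_norm_coeff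
    b.summable_norm_coeff

noncomputable instance : Mul Wiener := ⟨fun a b => mk _ (summable_antidiagonal a b)⟩

noncomputable instance : One Wiener :=
  ⟨mk (fun n => if n = 0 then 1 else 0)
    (summable_of_ne_finset_zero (s := {0}) (by intro n hn; simp at hn; simp [hn]))⟩

@[simp] lemma toPS_mul (a b : Wiener) : (a * b).toPS = a.toPS * b.toPS := by
  ext n; rw [coeff_toPS]; rfl

@[simp] lemma toPS_one : (1 : Wiener).toPS = 1 := by
  ext n; rw [coeff_toPS, PowerSeries.coeff_one]; rfl

@[simp] lemma toPS_add (a b : Wiener) : (a + b).toPS = a.toPS + b.toPS := by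
  ext n; simp

@[simp] lemma toPS_zero : (0 : Wiener).toPS = 0 := by
  ext n; simp

lemma coeff_mul (a b : Wiener) (n : ℕ) :
    (a * b).coeff n = ∑ p ∈ Finset.HasAntidiagonal.antidiagonal n, a.coeff p.1 * b.coeff p.2 := by
  rw [← coeff_toPS, toPS_mul, PowerSeries.coeff_mul]; simp

lemma coeff_one (n : ℕ) : (1 : Wiener).coeff n = if n = 0 then 1 else 0 := rfl

noncomputable instance : CommRing Wiener :=
  { (inferInstance : AddCommGroup Wiener) with
    mul := (· * ·)
    one := 1
    mul_assoc := fun a b c => toPS_injective (by simp [mul_assoc])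
    mul_comm := fun a b => toPS_injective (by simp [mul_comm])
    one_mul := fun a => toPS_injective (by simp)
    mul_one := fun a => toPS_injective (by simp)
    left_distrib := fun a b c => toPS_injective (by simp [mul_add])
    right_distrib := fun a b c => toPS_injective (by simp [add_mul])
    zero_mul := fun a => toPS_injective (by simp)
    mul_zero := fun a => toPS_injective (by simp) }

lemma norm_mul_le' (a b : Wiener) : ‖a * b‖ ≤ ‖a‖ * ‖b‖ := by
  rw [norm_eq, norm_eq a, norm_eq b,
    tsum_mul_tsum_eq_tsum_sum_antidiagonal_of_summable_norm
      (by simpa using a.summable_norm_coeff) (by simpa using b.summable_norm_coeff)]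
  refine (a * b).summable_norm_coeff.tsum_le_tsum (fun n => ?_) ?_
  · rw [coeff_mul]
    refine (norm_sum_le _ _).trans (le_of_eq ?_)
    simp
  · have := summable_norm_sum_mul_antidiagonal_of_summable_norm
      (f := fun n => ‖a.coeff n‖) (g := fun n => ‖b.coeff n‖)
      (by simpa using a.summable_norm_coeff) (by simpa using b.summable_norm_coeff)
    exact this.of_norm

noncomputable instance : NormedCommRing Wiener :=
  { (inferInstance : NormedAddCommGroup Wiener), (inferInstance : CommRing Wiener) with
    norm_mul_le := norm_mul_le' }

noncomputable instance : Algebra ℂ Wiener :=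
  Algebra.ofModule
    (fun c a b => by
      ext n; simp [coeff_mul, Finset.mul_sum, mul_assoc])
    (fun c a b => by
      ext n; simp [coeff_mul, Finset.mul_sum, mul_left_comm])

noncomputable instance : NormedAlgebra ℂ Wiener :=
  { (inferInstance : Algebra ℂ Wiener) with
    norm_smul_le := fun c a => (norm_smul_le c a) }

/-- The `n`-th coefficient, as a continuous linear functional. -/
noncomputable def coeffL (n : ℕ) : Wiener →L[ℂ] ℂ :=
  LinearMap.mkContinuous
    { toFun := fun a => a.coeff n
      map_add' := fun _ _ => rfl
      map_smul' := fun _ _ => rfl } 1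
    (fun a => (norm_coeff_le a n).trans_eq (one_mul _).symm)

@[simp] lemma coeffL_apply (n : ℕ) (a : Wiener) : coeffL n a = a.coeff n := rfl

lemma norm_coeffL_le (n : ℕ) : ‖coeffL n‖ ≤ 1 :=
  LinearMap.mkContinuous_norm_le _ zero_le_one _

/-- Evaluation at a point of the open unit disc. -/
noncomputable def eval (ξ : ℂ) : Wiener →L[ℂ] ℂ := ∑' n, ξ ^ n • coeffL n

lemma hasSum_eval {ξ : ℂ} (h : ‖ξ‖ < 1) : HasSum (fun n => ξ ^ n • coeffL n) (eval ξ) := by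
  refine Summable.hasSum ?_
  refine Summable.of_norm_bounded (summable_geometric_of_lt_one (norm_nonneg ξ) h) (fun n => ?_)
  rw [norm_smul, norm_pow]
  exact mul_le_of_le_one_right (by positivity) (norm_coeffL_le n)

lemma hasSum_eval_apply {ξ : ℂ} (h : ‖ξ‖ < 1) (a : Wiener) :
    HasSum (fun n => ξ ^ n * a.coeff n) (eval ξ a) := by
  simpa using (ContinuousLinearMap.apply ℂ ℂ a).hasSum (hasSum_eval h)

lemma analyticAt_eval : AnalyticAt ℂ eval 0 := by
  obtain ⟨p, hp, -⟩ := exists_hasFPowerSeriesAt_of_hasSum (f := eval) (c := coeffL) (by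
    filter_upwards [Metric.ball_mem_nhds (0 : ℂ) one_pos] with z hz
    exact hasSum_eval (by simpa using hz))
  exact ⟨p, hp⟩

lemma eval_one {ξ : ℂ} (h : ‖ξ‖ < 1) : eval ξ 1 = 1 := by
  refine (hasSum_eval_apply h 1).unique ?_
  convert hasSum_ite_eq 0 (1 : ℂ) using 2 with n
  by_cases hn : n = 0 <;> simp [coeff_one, hn]

lemma eval_mul {ξ : ℂ} (h : ‖ξ‖ < 1) (a b : Wiener) : eval ξ (a * b) = eval ξ a * eval ξ b := by
  have key : ∀ a : Wiener, Summable fun n => ‖ξ ^ n * a.coeff n‖ := fun a => by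
    refine a.summable_norm_coeff.of_nonneg_of_le (fun _ => norm_nonneg _) (fun n => ?_)
    rw [norm_mul, norm_pow]
    exact mul_le_of_le_one_left (norm_nonneg _) (pow_le_one₀ (norm_nonneg _) h.le)
  rw [← (hasSum_eval_apply h a).tsum_eq, ← (hasSum_eval_apply h b).tsum_eq,
    tsum_mul_tsum_eq_tsum_sum_antidiagonal_of_summable_norm (key a) (key b),
    ← (hasSum_eval_apply h _).tsum_eq]
  refine tsum_congr fun n => ?_
  rw [coeff_mul, Finset.mul_sum]
  refine Finset.sum_congr rfl fun p hp => ?_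
  rw [← Finset.HasAntidiagonal.mem_antidiagonal.1 hp]; ring

/-- An element is determined by its values near the origin. -/
lemma eq_zero_of_eval {a : Wiener} (h : ∀ᶠ ξ in 𝓝 (0 : ℂ), eval ξ a = 0) : a = 0 := by
  obtain ⟨p, hp, hc⟩ := exists_hasFPowerSeriesAt_of_hasSum (f := fun ξ => eval ξ a) (c := a.coeff) (by
    filter_upwards [Metric.ball_mem_nhds (0 : ℂ) one_pos] with z hz
    exact hasSum_eval_apply (by simpa using hz) a)
  have h2 : p = 0 := HasFPowerSeriesAt.eq_zero (hp.congr h)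
  ext n
  rw [← hc, h2]; rfl

end Wiener

namespace Wiener

/-- The coordinate function. -/
noncomputable def X : Wiener :=
  mk (fun n => if n = 1 then 1 else 0)
    (summable_of_ne_finset_zero (s := {1}) (by intro n hn; simp at hn; simp [hn]))

@[simp] lemma toPS_X : X.toPS = PowerSeries.X := by
  ext n; rw [coeff_toPS, PowerSeries.coeff_X]; rfl

lemma toPS_pow (a : Wiener) (k : ℕ) : (a ^ k).toPS = a.toPS ^ k := by
  induction k with
  | zero => simp
  | succ k ih => rw [pow_succ, toPS_mul, ih, pow_succ]

lemma coeff_X_pow_mul (k : ℕ) (a : Wiener) (n : ℕ) :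
    (X ^ k * a).coeff n = if k ≤ n then a.coeff (n - k) else 0 := by
  rw [← coeff_toPS, toPS_mul, toPS_pow, toPS_X, PowerSeries.coeff_X_pow_mul', coeff_toPS]

lemma coeff_algebraMap (c : ℂ) (n : ℕ) :
    (algebraMap ℂ Wiener c).coeff n = if n = 0 then c else 0 := by
  rw [Algebra.algebraMap_eq_smul_one, coeff_smul, coeff_one]; simp

lemma eval_X {ξ : ℂ} (h : ‖ξ‖ < 1) : eval ξ X = ξ := by
  refine (hasSum_eval_apply h X).unique ?_
  convert hasSum_ite_eq 1 ξ using 2 with n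
  by_cases hn : n = 1 <;> simp [X, hn]

/-- Dropping the first `k` coefficients. -/
noncomputable def shift (k : ℕ) : Wiener →L[ℂ] Wiener :=
  LinearMap.mkContinuous
    { toFun := fun a => mk (fun n => a.coeff (n + k))
        ((summable_nat_add_iff k).2 a.summable_norm_coeff)
      map_add' := fun _ _ => rfl
      map_smul' := fun _ _ => rfl } 1 (fun a => by
        rw [norm_eq, norm_eq, one_mul]
        exact Summable.tsum_le_tsum_of_inj (fun n => n + k) (add_left_injective k)
          (fun _ _ => norm_nonneg _) (fun _ => le_rfl)
          ((summable_nat_add_iff k).2 a.summable_norm_coeff) a.summable_norm_coeff)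

@[simp] lemma coeff_shift (k : ℕ) (a : Wiener) (n : ℕ) :
    (shift k a).coeff n = a.coeff (n + k) := rfl

lemma norm_shift_le (k : ℕ) (a : Wiener) : ‖shift k a‖ ≤ ‖a‖ := by
  simpa using (shift k).le_of_opNorm_le (LinearMap.mkContinuous_norm_le _ zero_le_one _) a

lemma shift_eq_zero_iff {k : ℕ} {a : Wiener} :
    shift k a = 0 ↔ ∀ n, k ≤ n → a.coeff n = 0 := by
  constructor
  · intro h n hn
    have := congrArg (fun b => b.coeff (n - k)) h
    simpa [Nat.sub_add_cancel hn] using this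
  · intro h; ext n; exact h _ (Nat.le_add_left _ _)

@[simp] lemma shift_X_pow_mul (k : ℕ) (a : Wiener) : shift k (X ^ k * a) = a := by
  ext n; simp [coeff_X_pow_mul]

/-- Term by term integration. -/
noncomputable def prim : Wiener →L[ℂ] Wiener :=
  LinearMap.mkContinuous
    { toFun := fun a => X * mk (fun n => a.coeff n / (n + 1))
        (a.summable_norm_coeff.of_nonneg_of_le (fun _ => norm_nonneg _) (fun n => by
          rw [norm_div]
          refine div_le_self (norm_nonneg _) ?_
          rw [← Nat.cast_succ, Complex.norm_natCast]; exact_mod_cast Nat.succ_pos n))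
      map_add' := fun a b => by
        rw [← mul_add]; congr 1; ext n; simp [add_div]
      map_smul' := fun c a => by
        rw [RingHom.id_apply, ← mul_smul_comm]; congr 1; ext n; simp [mul_div_assoc] } ‖X‖
    (fun a => by
      refine (norm_mul_le _ _).trans (mul_le_mul_of_nonneg_left ?_ (norm_nonneg _))
      rw [← one_mul ‖a‖]
      refine norm_le_of_le _ _ _ fun n => ?_
      rw [coeff_mk, norm_div, one_mul]
      refine div_le_self (norm_nonneg _) ?_
      rw [← Nat.cast_succ, Complex.norm_natCast]; exact_mod_cast Nat.succ_pos n)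

lemma coeff_prim (a : Wiener) (n : ℕ) :
    (prim a).coeff n = if 1 ≤ n then a.coeff (n - 1) / n else 0 := by
  change (X * _ : Wiener).coeff n = _
  rw [← pow_one X, coeff_X_pow_mul]
  split_ifs with h
  · rw [coeff_mk]; congr 1; exact_mod_cast Nat.sub_add_cancel h
  · rfl

@[simp] lemma coeff_prim_succ (a : Wiener) (n : ℕ) :
    (prim a).coeff (n + 1) = a.coeff n / (n + 1) := by
  simp [coeff_prim]

@[simp] lemma coeff_prim_zero (a : Wiener) : (prim a).coeff 0 = 0 := by
  simp [coeff_prim]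

lemma norm_prim_X_pow_le (k : ℕ) (a : Wiener) : ‖prim (X ^ k * a)‖ ≤ (1 / (k + 1)) * ‖a‖ := by
  have h1 : prim (X ^ k * a) = X ^ (k + 1) * shift (k + 1) (prim (X ^ k * a)) := by
    ext n
    rw [coeff_X_pow_mul, coeff_prim]
    rcases n with _ | n
    · simp
    · simp only [coeff_shift, coeff_X_pow_mul]
      by_cases h : k ≤ n
      · have : n - k + (k + 1) = n + 1 := by omega
        simp [h, this, coeff_X_pow_mul]
      · simp [h]
  have h2 : ∀ (j : ℕ) (b : Wiener), ‖X ^ j * b‖ ≤ ‖b‖ := by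
    intro j b
    rw [norm_eq, norm_eq b, ← (X ^ j * b).summable_norm_coeff.sum_add_tsum_nat_add j]
    rw [Finset.sum_eq_zero (fun n hn => by
      rw [coeff_X_pow_mul, if_neg (by simpa using hn), norm_zero]), zero_add]
    simp [coeff_X_pow_mul]
  rw [h1]
  refine (h2 _ _).trans (norm_le_of_le _ _ _ fun n => ?_)
  have e : n + (k + 1) = (n + k) + 1 := by ring
  rw [coeff_shift, e, coeff_prim_succ, coeff_X_pow_mul, if_pos (by omega), norm_div,
    Nat.add_sub_cancel, mul_comm, mul_one_div]
  have e2 : ‖((n + k : ℕ) : ℂ) + 1‖ = (n + k : ℝ) + 1 := by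
    rw [← Nat.cast_succ, Complex.norm_natCast]; push_cast; ring
  rw [e2]
  gcongr
  linarith [(Nat.cast_nonneg n : (0 : ℝ) ≤ n)]

lemma hasDerivAt_eval_prim (b : Wiener) {ξ : ℂ} (h : ‖ξ‖ < 1) :
    HasDerivAt (fun ξ => eval ξ (prim b)) (eval ξ b) ξ := by
  have key : ∀ z : ℂ, ‖z‖ < 1 →
      HasSum (fun n : ℕ => z ^ (n + 1) * (b.coeff n / (n + 1))) (eval z (prim b)) := by
    intro z hz
    have := (hasSum_nat_add_iff' 1).2 (hasSum_eval_apply hz (prim b))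
    simpa using this
  have h0 : HasDerivAt (fun z => ∑' n : ℕ, z ^ (n + 1) * (b.coeff n / (n + 1)))
      (∑' n : ℕ, ξ ^ n * b.coeff n) ξ := by
    refine hasDerivAt_tsum_of_isPreconnected
      (g := fun (n : ℕ) (z : ℂ) => z ^ (n + 1) * (b.coeff n / (n + 1)))
      (g' := fun (n : ℕ) (z : ℂ) => z ^ n * b.coeff n) (t := Metric.ball 0 1) (y₀ := 0)
      b.summable_norm_coeff Metric.isOpen_ball (convex_ball _ _).isPreconnected ?_ ?_
      (by simp) (key 0 (by simp)).summable (by simpa using h)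
    · intro n y _
      have : HasDerivAt (fun z : ℂ => z ^ (n + 1) * (b.coeff n / (n + 1))) _ y :=
        (hasDerivAt_pow (n + 1) y).mul_const (b.coeff n / (n + 1))
      have hn : (n : ℂ) + 1 ≠ 0 := by exact_mod_cast n.succ_ne_zero
      refine this.congr_deriv ?_
      rw [Nat.add_sub_cancel]
      push_cast
      field_simp
    · intro n y hy
      rw [norm_mul, norm_pow]
      exact mul_le_of_le_one_left (norm_nonneg _)
        (pow_le_one₀ (norm_nonneg _) (by simpa using (Metric.mem_ball.1 hy).le))
  rw [(hasSum_eval_apply h b).tsum_eq] at h0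
  refine h0.congr_of_eventuallyEq ?_
  filter_upwards [Metric.isOpen_ball.mem_nhds (show ξ ∈ Metric.ball (0 : ℂ) 1 by simpa using h)]
    with z hz
  exact (key z (by simpa using hz)).tsum_eq.symm

lemma eval_zero (a : Wiener) : eval 0 a = a.coeff 0 := by
  refine (hasSum_eval_apply (by simp) a).unique ?_
  convert hasSum_ite_eq 0 (a.coeff 0) using 2 with n
  by_cases hn : n = 0 <;> simp [hn]

end Wiener

instance : NormOneClass Wiener where
  norm_one := by
    rw [Wiener.norm_eq, tsum_eq_single 0 (fun n hn => by simp [Wiener.coeff_one, hn])]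
    simp [Wiener.coeff_one]

/-! ### Holomorphic functional calculus and representation of germs -/

/-- Multilinear terms of the holomorphic functional calculus. -/
noncomputable def calculusSeries {V : Type*} [NormedAddCommGroup V] [NormedSpace ℂ V] {d : ℕ}
    (v : Fin d → V) (U : FormalMultilinearSeries ℂ V ℂ) :
    FormalMultilinearSeries ℂ (Fin d → Wiener) Wiener := fun n =>
  ∑ i : Fin n → Fin d, U n (fun k => v (i k)) •
    (ContinuousMultilinearMap.mkPiAlgebra ℂ (Fin n) Wiener).compContinuousLinearMap
      fun k => ContinuousLinearMap.proj (i k)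

lemma eval_calculusSeries {V : Type*} [NormedAddCommGroup V] [NormedSpace ℂ V] {d : ℕ}
    (v : Fin d → V) (U : FormalMultilinearSeries ℂ V ℂ) (n : ℕ) (a : Fin d → Wiener) {ξ : ℂ}
    (h : ‖ξ‖ < 1) :
    Wiener.eval ξ (calculusSeries v U n fun _ => a) =
      U n fun _ => ∑ i, Wiener.eval ξ (a i) • v i := by
  have hprod : ∀ b : Fin n → Wiener, Wiener.eval ξ (∏ k, b k) = ∏ k, Wiener.eval ξ (b k) := by
    intro b
    exact map_prod (MonoidHom.mk ⟨Wiener.eval ξ, Wiener.eval_one h⟩ (Wiener.eval_mul h)) b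
      Finset.univ
  rw [ContinuousMultilinearMap.map_sum]
  simp only [calculusSeries, sum_apply, map_sum]
  refine Finset.sum_congr rfl fun i _ => ?_
  rw [ContinuousMultilinearMap.map_smul_univ, smul_apply, map_smul]
  simp [hprod, mul_comm]

lemma norm_calculusSeries_le {V : Type*} [NormedAddCommGroup V] [NormedSpace ℂ V] {d : ℕ}
    (v : Fin d → V) (U : FormalMultilinearSeries ℂ V ℂ) (n : ℕ) :
    ‖calculusSeries v U n‖ ≤ ‖U n‖ * (d * ‖v‖) ^ n := by
  have h1 : ∀ i : Fin n → Fin d, ‖U n (fun k => v (i k)) •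
    (ContinuousMultilinearMap.mkPiAlgebra ℂ (Fin n) Wiener).compContinuousLinearMap
      fun k => (ContinuousLinearMap.proj (i k) : (Fin d → Wiener) →L[ℂ] Wiener)‖
      ≤ ‖U n‖ * ‖v‖ ^ n := by
    intro i
    rw [norm_smul]
    have e1 : ‖U n (fun k => v (i k))‖ ≤ ‖U n‖ * ‖v‖ ^ n := by
      refine ((U n).le_opNorm _).trans ?_
      gcongr
      exact (Finset.prod_le_prod (fun _ _ => norm_nonneg _)
        (fun k _ => norm_le_pi_norm v (i k))).trans_eq (by simp)
    have e2 : ‖(ContinuousMultilinearMap.mkPiAlgebra ℂ (Fin n) Wiener).compContinuousLinearMap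
      fun k => (ContinuousLinearMap.proj (i k) : (Fin d → Wiener) →L[ℂ] Wiener)‖ ≤ 1 := by
      refine ContinuousMultilinearMap.opNorm_le_bound zero_le_one fun m => ?_
      simp only [ContinuousMultilinearMap.compContinuousLinearMap_apply,
        ContinuousMultilinearMap.mkPiAlgebra_apply, ContinuousLinearMap.proj_apply, one_mul]
      refine (Finset.norm_prod_le _ _).trans ?_
      exact Finset.prod_le_prod (fun _ _ => norm_nonneg _)
        (fun k _ => norm_le_pi_norm (m k) (i k))
    exact (mul_le_of_le_one_right (norm_nonneg _) e2).trans e1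
  refine (norm_sum_le _ _).trans ((Finset.sum_le_sum fun i _ => h1 i).trans_eq ?_)
  simp [mul_pow]; ring

lemma exists_functional_calculus {V : Type*} [NormedAddCommGroup V] [NormedSpace ℂ V] {d : ℕ}
    (v : Fin d → V) {u : V → ℂ} (hu : AnalyticAt ℂ u 0) :
    ∃ r > 0, ∃ w : (Fin d → Wiener) → Wiener, (∀ a, ‖a‖ < r → AnalyticAt ℂ w a) ∧
      ∀ a, ‖a‖ < r → ∀ ξ, ‖ξ‖ < 1 → ‖∑ i, Wiener.eval ξ (a i) • v i‖ < r →
        Wiener.eval ξ (w a) = u (∑ i, Wiener.eval ξ (a i) • v i) := by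
  obtain ⟨U, R, hU⟩ := hu
  obtain ⟨r0, hr0, hr0R⟩ : ∃ r0 : NNReal, 0 < r0 ∧ (r0 : ENNReal) < U.radius := by
    obtain ⟨q, h1, h2⟩ := ENNReal.lt_iff_exists_nnreal_btwn.1 (hU.r_pos.trans_le hU.r_le)
    exact ⟨q, by exact_mod_cast h1, h2⟩
  obtain ⟨C, hC, hb⟩ := U.norm_mul_pow_le_of_lt_radius hr0R
  set W := calculusSeries v U
  let s : NNReal := r0 / (d * ‖v‖₊ + 1)
  have hs : 0 < s := by positivity
  have hWr : (s : ENNReal) ≤ W.radius := by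
    refine W.le_radius_of_bound C fun n => ?_
    refine le_trans ?_ (hb n)
    have h2 : (d * ‖v‖) * (s : ℝ) ≤ r0 := by
      have : (s : ℝ) = r0 / (d * ‖v‖ + 1) := by simp [s]
      rw [this, mul_div_assoc', div_le_iff₀ (by positivity)]
      nlinarith [r0.2, norm_nonneg v, (Nat.cast_nonneg d : (0:ℝ) ≤ d)]
    calc ‖W n‖ * (s : ℝ) ^ n ≤ ‖U n‖ * (d * ‖v‖) ^ n * (s : ℝ) ^ n := by
          gcongr; exact norm_calculusSeries_le v U n
      _ = ‖U n‖ * ((d * ‖v‖) * (s : ℝ)) ^ n := by rw [mul_assoc, ← mul_pow]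
      _ ≤ ‖U n‖ * (r0 : ℝ) ^ n := by gcongr
  have hW := W.hasFPowerSeriesOnBall (lt_of_lt_of_le (by exact_mod_cast hs) hWr)
  obtain ⟨q, hq0, hqR⟩ : ∃ q : NNReal, 0 < q ∧ (q : ENNReal) < R := by
    obtain ⟨q, h1, h2⟩ := ENNReal.lt_iff_exists_nnreal_btwn.1 hU.r_pos
    exact ⟨q, by exact_mod_cast h1, h2⟩
  have hmem : ∀ a : Fin d → Wiener, ‖a‖ < min (s : ℝ) q → a ∈ Metric.eball 0 W.radius := by
    intro a ha
    refine Metric.eball_subset_eball hWr ?_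
    rw [Metric.eball_coe, mem_ball_zero_iff]
    exact ha.trans_le (min_le_left _ _)
  refine ⟨min s q, lt_min (by exact_mod_cast hs) (by exact_mod_cast hq0), W.sum,
    fun a ha => hW.analyticAt_of_mem (hmem a ha), fun a ha ξ hξ hz => ?_⟩
  have h1 := (Wiener.eval ξ).hasSum (hW.hasSum (hmem a ha))
  have h2 : HasSum _ (u (0 + ∑ i, Wiener.eval ξ (a i) • v i)) := hU.hasSum (by
    refine Metric.eball_subset_eball hqR.le ?_
    rw [Metric.eball_coe, mem_ball_zero_iff]
    exact hz.trans_le (min_le_right _ _))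
  rw [zero_add] at h1 h2
  refine h1.unique ?_
  convert h2 using 2 with n
  exact eval_calculusSeries v U n a hξ

namespace Og

variable {P : Type*} [NormedAddCommGroup P] [NormedSpace ℂ P]

/-- `U` represents the germ `u` as an analytic family of power series converging absolutely on
the closed disc of radius `ρ`. -/
def Rep (ρ : ℝ) (U : P → Wiener) (u : Og (P × ℂ)) : Prop :=
  AnalyticAt ℂ U 0 ∧ rep u =ᶠ[𝓝 0] fun z => Wiener.eval (z.2 / ρ) (U z.1)

omit [NormedSpace ℂ P] in
lemma eventually_norm_div_lt (ρ : ℝ) :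
    ∀ᶠ z in 𝓝 (0 : P × ℂ), ‖z.2 / (ρ : ℂ)‖ < 1 := by
  have : ContinuousAt (fun z : P × ℂ => ‖z.2 / (ρ : ℂ)‖) 0 := by fun_prop
  exact this.eventually_lt continuousAt_const (by simp)

/-- Every germ is representable on all sufficiently small discs. -/
lemma eventually_exists_rep [FiniteDimensional ℂ P] (u : Og (P × ℂ)) :
    ∀ᶠ ρ in 𝓝[>] (0 : ℝ), ∃ U, Rep ρ U u := by
  let b := Module.finBasis ℂ (P × ℂ)
  obtain ⟨r, hr, w, hw, hwu⟩ := exists_functional_calculus (fun i => b i) (analyticAt_rep u)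
  let cr : Fin _ → (P × ℂ) →L[ℂ] ℂ := fun i => LinearMap.toContinuousLinearMap (b.coord i)
  let a : ℝ → P → Fin _ → Wiener := fun ρ p i =>
    cr i (p, 0) • (1 : Wiener) + (cr i (0, 1) * ρ) • Wiener.X
  have ha0 : ∀ᶠ ρ in 𝓝[>] (0 : ℝ), ‖a ρ 0‖ < r := by
    have hc : Continuous fun ρ : ℝ => a ρ 0 := by
      refine continuous_pi fun i => ?_
      have : Continuous fun ρ : ℝ => (cr i (0, 1) * ρ : ℂ) := by fun_prop
      exact continuous_const.add (this.smul continuous_const)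
    have h0 : a 0 0 = 0 := by
      funext i
      have : ((0 : P), (0 : ℂ)) = 0 := rfl
      simp [a, this]
    have : Tendsto (fun ρ : ℝ => ‖a ρ 0‖) (𝓝 0) (𝓝 0) := by
      simpa [h0] using hc.norm.tendsto 0
    exact (this.eventually_lt_const hr).filter_mono nhdsWithin_le_nhds
  filter_upwards [ha0, self_mem_nhdsWithin] with ρ hρ1 hρ
  have hρ0 : (ρ : ℂ) ≠ 0 := by exact_mod_cast (ne_of_gt hρ)
  have haa : AnalyticAt ℂ (a ρ) 0 := by
    refine AnalyticAt.pi fun i => ?_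
    have h1 : AnalyticAt ℂ (fun p : P => cr i (p, 0)) 0 :=
      ((cr i).comp (ContinuousLinearMap.inl ℂ P ℂ)).analyticAt 0
    exact (h1.smul analyticAt_const).add analyticAt_const
  refine ⟨fun p => w (a ρ p), (hw _ hρ1).comp_of_eq haa rfl, ?_⟩
  have hfst : Tendsto (fun z : P × ℂ => z.1) (𝓝 0) (𝓝 0) := continuous_fst.tendsto' _ _ rfl
  have e1 : ∀ᶠ z in 𝓝 (0 : P × ℂ), ‖a ρ z.1‖ < r :=
    hfst.eventually (haa.continuousAt.norm.eventually_lt continuousAt_const hρ1)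
  have e3 : ∀ᶠ z in 𝓝 (0 : P × ℂ), ‖z‖ < r := by
    filter_upwards [Metric.ball_mem_nhds (0 : P × ℂ) hr] with z hz using by simpa using hz
  filter_upwards [e1, e3, eventually_norm_div_lt ρ] with z h1 h3 h2
  have hz : ∑ i, Wiener.eval (z.2 / ρ) (a ρ z.1 i) • b i = z := by
    have : ∀ i, Wiener.eval (z.2 / ρ) (a ρ z.1 i) = b.repr z i := by
      intro i
      have h4 : z = (z.1, (0 : ℂ)) + z.2 • ((0 : P), (1 : ℂ)) := by ext <;> simp
      have h5 : b.repr z i = cr i z := rfl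
      rw [h5]
      conv_rhs => rw [h4]
      simp only [a, map_add, map_smul, Wiener.eval_one h2, Wiener.eval_X h2, smul_eq_mul]
      field_simp
    simp only [this]
    exact b.sum_repr z
  rw [hwu _ h1 _ h2 (by rw [hz]; exact h3), hz]

lemma analyticAt_eval_comp {ρ : ℝ} {U : P → Wiener} (hU : AnalyticAt ℂ U 0) :
    AnalyticAt ℂ (fun z : P × ℂ => Wiener.eval (z.2 / ρ) (U z.1)) 0 := by
  have h1 : AnalyticAt ℂ (fun z : P × ℂ => Wiener.eval (z.2 / ρ)) 0 :=
    Wiener.analyticAt_eval.comp_of_eq (analyticAt_snd.div_const) (by simp)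
  have h2 : AnalyticAt ℂ (fun z : P × ℂ => U z.1) 0 := hU.comp_of_eq analyticAt_fst rfl
  exact ((ContinuousLinearMap.id ℂ (Wiener →L[ℂ] ℂ)).analyticAt_bilinear _).comp₂ h1 h2

/-- The germ represented by an analytic family. -/
lemma exists_of_family (ρ : ℝ) {U : P → Wiener} (hU : AnalyticAt ℂ U 0) :
    ∃ u : Og (P × ℂ), Rep ρ U u :=
  ⟨ofFun _ (analyticAt_eval_comp hU), hU, rep_ofFun _⟩

end Og

namespace Og

section Rep

variable {P : Type*} [NormedAddCommGroup P] [NormedSpace ℂ P] {ρ : ℝ} {U V : P → Wiener}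
  {u v : Og (P × ℂ)}

omit [NormedSpace ℂ P] in
lemma tendsto_fst_zero : Tendsto (fun z : P × ℂ => z.1) (𝓝 0) (𝓝 0) :=
  continuous_fst.tendsto' _ _ rfl

lemma Rep.add (hu : Rep ρ U u) (hv : Rep ρ V v) : Rep ρ (fun p => U p + V p) (u + v) := by
  refine ⟨hu.1.add hv.1, ?_⟩
  filter_upwards [rep_add u v, hu.2, hv.2] with z h1 h2 h3
  simp [h1, h2, h3]

lemma Rep.mul (hu : Rep ρ U u) (hv : Rep ρ V v) : Rep ρ (fun p => U p * V p) (u * v) := by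
  refine ⟨hu.1.mul hv.1, ?_⟩
  filter_upwards [rep_mul u v, hu.2, hv.2, eventually_norm_div_lt ρ] with z h1 h2 h3 h4
  simp [h1, h2, h3, Wiener.eval_mul h4]

lemma Rep.zero : Rep ρ (fun _ : P => 0) (0 : Og (P × ℂ)) := by
  refine ⟨analyticAt_const, ?_⟩
  filter_upwards [rep_ofFun (analyticAt_const (v := (0 : ℂ)) (x := (0 : P × ℂ)))] with z h1
  rw [map_zero]; exact h1

lemma Rep.sum {ι : Type*} (s : Finset ι) {U : ι → P → Wiener} {u : ι → Og (P × ℂ)}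
    (h : ∀ i ∈ s, Rep ρ (U i) (u i)) : Rep ρ (fun p => ∑ i ∈ s, U i p) (∑ i ∈ s, u i) := by
  induction s using Finset.induction_on with
  | empty => simpa using Rep.zero
  | insert a s ha ih =>
    simp only [Finset.sum_insert ha]
    exact (h a (Finset.mem_insert_self _ _)).add
      (ih fun i hi => h i (Finset.mem_insert_of_mem hi))

lemma Rep.fst (c : Og P) : Rep ρ (fun p => algebraMap ℂ Wiener (rep c p))
    (lpb (ContinuousLinearMap.fst ℂ P ℂ) c) := by
  refine ⟨((Algebra.linearMap ℂ Wiener).mkContinuous 1 (fun x => by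
    simp [norm_algebraMap'])).analyticAt _ |>.comp (analyticAt_rep c), ?_⟩
  filter_upwards [rep_pb ((ContinuousLinearMap.fst ℂ P ℂ).analyticAt 0) (map_zero _) c,
    eventually_norm_div_lt ρ] with z h1 h2
  rw [h1, Algebra.algebraMap_eq_smul_one, map_smul, Wiener.eval_one h2]
  simp

lemma Rep.snd (hρ : 0 < ρ) : Rep ρ (fun _ : P => (ρ : ℂ) • Wiener.X)
    (lpb (ContinuousLinearMap.snd ℂ P ℂ) (ofFun (fun x : ℂ => x) analyticAt_id)) := by
  refine ⟨analyticAt_const, ?_⟩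
  have hρ0 : (ρ : ℂ) ≠ 0 := by exact_mod_cast hρ.ne'
  rw [pb_ofFun]
  filter_upwards [rep_ofFun ((ContinuousLinearMap.snd ℂ P ℂ).analyticAt 0),
    eventually_norm_div_lt ρ] with z h1 h2
  rw [map_smul, Wiener.eval_X h2, smul_eq_mul, mul_div_cancel₀ _ hρ0]
  exact h1

/-- The derivative in the distinguished variable. -/
lemma Rep.pd_prim (hu : Rep ρ (fun p => Wiener.prim (U p)) u) (hU : AnalyticAt ℂ U 0) :
    Rep ρ (fun p => (ρ : ℂ)⁻¹ • U p) (pd (0, 1) u) := by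
  refine ⟨(analyticAt_const (v := (ρ : ℂ)⁻¹)).fun_smul hU, ?_⟩
  filter_upwards [rep_pd (0, 1) u, hu.2.eventually_nhds, eventually_norm_div_lt ρ,
    eventually_differentiableAt (analyticAt_rep u)] with z h1 h2 h3 h4
  rw [h1]
  have e1 : HasDerivAt (fun t : ℂ => rep u (z + t • ((0 : P), (1 : ℂ))))
      (fderiv ℂ (rep u) z (0, 1)) 0 := by
    have hl : HasDerivAt (fun t : ℂ => z + t • ((0 : P), (1 : ℂ))) (0, 1) 0 := by
      simpa using ((hasDerivAt_id (0 : ℂ)).smul_const ((0 : P), (1 : ℂ))).const_add z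
    exact HasFDerivAt.comp_hasDerivAt_of_eq (0 : ℂ) h4.hasFDerivAt hl (by simp)
  have e2 : HasDerivAt (fun t : ℂ => Wiener.eval ((z.2 + t) / ρ) (Wiener.prim (U z.1)))
      (Wiener.eval (z.2 / ρ) (U z.1) * (ρ : ℂ)⁻¹) 0 := by
    have hl : HasDerivAt (fun t : ℂ => (z.2 + t) / ρ) ((ρ : ℂ)⁻¹) 0 := by
      simpa [one_div] using ((hasDerivAt_id (0 : ℂ)).const_add z.2).div_const (ρ : ℂ)
    exact HasDerivAt.comp_of_eq (0 : ℂ) (Wiener.hasDerivAt_eval_prim (U z.1) h3) hl (by simp)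
  have e3 : (fun t : ℂ => rep u (z + t • ((0 : P), (1 : ℂ)))) =ᶠ[𝓝 0]
      fun t : ℂ => Wiener.eval ((z.2 + t) / ρ) (Wiener.prim (U z.1)) := by
    have ht : Tendsto (fun t : ℂ => z + t • ((0 : P), (1 : ℂ))) (𝓝 0) (𝓝 z) := by
      have : Continuous fun t : ℂ => z + t • ((0 : P), (1 : ℂ)) := by fun_prop
      exact this.tendsto' _ _ (by simp)
    filter_upwards [ht.eventually h2] with t ht
    rw [ht]; simp
  rw [e1.unique (e2.congr_of_eventuallyEq e3)]
  simp [mul_comm]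

lemma Rep.unique (hρ : 0 < ρ) (hU : Rep ρ U u) (hV : Rep ρ V u) : U =ᶠ[𝓝 0] V := by
  have h : ∀ᶠ z in 𝓝 (0 : P × ℂ), Wiener.eval (z.2 / ρ) (U z.1 - V z.1) = 0 := by
    filter_upwards [hU.2, hV.2] with z h1 h2
    rw [map_sub, ← h1, ← h2, sub_self]
  rw [← Prod.mk_zero_zero, nhds_prod_eq] at h
  filter_upwards [h.curry] with p hp
  rw [← sub_eq_zero]
  refine Wiener.eq_zero_of_eval ?_
  have hρ0 : (ρ : ℂ) ≠ 0 := by exact_mod_cast hρ.ne'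
  have ht : Tendsto (fun ξ : ℂ => ρ * ξ) (𝓝 0) (𝓝 0) :=
    (continuous_const_mul (ρ : ℂ)).tendsto' _ _ (by simp)
  filter_upwards [ht.eventually hp] with ξ hξ
  simpa [mul_div_cancel_left₀ _ hρ0] using hξ

lemma Rep.congr (hU : Rep ρ U u) (hV : Rep ρ V v) (h : U =ᶠ[𝓝 0] V) : u = v := by
  refine ext_rep ?_
  filter_upwards [hU.2, hV.2, tendsto_fst_zero.eventually h] with z h1 h2 h3
  rw [h1, h2, h3]

end Rep

lemma eventually_norm_div_lt' (ρ : ℝ) : ∀ᶠ x in 𝓝 (0 : ℂ), ‖x / (ρ : ℂ)‖ < 1 := by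
  have : ContinuousAt (fun x : ℂ => ‖x / (ρ : ℂ)‖) 0 := by fun_prop
  exact this.eventually_lt continuousAt_const (by simp)

lemma _root_.Wiener.analyticAt_eval_div (ρ : ℝ) (a : Wiener) :
    AnalyticAt ℂ (fun x : ℂ => Wiener.eval (x / ρ) a) 0 :=
  ((ContinuousLinearMap.apply ℂ ℂ a).analyticAt _).comp
    (Wiener.analyticAt_eval.comp_of_eq (analyticAt_id.div_const) (by simp))

/-- Convergent power series in one variable defined by elements of the Wiener algebra. -/
noncomputable def toGerm (ρ : ℝ) : Wiener →ₐ[ℂ] Og ℂ where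
  toFun a := ofFun (fun x => Wiener.eval (x / ρ) a)
    (Wiener.analyticAt_eval_div ρ a)
  map_one' := by
    refine (ofFun_eq_iff (hh := analyticAt_const (v := (1 : ℂ)))).2 ?_
    filter_upwards [eventually_norm_div_lt' ρ] with x hx
    exact Wiener.eval_one hx
  map_zero' := by
    refine (ofFun_eq_iff (hh := analyticAt_const (v := (0 : ℂ)))).2 ?_
    exact Eventually.of_forall fun x => map_zero _
  map_mul' a b := by
    rw [ofFun_mul]
    refine ofFun_eq_iff.2 ?_
    filter_upwards [eventually_norm_div_lt' ρ] with x hx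
    exact Wiener.eval_mul hx a b
  map_add' a b := by
    rw [ofFun_add]
    exact ofFun_eq_iff.2 (Eventually.of_forall fun x => map_add _ _ _)
  commutes' c := by
    rw [algebraMap_eq]
    refine ofFun_eq_iff.2 ?_
    filter_upwards [eventually_norm_div_lt' ρ] with x hx
    rw [Algebra.algebraMap_eq_smul_one, map_smul, Wiener.eval_one hx]
    simp

lemma toGerm_apply (ρ : ℝ) (a : Wiener) : toGerm ρ a =
    ofFun (fun x => Wiener.eval (x / ρ) a) (Wiener.analyticAt_eval_div ρ a) := rfl

lemma toGerm_injective {ρ : ℝ} (hρ : 0 < ρ) : Function.Injective (toGerm ρ) := by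
  refine (injective_iff_map_eq_zero _).2 fun a ha => Wiener.eq_zero_of_eval ?_
  have h1 := (ofFun_eq_iff (hg := Wiener.analyticAt_eval_div ρ a)
    (hh := analyticAt_const (v := (0 : ℂ)))).1 ha
  have hρ0 : (ρ : ℂ) ≠ 0 := by exact_mod_cast hρ.ne'
  have ht : Tendsto (fun ξ : ℂ => ρ * ξ) (𝓝 0) (𝓝 0) :=
    (continuous_const_mul (ρ : ℂ)).tendsto' _ _ (by simp)
  filter_upwards [ht.eventually h1] with ξ hξ
  simpa [mul_div_cancel_left₀ _ hρ0] using hξ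

lemma Rep.restrict {P : Type*} [NormedAddCommGroup P] [NormedSpace ℂ P] {ρ : ℝ}
    {U : P → Wiener} {u : Og (P × ℂ)} (h : Rep ρ U u) :
    lpb (ContinuousLinearMap.inr ℂ P ℂ) u = toGerm ρ (U 0) := by
  rw [pb_apply, toGerm_apply]
  refine ofFun_eq_iff.2 ?_
  have ht : Tendsto (fun x : ℂ => ((0 : P), x)) (𝓝 0) (𝓝 0) :=
    (Continuous.prodMk_right (0 : P)).tendsto' _ _ rfl
  filter_upwards [ht.eventually h.2] with x hx using hx

lemma eventually_mem_range_toGerm (u : Og ℂ) :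
    ∀ᶠ ρ in 𝓝[>] (0 : ℝ), ∃ a, toGerm ρ a = u := by
  filter_upwards [eventually_exists_rep (P := ℂ) (lpb (ContinuousLinearMap.snd ℂ ℂ ℂ) u)]
    with ρ ⟨U, hU⟩
  refine ⟨U 0, ?_⟩
  rw [← hU.restrict, lpb_lpb]
  exact lpb_id u

/-- The coordinate germ in one variable. -/
noncomputable def x : Og ℂ := ofFun (fun x => x) analyticAt_id

lemma toGerm_X {ρ : ℝ} (hρ : 0 < ρ) : toGerm ρ ((ρ : ℂ) • Wiener.X) = x := by
  rw [toGerm_apply]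
  refine ofFun_eq_iff.2 ?_
  have hρ0 : (ρ : ℂ) ≠ 0 := by exact_mod_cast hρ.ne'
  filter_upwards [eventually_norm_div_lt' ρ] with x hx
  rw [map_smul, Wiener.eval_X hx, smul_eq_mul, mul_div_cancel₀ _ hρ0]

lemma pd_toGerm_prim (ρ : ℝ) (a : Wiener) :
    pd 1 (toGerm ρ (Wiener.prim a)) = (ρ : ℂ)⁻¹ • toGerm ρ a := by
  rw [← map_smul]
  rw [toGerm_apply, toGerm_apply, pd_ofFun]
  refine ofFun_eq_iff.2 ?_
  filter_upwards [eventually_norm_div_lt' ρ] with x hx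
  have hl : HasDerivAt (fun t : ℂ => t / ρ) ((ρ : ℂ)⁻¹) x := by
    simpa [one_div] using (hasDerivAt_id x).div_const (ρ : ℂ)
  have := HasDerivAt.comp x (Wiener.hasDerivAt_eval_prim a hx) hl
  rw [map_smul, smul_eq_mul, mul_comm, ← this.deriv, ← fderiv_apply_one_eq_deriv]
  rfl

lemma ev_toGerm (ρ : ℝ) (a : Wiener) : ev (toGerm ρ a) = a.coeff 0 := by
  rw [toGerm_apply, ev_ofFun, zero_div, Wiener.eval_zero]

end Og

/-! ### Analytic families of invertible operators -/

section Families

variable {Z X Y : Type*} [NormedAddCommGroup Z] [NormedSpace ℂ Z] [NormedAddCommGroup X]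
  [NormedSpace ℂ X] [CompleteSpace X] [NormedAddCommGroup Y] [NormedSpace ℂ Y] [CompleteSpace Y]

/-- An analytic family of operators that is bijective at the origin is injective near the
origin, and the corresponding equations have analytic solutions. -/
lemma exists_analytic_solution {T : Z → X →L[ℂ] Y} (hT : AnalyticAt ℂ T 0)
    (hb : Function.Bijective (T 0)) :
    (∀ᶠ z in 𝓝 0, ∀ x, T z x = 0 → x = 0) ∧
    ∀ g : Z → Y, AnalyticAt ℂ g 0 → ∃ h : Z → X, AnalyticAt ℂ h 0 ∧
      ∀ᶠ z in 𝓝 0, T z (h z) = g z := by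
  let e : X ≃L[ℂ] Y := ContinuousLinearEquiv.ofBijective (T 0)
    (LinearMap.ker_eq_bot.2 hb.1) (LinearMap.range_eq_top.2 hb.2)
  have he : ∀ x, e x = T 0 x := fun x => rfl
  let S : Z → X →L[ℂ] X := fun z => (e.symm : Y →L[ℂ] X).comp (T z)
  have hS : AnalyticAt ℂ S 0 :=
    (ContinuousLinearMap.compL ℂ X Y X (e.symm : Y →L[ℂ] X)).analyticAt _ |>.comp hT
  have hS0 : S 0 = 1 := by
    ext x; simp [S, ← he]
  have hu : ∀ᶠ z in 𝓝 0, IsUnit (S z) := by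
    have : IsUnit (S 0) := by rw [hS0]; exact isUnit_one
    exact hS.continuousAt.eventually (Units.isOpen.mem_nhds this)
  have hTS : ∀ z x, e (S z x) = T z x := fun z x => by simp [S]
  constructor
  · filter_upwards [hu] with z hz x hx
    have h1 : S z x = 0 := by simp [S, hx]
    have h2 : (Ring.inverse (S z) * S z) x = x := by rw [Ring.inverse_mul_cancel _ hz]; rfl
    rw [← h2]; simp [mul_apply_eq_comp, h1]
  · intro g hg
    have hinv : AnalyticAt ℂ (fun z => Ring.inverse (S z)) 0 := by
      have : AnalyticAt ℂ (Ring.inverse : (X →L[ℂ] X) → _) (S 0) := by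
        rw [hS0]; exact analyticAt_inverse (𝕜 := ℂ) (1 : (X →L[ℂ] X)ˣ)
      exact this.comp hS
    refine ⟨fun z => Ring.inverse (S z) (e.symm (g z)), ?_, ?_⟩
    · have h2 : AnalyticAt ℂ (fun z => e.symm (g z)) 0 :=
        ((e.symm : Y →L[ℂ] X).analyticAt _).comp hg
      exact ((ContinuousLinearMap.id ℂ (X →L[ℂ] X)).analyticAt_bilinear _).comp₂ hinv h2
    · filter_upwards [hu] with z hz
      rw [← hTS, ← mul_apply_eq_comp, Ring.mul_inverse_cancel _ hz]
      simp

end Families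

namespace Wiener

/-- Polynomials of degree less than `n`. -/
noncomputable def poly (n : ℕ) : (Fin n → ℂ) →L[ℂ] Wiener :=
  ∑ j : Fin n, (ContinuousLinearMap.proj j : (Fin n → ℂ) →L[ℂ] ℂ).smulRight (X ^ (j : ℕ))

lemma poly_apply (n : ℕ) (c : Fin n → ℂ) : poly n c = ∑ j, c j • X ^ (j : ℕ) := by
  simp [poly, sum_apply]

lemma coeff_X_pow (k n : ℕ) : (X ^ k).coeff n = if n = k then 1 else 0 := by
  have := coeff_X_pow_mul k 1 n
  rw [mul_one, coeff_one] at this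
  rw [this]
  by_cases h : k ≤ n
  · simp only [h, if_true]; congr 1; simp only [eq_iff_iff]; omega
  · rw [if_neg h, if_neg (by omega)]

lemma coeff_sum {ι : Type*} (s : Finset ι) (a : ι → Wiener) (n : ℕ) :
    (∑ i ∈ s, a i).coeff n = ∑ i ∈ s, (a i).coeff n :=
  map_sum (coeffL n) a s

lemma coeff_poly (n : ℕ) (c : Fin n → ℂ) (i : ℕ) :
    (poly n c).coeff i = if h : i < n then c ⟨i, h⟩ else 0 := by
  rw [poly_apply, coeff_sum]
  simp only [coeff_smul, coeff_X_pow]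
  split_ifs with h
  · rw [Finset.sum_eq_single ⟨i, h⟩]
    · simp
    · intro j _ hj
      have : i ≠ j := fun e => hj (Fin.ext e.symm)
      simp [this]
    · simp
  · refine Finset.sum_eq_zero fun j _ => ?_
    have : i ≠ j := by omega
    simp [this]

lemma poly_add_X_pow_mul_shift (n : ℕ) (a : Wiener) :
    poly n (fun j => a.coeff j) + X ^ n * shift n a = a := by
  ext i
  rw [coeff_add, coeff_poly, coeff_X_pow_mul]
  by_cases h : i < n
  · simp [h, not_le.2 h]
  · simp [h, not_lt.1 h]

@[simp] lemma shift_poly (n : ℕ) (c : Fin n → ℂ) : shift n (poly n c) = 0 := by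
  ext i; simp [coeff_poly]

lemma poly_add_X_pow_mul_eq_zero {n : ℕ} {c : Fin n → ℂ} {a : Wiener}
    (h : poly n c + X ^ n * a = 0) : c = 0 ∧ a = 0 := by
  have h1 : a = 0 := by
    have := congrArg (shift n) h
    simpa using this
  refine ⟨funext fun j => ?_, h1⟩
  have := congrArg (fun b => b.coeff j) h
  simpa [h1, coeff_poly] using this

end Wiener

namespace Og

lemma Rep.one {P : Type*} [NormedAddCommGroup P] [NormedSpace ℂ P] (ρ : ℝ) :
    Rep ρ (fun _ : P => 1) (1 : Og (P × ℂ)) := by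
  have := Rep.fst (P := P) (ρ := ρ) 1
  refine ⟨analyticAt_const, ?_⟩
  filter_upwards [rep_ofFun (analyticAt_const (v := (1 : ℂ)) (x := (0 : P × ℂ))),
    eventually_norm_div_lt ρ] with z h1 h2
  rw [Wiener.eval_one h2]; exact h1

lemma Rep.pow {P : Type*} [NormedAddCommGroup P] [NormedSpace ℂ P] {ρ : ℝ} {U : P → Wiener}
    {u : Og (P × ℂ)} (h : Rep ρ U u) (n : ℕ) : Rep ρ (fun p => U p ^ n) (u ^ n) := by
  induction n with
  | zero => simpa using Rep.one ρ
  | succ n ih => simpa only [pow_succ] using ih.mul h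

/-- The last coordinate on a product. -/
noncomputable def last (P : Type*) [NormedAddCommGroup P] [NormedSpace ℂ P] : Og (P × ℂ) :=
  lpb (ContinuousLinearMap.snd ℂ P ℂ) x

/-- Germs not depending on the last coordinate. -/
noncomputable abbrev incl (P : Type*) [NormedAddCommGroup P] [NormedSpace ℂ P] :
    Og P →+* Og (P × ℂ) := lpb (ContinuousLinearMap.fst ℂ P ℂ)

/-- Restriction to the last coordinate line. -/
noncomputable abbrev line (P : Type*) [NormedAddCommGroup P] [NormedSpace ℂ P] :
    Og (P × ℂ) →+* Og ℂ := lpb (ContinuousLinearMap.inr ℂ P ℂ)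

variable {P : Type*} [NormedAddCommGroup P] [NormedSpace ℂ P]

/-- The operator family of Weierstrass division. -/
private noncomputable def divFamily (ρ : ℝ) (n : ℕ) (Φ : P → Wiener) (p : P) :
    (Wiener × (Fin n → ℂ)) →L[ℂ] Wiener :=
  (ContinuousLinearMap.mul ℂ Wiener (Φ p)).comp (ContinuousLinearMap.fst ℂ _ _) +
    (∑ j : Fin n, (ContinuousLinearMap.proj j : (Fin n → ℂ) →L[ℂ] ℂ).smulRight
      (((ρ : ℂ) • Wiener.X) ^ (j : ℕ))).comp (ContinuousLinearMap.snd ℂ _ _)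

omit [NormedAddCommGroup P] [NormedSpace ℂ P] in
private lemma divFamily_apply (ρ : ℝ) (n : ℕ) (Φ : P → Wiener) (p : P) (g : Wiener)
    (a : Fin n → ℂ) : divFamily ρ n Φ p (g, a) = Φ p * g +
      ∑ j, algebraMap ℂ Wiener (a j) * ((ρ : ℂ) • Wiener.X) ^ (j : ℕ) := by
  simp [divFamily, sum_apply, Algebra.smul_def]

private lemma analyticAt_divFamily (ρ : ℝ) (n : ℕ) {Φ : P → Wiener} (hΦ : AnalyticAt ℂ Φ 0) :
    AnalyticAt ℂ (divFamily ρ n Φ) 0 := by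
  have h1 : AnalyticAt ℂ (fun p => (ContinuousLinearMap.mul ℂ Wiener (Φ p)).comp
      (ContinuousLinearMap.fst ℂ Wiener (Fin n → ℂ))) 0 :=
    ((((ContinuousLinearMap.compL ℂ (Wiener × (Fin n → ℂ)) Wiener Wiener).flip
      (ContinuousLinearMap.fst ℂ _ _)).comp (ContinuousLinearMap.mul ℂ Wiener)).analyticAt _).comp
        hΦ
  exact h1.add analyticAt_const

private lemma divFamily_bijective {ρ : ℝ} (hρ : 0 < ρ) {n : ℕ} {Φ : P → Wiener} {e e' : Wiener}
    (he : e * e' = 1) (h : Φ 0 = ((ρ : ℂ) • Wiener.X) ^ n * e) :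
    Function.Bijective (divFamily ρ n Φ 0) := by
  have hρ0 : (ρ : ℂ) ≠ 0 := by exact_mod_cast hρ.ne'
  have key : ∀ g a, divFamily ρ n Φ 0 (g, a) = Wiener.poly n (fun j => a j * ρ ^ (j : ℕ)) +
      Wiener.X ^ n * ((ρ : ℂ) ^ n • (e * g)) := by
    intro g a
    rw [divFamily_apply, h, Wiener.poly_apply, add_comm]
    congr 1
    · refine Finset.sum_congr rfl fun j _ => ?_
      rw [smul_pow, ← Algebra.smul_def, smul_smul]
    · rw [smul_pow, smul_mul_assoc, smul_mul_assoc, mul_smul_comm, mul_assoc]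
  constructor
  · refine (injective_iff_map_eq_zero _).2 ?_
    rintro ⟨g, a⟩ hz
    rw [key] at hz
    obtain ⟨h1, h2⟩ := Wiener.poly_add_X_pow_mul_eq_zero hz
    have hg : g = 0 := by
      have h3 : e * g = 0 := (smul_eq_zero.1 h2).resolve_left (pow_ne_zero _ hρ0)
      calc g = (e * e') * g := by rw [he, one_mul]
        _ = e' * (e * g) := by ring
        _ = 0 := by rw [h3, mul_zero]
    have ha : a = 0 := funext fun j => by
      have := congrFun h1 j
      simpa [hρ0] using this
    rw [hg, ha]; rfl
  · intro u
    refine ⟨((ρ : ℂ)⁻¹ ^ n • (e' * Wiener.shift n u), fun j => u.coeff j * (ρ : ℂ)⁻¹ ^ (j : ℕ)), ?_⟩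
    rw [key]
    conv_rhs => rw [← Wiener.poly_add_X_pow_mul_shift n u]
    congr 2
    · refine funext fun j => ?_
      rw [mul_assoc, ← mul_pow, inv_mul_cancel₀ hρ0, one_pow, mul_one]
    · rw [mul_smul_comm, smul_smul, ← mul_pow, mul_inv_cancel₀ hρ0, one_pow, one_smul,
        ← mul_assoc, he, one_mul]

/-- **Weierstrass division theorem.** -/
theorem weierstrass_division [FiniteDimensional ℂ P] {n : ℕ} {Φ : Og (P × ℂ)} {ε : Og ℂ}
    (hε : IsUnit ε) (hΦ : line P Φ = x ^ n * ε) (u : Og (P × ℂ)) :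
    ∃! qa : Og (P × ℂ) × (Fin n → Og P),
      u = Φ * qa.1 + ∑ j, incl P (qa.2 j) * last P ^ (j : ℕ) := by
  obtain ⟨ε', hε'⟩ := hε.exists_right_inv
  have good : ∀ᶠ ρ in 𝓝[>] (0 : ℝ), 0 < ρ ∧ ∃ U, Rep ρ U Φ ∧
      Function.Bijective (divFamily ρ n U 0) := by
    filter_upwards [self_mem_nhdsWithin, eventually_exists_rep Φ, eventually_mem_range_toGerm ε,
      eventually_mem_range_toGerm ε'] with ρ hρ ⟨U, hU⟩ ⟨e, he⟩ ⟨e', he'⟩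
    refine ⟨hρ, U, hU, divFamily_bijective (e := e) (e' := e') hρ ?_ ?_⟩
    · apply toGerm_injective hρ
      rw [map_mul, he, he', hε', map_one]
    · apply toGerm_injective hρ
      rw [← hU.restrict, hΦ, map_mul, map_pow, toGerm_X hρ, he]
  have hrep : ∀ (ρ : ℝ) (_ : 0 < ρ) (U : P → Wiener) (_ : Rep ρ U Φ) (G : P → Wiener)
      (q : Og (P × ℂ)) (_ : Rep ρ G q) (a : Fin n → Og P),
      Rep ρ (fun p => divFamily ρ n U p (G p, fun j => rep (a j) p))
        (Φ * q + ∑ j, incl P (a j) * last P ^ (j : ℕ)) := by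
    intro ρ hρ U hU G q hG a
    simp only [divFamily_apply]
    exact (hU.mul hG).add (Rep.sum _ fun j _ => (Rep.fst _).mul ((Rep.snd hρ).pow _))
  have hexists : ∃ qa : Og (P × ℂ) × (Fin n → Og P),
      u = Φ * qa.1 + ∑ j, incl P (qa.2 j) * last P ^ (j : ℕ) := by
    obtain ⟨ρ, ⟨hρ, U, hU, hb⟩, V, hV⟩ := (good.and (eventually_exists_rep u)).exists
    obtain ⟨h, hh, hs⟩ := (exists_analytic_solution (analyticAt_divFamily ρ n hU.1) hb).2 V hV.1
    have h1 : AnalyticAt ℂ (fun p => (h p).1) 0 := analyticAt_fst.comp hh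
    have h2 : ∀ j, AnalyticAt ℂ (fun p => (h p).2 j) 0 := fun j =>
      ((ContinuousLinearMap.proj j : (Fin n → ℂ) →L[ℂ] ℂ).analyticAt _).comp
        (analyticAt_snd.comp hh)
    obtain ⟨q, hq⟩ := exists_of_family ρ h1
    refine ⟨(q, fun j => ofFun _ (h2 j)), hV.congr (hrep ρ hρ U hU _ q hq _) ?_⟩
    filter_upwards [hs, eventually_all.2 fun j => rep_ofFun (h2 j)] with p h3 h4
    rw [← h3]
    congr 1
    exact Prod.ext rfl (funext fun j => (h4 j).symm)
  obtain ⟨qa, hqa⟩ := hexists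
  refine ⟨qa, hqa, fun qa' hqa' => ?_⟩
  have h0 : (0 : Og (P × ℂ)) = Φ * (qa'.1 - qa.1) +
      ∑ j, incl P ((qa'.2 - qa.2) j) * last P ^ (j : ℕ) := by
    simp only [Pi.sub_apply, map_sub, sub_mul, Finset.sum_sub_distrib, mul_sub]
    linear_combination hqa' - hqa
  obtain ⟨ρ, ⟨hρ, U, hU, hb⟩, G, hG⟩ :=
    (good.and (eventually_exists_rep (qa'.1 - qa.1))).exists
  have h1 := Rep.unique hρ (h0 ▸ hrep ρ hρ U hU G _ hG (qa'.2 - qa.2)) Rep.zero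
  have h2 := (exists_analytic_solution (analyticAt_divFamily ρ n hU.1) hb).1
  have h3 : qa'.1 - qa.1 = 0 := hG.congr Rep.zero (by
    filter_upwards [h1, h2] with p h1 h2
    exact congrArg Prod.fst (h2 _ h1))
  have h4 : qa'.2 - qa.2 = 0 := funext fun j => by
    rw [← ofFun_rep ((qa'.2 - qa.2) j)]
    refine (ofFun_eq_iff (hh := analyticAt_const (v := (0 : ℂ)))).2 ?_
    filter_upwards [h1, h2] with p h1 h2
    exact congrFun (congrArg Prod.snd (h2 _ h1)) j
  exact Prod.ext (sub_eq_zero.1 h3) (sub_eq_zero.1 h4)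

end Og

/-! ### Germs with vanishing derivative, primitives, and germs in one variable -/

namespace Og

/-- A germ whose derivative along `v` vanishes is constant along `v`. -/
lemma lpb_id_sub_smulRight {v : E} {g : Og E} (h : pd v g = 0) (l : E →L[ℂ] ℂ) :
    lpb (ContinuousLinearMap.id ℂ E - l.smulRight v) g = g := by
  obtain ⟨g, hg, rfl⟩ := exists_ofFun g
  rw [pd_ofFun] at h
  have h' : ∀ᶠ z in 𝓝 (0 : E), fderiv ℂ g z v = 0 :=
    (ofFun_eq_iff (hh := analyticAt_const (v := (0 : ℂ)))).1 h
  rw [pb_ofFun]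
  refine ofFun_eq_iff.2 ?_
  have hev := h'.and (eventually_differentiableAt hg)
  have hmap : ContinuousAt (fun p : E × ℝ => p.1 - ((p.2 : ℂ) * l p.1) • v) (0, 0) := by
    fun_prop
  obtain ⟨r, hr, hball⟩ := Metric.eventually_nhds_iff_ball.1 hev
  have hC : ∀ᶠ z in 𝓝 (0 : E), ‖z‖ + ‖l z‖ * ‖v‖ < r := by
    have : ContinuousAt (fun z : E => ‖z‖ + ‖l z‖ * ‖v‖) 0 := by fun_prop
    exact this.eventually (gt_mem_nhds (by simpa using hr))
  filter_upwards [hC] with z hz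
  have hin : ∀ s ∈ Set.Icc (0 : ℝ) 1, z - ((s : ℂ) * l z) • v ∈ Metric.ball (0 : E) r := by
    intro s hs
    rw [mem_ball_zero_iff]
    refine lt_of_le_of_lt ((norm_sub_le _ _).trans ?_) hz
    rw [norm_smul, norm_mul]
    have : ‖(s : ℂ)‖ ≤ 1 := by simpa [abs_of_nonneg hs.1] using hs.2
    gcongr
    exact mul_le_of_le_one_left (norm_nonneg _) this
  have hder : ∀ s ∈ Set.Icc (0 : ℝ) 1,
      HasDerivAt (fun s : ℝ => g (z - ((s : ℂ) * l z) • v)) 0 s := by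
    intro s hs
    obtain ⟨h0, hd⟩ := hball _ (hin s hs)
    have h1 : HasDerivAt (fun s : ℂ => z - (s * l z) • v) (-(l z • v)) (s : ℂ) := by
      have := (((hasDerivAt_id (s : ℂ)).mul_const (l z)).smul_const v).const_sub z
      simpa using this
    have h2 := (hd.hasFDerivAt.comp_hasDerivAt (s : ℂ) h1).comp_ofReal
    simpa [h0] using h2
  have := constant_of_derivWithin_zero (f := fun s : ℝ => g (z - ((s : ℂ) * l z) • v))
    (a := 0) (b := 1) (fun s hs => (hder s hs).differentiableAt.differentiableWithinAt)
    (fun s hs => (hder s ⟨hs.1, hs.2.le⟩).hasDerivWithinAt.derivWithin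
      (uniqueDiffOn_Icc zero_lt_one s ⟨hs.1, hs.2.le⟩)) 1 (by simp)
  simpa using this

@[simp] lemma pd_x : pd 1 x = 1 := by
  rw [x, pd_ofFun]
  exact (ofFun_eq_iff (hh := analyticAt_const (v := (1 : ℂ)))).2 (.of_forall fun z => by simp)

section Parameters

variable {P : Type*} [NormedAddCommGroup P] [NormedSpace ℂ P]

lemma incl_of_pd_eq_zero {g : Og (P × ℂ)} (h : pd (0, 1) g = 0) :
    incl P (lpb (ContinuousLinearMap.inl ℂ P ℂ) g) = g := by
  rw [lpb_lpb]
  conv_rhs => rw [← lpb_id_sub_smulRight h (ContinuousLinearMap.snd ℂ P ℂ)]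
  congr 2
  ext <;> simp

@[simp] lemma pd_incl (c : Og P) : pd (0, 1) (incl P c) = 0 := by
  rw [pd_lpb]
  obtain ⟨c, hc, rfl⟩ := exists_ofFun c
  rw [pd_ofFun, pb_ofFun]
  exact (ofFun_eq_iff (hh := analyticAt_const (v := (0 : ℂ)))).2 (by simp; rfl)

@[simp] lemma pd_last : pd (0, 1) (last P) = 1 := by
  have h : last P = lpb (ContinuousLinearMap.snd ℂ P ℂ) x := rfl
  rw [h, pd_lpb]
  simp

@[simp] lemma inl_incl (c : Og P) : lpb (ContinuousLinearMap.inl ℂ P ℂ) (incl P c) = c := by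
  rw [lpb_lpb, ContinuousLinearMap.fst_comp_inl, lpb_id]

/-- Primitives with respect to the last variable. -/
lemma exists_primitive [FiniteDimensional ℂ P] (w : Og (P × ℂ)) :
    ∃ W : Og (P × ℂ), pd (0, 1) W = w := by
  obtain ⟨ρ, ⟨U, hU⟩, hρ⟩ :=
    ((eventually_exists_rep w).and self_mem_nhdsWithin).exists
  have hρ : 0 < ρ := hρ
  have hρ' : (ρ : ℂ) ≠ 0 := by exact_mod_cast hρ.ne'
  have hA : AnalyticAt ℂ (fun p => (ρ : ℂ) • U p) 0 := analyticAt_const.fun_smul hU.1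
  obtain ⟨W, hW⟩ := exists_of_family ρ (U := fun p => Wiener.prim ((ρ : ℂ) • U p))
    ((Wiener.prim.analyticAt _).comp hA)
  refine ⟨W, (hW.pd_prim hA).congr hU (.of_forall fun p => ?_)⟩
  change (ρ : ℂ)⁻¹ • (ρ : ℂ) • U p = U p
  rw [smul_smul, inv_mul_cancel₀ hρ', one_smul]

end Parameters

/-! Germs in one variable. -/

lemma algebraMap_of_pd_eq_zero {g : Og ℂ} (h : pd 1 g = 0) : algebraMap ℂ _ (ev g) = g := by
  conv_rhs => rw [← lpb_id_sub_smulRight h (ContinuousLinearMap.id ℂ ℂ)]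
  rw [pb_apply, algebraMap_eq]
  exact ofFun_eq_iff.2 (.of_forall fun z => by simp [ev_apply])

@[simp] lemma ev_x : ev x = 0 := ev_ofFun _

lemma x_pow (m : ℕ) : x ^ m = ofFun (fun z : ℂ => z ^ m) (by fun_prop) := by
  induction m with
  | zero =>
    rw [pow_zero]
    exact (ofFun_eq_iff (hg := analyticAt_const (v := (1 : ℂ)))).2 (.of_forall fun z => by simp)
  | succ m ih =>
    rw [pow_succ, ih, x, ofFun_mul]
    exact ofFun_eq_iff.2 (.of_forall fun z => (pow_succ z m).symm)

lemma exists_eq_x_pow_mul {u : Og ℂ} (hu : u ≠ 0) :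
    ∃ (m : ℕ) (ε : Og ℂ), IsUnit ε ∧ u = x ^ m * ε := by
  obtain ⟨u, h, rfl⟩ := exists_ofFun u
  have h1 : ¬ ∀ᶠ z in 𝓝 (0 : ℂ), u z = 0 := fun h' =>
    hu ((ofFun_eq_iff (hh := analyticAt_const (v := (0 : ℂ)))).2 h')
  obtain ⟨m, g, hg, hg0, he⟩ := h.exists_eventuallyEq_pow_smul_nonzero_iff.2 h1
  refine ⟨m, ofFun g hg, isUnit_iff.2 (by rwa [ev_ofFun]), ?_⟩
  rw [x_pow, ofFun_mul]
  refine ofFun_eq_iff.2 ?_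
  filter_upwards [he] with z hz using by simpa using hz

lemma x_mul_eq_zero {u : Og ℂ} (h : x * u = 0) : u = 0 := by
  obtain ⟨u, hu, rfl⟩ := exists_ofFun u
  rw [x, ofFun_mul] at h
  have h' := (ofFun_eq_iff (hh := analyticAt_const (v := (0 : ℂ)))).1 h
  refine (ofFun_eq_iff (hh := analyticAt_const (v := (0 : ℂ)))).2 ?_
  refine (hu.eventually_eq_zero_or_eventually_ne_zero).resolve_right fun hne => ?_
  have : ∀ᶠ z in 𝓝[≠] (0 : ℂ), False := by
    filter_upwards [hne, h'.filter_mono nhdsWithin_le_nhds, self_mem_nhdsWithin] with z h1 h2 h3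
    exact h1 (by simpa [show z ≠ 0 from h3] using h2)
  exact (this.exists).elim fun _ h => h

lemma x_pow_mul_eq_zero {m : ℕ} {u : Og ℂ} (h : x ^ m * u = 0) : u = 0 := by
  induction m with
  | zero => simpa using h
  | succ m ih => exact ih (x_mul_eq_zero (by rw [← h]; ring))

instance : Nontrivial (Og E) := ⟨0, 1, fun h => by simpa using congrArg ev h⟩

instance : IsDomain (Og ℂ) :=
  have : NoZeroDivisors (Og ℂ) := ⟨fun {a b} h => by
    by_contra! hab
    obtain ⟨m, ε, hε, rfl⟩ := exists_eq_x_pow_mul hab.1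
    rw [mul_assoc] at h
    exact hab.2 ((hε.mul_right_eq_zero).1 (x_pow_mul_eq_zero h))⟩
  NoZeroDivisors.to_isDomain _

end Og

/-! ### Two lemmas of linear algebra -/

section LinearAlgebra

variable {D B V W C D' B' V' W' : Type*} [AddCommGroup D] [Module ℂ D] [AddCommGroup B] [Module ℂ B]
  [AddCommGroup V] [Module ℂ V] [AddCommGroup W] [Module ℂ W] [AddCommGroup C] [Module ℂ C]
  [AddCommGroup D'] [Module ℂ D'] [AddCommGroup B'] [Module ℂ B'] [AddCommGroup W'] [Module ℂ W']

/-- The index of an operator with a bijective block of finite codimensions. -/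
lemma index_of_bijective_block [FiniteDimensional ℂ V] (T : D →ₗ[ℂ] B) (q : D →ₗ[ℂ] V)
    (π : B →ₗ[ℂ] W) (γ : B →ₗ[ℂ] C) (hq : Function.Surjective q)
    (hb : ∀ w, ∃! d, q d = 0 ∧ π (T d) = w) [FiniteDimensional ℂ (LinearMap.ker π)]
    (hγ : ∀ b, γ b = 0 ↔ ∃ d, T d = b) :
    FiniteDimensional ℂ (LinearMap.range γ) ∧ FiniteDimensional ℂ (LinearMap.ker T) ∧
    Module.finrank ℂ (LinearMap.range γ) + Module.finrank ℂ V =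
      Module.finrank ℂ (LinearMap.ker π) + Module.finrank ℂ (LinearMap.ker T) := by
  let A := LinearMap.ker (π ∘ₗ T)
  have hA : ∀ d, d ∈ A ↔ π (T d) = 0 := fun d => Iff.rfl
  let qA : A ≃ₗ[ℂ] V := LinearEquiv.ofBijective (q.domRestrict A) ⟨by
      rw [← LinearMap.ker_eq_bot, LinearMap.ker_eq_bot']
      rintro ⟨d, hd⟩ h
      exact Subtype.ext ((hb 0).unique ⟨h, hd⟩ ⟨map_zero _, by simp⟩), fun v => by
      obtain ⟨d, rfl⟩ := hq v
      obtain ⟨d', ⟨h1, h2⟩, -⟩ := hb (π (T d))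
      exact ⟨⟨d - d', by rw [hA, map_sub, map_sub, h2, sub_self]⟩, by simp [h1]⟩⟩
  have : FiniteDimensional ℂ A := qA.symm.finiteDimensional
  let φ : A →ₗ[ℂ] LinearMap.ker π :=
    LinearMap.codRestrict (LinearMap.ker π) (T ∘ₗ A.subtype) fun a => a.2
  let ψ : LinearMap.ker π →ₗ[ℂ] C := γ.domRestrict (LinearMap.ker π)
  have h1 : LinearMap.range ψ = LinearMap.range γ := by
    apply le_antisymm
    · rintro _ ⟨b, rfl⟩; exact ⟨b, rfl⟩
    · rintro _ ⟨b, rfl⟩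
      obtain ⟨d, ⟨-, h2⟩, -⟩ := hb (π b)
      refine ⟨⟨b - T d, by simp [h2]⟩, ?_⟩
      have : γ (T d) = 0 := (hγ _).2 ⟨d, rfl⟩
      simp [ψ, this]
  have h2 : LinearMap.ker ψ = LinearMap.range φ := by
    ext ⟨b, hb'⟩
    have : (⟨b, hb'⟩ : LinearMap.ker π) ∈ LinearMap.ker ψ ↔ ∃ d, T d = b := (hγ b)
    rw [this]
    constructor
    · rintro ⟨d, rfl⟩; exact ⟨⟨d, hb'⟩, rfl⟩
    · rintro ⟨d, h⟩; exact ⟨d.1, congrArg Subtype.val h⟩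
  have h3 : (LinearMap.ker φ).map A.subtype = LinearMap.ker T := by
    ext d
    constructor
    · rintro ⟨a, ha, rfl⟩; exact congrArg Subtype.val ha
    · intro hd
      exact ⟨⟨d, by rw [hA, show T d = 0 from hd, map_zero]⟩, Subtype.ext hd, rfl⟩
  have h4 := LinearMap.finrank_range_add_finrank_ker φ
  have h5 := LinearMap.finrank_range_add_finrank_ker ψ
  have h6 : Module.finrank ℂ (LinearMap.ker T) = Module.finrank ℂ (LinearMap.ker φ) := by
    rw [← h3, Submodule.finrank_map_subtype_eq]
  refine ⟨?_, ?_, ?_⟩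
  · rw [← h1]; infer_instance
  · rw [← h3]; infer_instance
  · rw [← h1, h6, ← qA.finrank_eq]
    rw [h2] at h5
    omega

/-- A regularity principle: solutions descend along compatible block decompositions. -/
lemma exists_of_compatible_blocks (T : D →ₗ[ℂ] B) (q : D →ₗ[ℂ] V)
    (π : B →ₗ[ℂ] W) (T' : D' →ₗ[ℂ] B') (q' : D' →ₗ[ℂ] V) (π' : B' →ₗ[ℂ] W')
    (iD : D →ₗ[ℂ] D') (iB : B →ₗ[ℂ] B') (hT : ∀ d, T' (iD d) = iB (T d))
    (hq : ∀ d', ∃ d, q' d' = q' (iD d)) (hiq : ∀ d, q d = 0 → q' (iD d) = 0)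
    (hiπ : ∀ b, π b = 0 → π' (iB b) = 0) (hs : ∀ w, ∃ d, q d = 0 ∧ π (T d) = w)
    (hi : ∀ d', q' d' = 0 → π' (T' d') = 0 → d' = 0) {d' : D'} {u : B} (h : T' d' = iB u) :
    ∃ d, iD d = d' := by
  obtain ⟨d, hd⟩ := hq d'
  obtain ⟨d₁, h1, h2⟩ := hs (π (u - T d))
  refine ⟨d + d₁, ?_⟩
  have := hi (d' - iD (d + d₁)) (by simp [hd, hiq d₁ h1]) (by
    rw [map_sub, h, hT, ← map_sub]
    exact hiπ _ (by rw [map_add, map_sub, map_add, h2, map_sub]; abel))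
  exact (sub_eq_zero.1 this).symm

end LinearAlgebra

namespace Wiener

/-- Dilation of power series. -/
noncomputable def dil (s : ℂ) (hs : ‖s‖ ≤ 1) : Wiener →ₗ[ℂ] Wiener where
  toFun a := mk (fun n => s ^ n * a.coeff n) (a.summable_norm_coeff.of_nonneg_of_le
    (fun _ => norm_nonneg _) fun n => by
      rw [norm_mul, norm_pow]
      exact mul_le_of_le_one_left (norm_nonneg _) (pow_le_one₀ (norm_nonneg _) hs))
  map_add' a b := by ext n; simp [mul_add]
  map_smul' c a := by ext n; simp; ring

@[simp] lemma coeff_dil (s : ℂ) (hs : ‖s‖ ≤ 1) (a : Wiener) (n : ℕ) :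
    (dil s hs a).coeff n = s ^ n * a.coeff n := rfl

lemma eval_dil {s : ℂ} (hs : ‖s‖ ≤ 1) (a : Wiener) {ξ : ℂ} (h : ‖ξ‖ < 1) :
    eval ξ (dil s hs a) = eval (ξ * s) a := by
  have h2 : ‖ξ * s‖ < 1 := by
    rw [norm_mul]; exact lt_of_le_of_lt (mul_le_of_le_one_right (norm_nonneg _) hs) h
  refine (hasSum_eval_apply h _).unique ?_
  convert hasSum_eval_apply h2 a using 2 with n
  rw [coeff_dil, mul_pow]; ring

lemma prim_dil {s : ℂ} (hs : ‖s‖ ≤ 1) (a : Wiener) :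
    prim (s • dil s hs a) = dil s hs (prim a) := by
  ext n
  cases n with
  | zero => simp
  | succ n => simp; ring

variable {ι : Type*} [Fintype ι]

/-- The operator `(a₀, b) ↦ c X^m b + N (a₀ + ∫ b)`. -/
noncomputable def ode (c : ℂ) (m : ℕ) (N : Matrix ι ι Wiener) :
    ((ι → ℂ) × (ι → Wiener)) →ₗ[ℂ] (ι → Wiener) where
  toFun d := c • (fun i => X ^ m * d.2 i) + N.mulVec fun i => algebraMap ℂ _ (d.1 i) + prim (d.2 i)
  map_add' d d' := by
    have : (fun i => algebraMap ℂ Wiener ((d + d').1 i) + prim ((d + d').2 i)) =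
      (fun i => algebraMap ℂ _ (d.1 i) + prim (d.2 i)) +
        fun i => algebraMap ℂ _ (d'.1 i) + prim (d'.2 i) := by
      funext i; simp; abel
    rw [this, Matrix.mulVec_add]
    funext i
    simp [mul_add]
    abel
  map_smul' r d := by
    have : (fun i => algebraMap ℂ Wiener ((r • d).1 i) + prim ((r • d).2 i)) =
      r • (fun i => algebraMap ℂ _ (d.1 i) + prim (d.2 i)) := by
      funext i; simp [Algebra.algebraMap_eq_smul_one, smul_smul]
    rw [this, Matrix.mulVec_smul]
    funext i
    simp [smul_smul, mul_comm]

/-- Projection to the initial coefficients. -/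
noncomputable def initial (K : ℕ) :
    ((ι → ℂ) × (ι → Wiener)) →ₗ[ℂ] ((ι → ℂ) × (ι → Fin K → ℂ)) where
  toFun d := (d.1, fun i j => (d.2 i).coeff j)
  map_add' _ _ := rfl
  map_smul' _ _ := rfl

/-- The componentwise shift. -/
noncomputable def shifts (ι : Type*) (k : ℕ) : (ι → Wiener) →ₗ[ℂ] (ι → Wiener) :=
  (shift k : Wiener →ₗ[ℂ] Wiener).compLeft ι

omit [Fintype ι] in
@[simp] lemma shifts_apply (k : ℕ) (a : ι → Wiener) (i : ι) :
    shifts ι k a i = shift k (a i) := rfl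

omit [Fintype ι] in
lemma initial_surjective (K : ℕ) : Function.Surjective (initial (ι := ι) K) := fun v =>
  ⟨(v.1, fun i => poly K (v.2 i)), by
    ext
    · rfl
    · rename_i i j
      change (poly K (v.2 i)).coeff j = _
      simp [coeff_poly]⟩

omit [Fintype ι] in
lemma initial_eq_zero {K : ℕ} {d : (ι → ℂ) × (ι → Wiener)} :
    initial K d = 0 ↔ ∃ β : ι → Wiener, d = (0, fun i => X ^ K * β i) := by
  constructor
  · intro h
    have h1 : d.1 = 0 := congrArg Prod.fst h
    refine ⟨fun i => shift K (d.2 i), Prod.ext h1 (funext fun i => ?_)⟩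
    have : (fun j : Fin K => (d.2 i).coeff j) = 0 := congrFun (congrArg Prod.snd h) i
    conv_lhs => rw [← poly_add_X_pow_mul_shift K (d.2 i), this]
    simp
  · rintro ⟨β, rfl⟩
    ext
    · rfl
    · rename_i i j
      change (X ^ K * β i).coeff j = 0
      simp [coeff_X_pow_mul]

/-- For large `K` the block of high order terms of `ode` is bijective. -/
lemma eventually_existsUnique_ode {c : ℂ} (hc : c ≠ 0) (m : ℕ) (N : Matrix ι ι Wiener) :
    ∀ᶠ K in atTop, ∀ w : ι → Wiener,
      ∃! d, initial K d = 0 ∧ shifts ι (K + m) (ode c m N d) = w := by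
  let C : ℝ := ∑ i, ∑ j, ‖N i j‖
  have hlim : Tendsto (fun K : ℕ => ‖c⁻¹‖ * ((1 / ((K : ℝ) + 1)) * C)) atTop (𝓝 0) := by
    simpa using (tendsto_one_div_add_atTop_nhds_zero_nat.mul_const C).const_mul ‖c⁻¹‖
  filter_upwards [hlim.eventually (gt_mem_nhds zero_lt_one)] with K hK
  let t : (ι → Wiener) →L[ℂ] (ι → Wiener) := LinearMap.mkContinuous
    { toFun := fun β i => shift (K + m) (∑ j, N i j * prim (X ^ K * β j))
      map_add' := fun a b => by funext i; simp [mul_add, Finset.sum_add_distrib]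
      map_smul' := fun r b => by funext i; simp [Finset.smul_sum] }
    ((1 / ((K : ℝ) + 1)) * C) fun β => by
      refine (pi_norm_le_iff_of_nonneg (by positivity)).2 fun i => ?_
      refine (norm_shift_le _ _).trans ((norm_sum_le _ _).trans ?_)
      calc ∑ j, ‖N i j * prim (X ^ K * β j)‖
          ≤ ∑ j, ‖N i j‖ * ((1 / ((K : ℝ) + 1)) * ‖β‖) := by
            refine Finset.sum_le_sum fun j _ => (norm_mul_le _ _).trans ?_
            gcongr
            refine (norm_prim_X_pow_le _ _).trans ?_
            gcongr
            exact norm_le_pi_norm β j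
        _ = (∑ j, ‖N i j‖) * ((1 / ((K : ℝ) + 1)) * ‖β‖) := by rw [Finset.sum_mul]
        _ ≤ C * ((1 / ((K : ℝ) + 1)) * ‖β‖) := by
            gcongr
            exact Finset.single_le_sum (f := fun i => ∑ j, ‖N i j‖)
              (fun i _ => by positivity) (Finset.mem_univ i)
        _ = _ := by ring
  have ht : ‖-(c⁻¹ • t)‖ < 1 := by
    rw [norm_neg, norm_smul]
    refine lt_of_le_of_lt ?_ hK
    gcongr
    exact LinearMap.mkContinuous_norm_le _ (by positivity) _
  have hbij := ContinuousLinearMap.isUnit_iff_bijective.1 (isUnit_one_sub_of_norm_lt_one ht)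
  have hS : ∀ β : ι → Wiener, shifts ι (K + m) (ode c m N (0, fun i => X ^ K * β i)) =
      c • (1 - -(c⁻¹ • t)) β := by
    intro β
    have h1 : (1 - -(c⁻¹ • t)) β = β + c⁻¹ • t β := by simp
    rw [h1, smul_add, smul_smul, mul_inv_cancel₀ hc, one_smul]
    funext i
    have h2 : X ^ m * (X ^ K * β i) = X ^ (K + m) * β i := by rw [pow_add]; ring
    simp only [shifts_apply, ode, LinearMap.coe_mk, AddHom.coe_mk, Pi.add_apply, Pi.smul_apply,
      map_add, map_smul, h2, shift_X_pow_mul]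
    congr 1
    simp [t, Matrix.mulVec, dotProduct]
  intro w
  obtain ⟨β, hβ⟩ := hbij.2 (c⁻¹ • w)
  refine ⟨(0, fun i => X ^ K * β i), ⟨initial_eq_zero.2 ⟨β, rfl⟩, ?_⟩, ?_⟩
  · rw [hS, hβ, smul_smul, mul_inv_cancel₀ hc, one_smul]
  · rintro d ⟨h1, h2⟩
    obtain ⟨β', rfl⟩ := initial_eq_zero.1 h1
    rw [hS] at h2
    have : β' = β := hbij.1 (by rw [hβ, ← h2, smul_smul, inv_mul_cancel₀ hc, one_smul])
    rw [this]

end Wiener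

/-! ### The index of a linear differential system in one variable -/

namespace Wiener

variable {ι : Type*}

lemma poly_injective (n : ℕ) : Function.Injective (poly n) := fun c c' h => by
  have : poly n (c - c') + X ^ n * 0 = 0 := by simp [h]
  exact sub_eq_zero.1 (poly_add_X_pow_mul_eq_zero this).1

/-- Tuples of polynomials. -/
noncomputable def polys (ι : Type*) (k : ℕ) : (ι → Fin k → ℂ) →ₗ[ℂ] (ι → Wiener) :=
  (poly k : (Fin k → ℂ) →ₗ[ℂ] Wiener).compLeft ι

lemma range_polys (k : ℕ) : LinearMap.range (polys ι k) = LinearMap.ker (shifts ι k) := by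
  apply le_antisymm
  · rintro _ ⟨c, rfl⟩
    exact funext fun i => shift_poly k (c i)
  · intro a ha
    refine ⟨fun i j => (a i).coeff j, funext fun i => ?_⟩
    have h : shift k (a i) = 0 := congrFun ha i
    have := poly_add_X_pow_mul_shift k (a i)
    rwa [h, mul_zero, add_zero] at this

lemma polys_injective (k : ℕ) : Function.Injective (polys ι k) := fun _ _ h =>
  funext fun i => poly_injective k (congrFun h i)

variable [Fintype ι]

instance (k : ℕ) : FiniteDimensional ℂ (LinearMap.ker (shifts ι k)) := by
  rw [← range_polys]; infer_instance

lemma finrank_ker_shifts (k : ℕ) :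
    Module.finrank ℂ (LinearMap.ker (shifts ι k)) = Fintype.card ι * k := by
  rw [← range_polys, LinearMap.finrank_range_of_inj (polys_injective k)]
  simp [Module.finrank_pi_fintype]

end Wiener

namespace Og

variable {ι : Type*}

/-- Tuples of germs from tuples of elements of the Wiener algebra. -/
noncomputable def germs (ι : Type*) (ρ : ℝ) : (ι → Wiener) →ₗ[ℂ] (ι → Og ℂ) :=
  (toGerm ρ).toLinearMap.compLeft ι

lemma germs_apply (ρ : ℝ) (a : ι → Wiener) (i : ι) : germs ι ρ a i = toGerm ρ (a i) := rfl

lemma germs_injective {ρ : ℝ} (hρ : 0 < ρ) : Function.Injective (germs ι ρ) := fun _ _ h =>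
  funext fun i => toGerm_injective hρ (congrFun h i)

/-- Tuples of germs from their initial values and derivatives. -/
noncomputable def primGerms (ι : Type*) (ρ : ℝ) :
    ((ι → ℂ) × (ι → Wiener)) →ₗ[ℂ] (ι → Og ℂ) where
  toFun d i := toGerm ρ (algebraMap ℂ _ (d.1 i) + Wiener.prim (d.2 i))
  map_add' d d' := by funext i; simp; abel
  map_smul' r d := by
    funext i
    change toGerm ρ (algebraMap ℂ _ (r * d.1 i) + Wiener.prim (r • d.2 i)) = r • toGerm ρ _
    rw [← map_smul, smul_add, map_smul, map_mul, ← Algebra.smul_def]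

lemma primGerms_apply (ρ : ℝ) (d : (ι → ℂ) × (ι → Wiener)) (i : ι) : primGerms ι ρ d i =
    toGerm ρ (algebraMap ℂ _ (d.1 i) + Wiener.prim (d.2 i)) := rfl

lemma ev_primGerms (ρ : ℝ) (d : (ι → ℂ) × (ι → Wiener)) (i : ι) :
    ev (primGerms ι ρ d i) = d.1 i := by
  rw [primGerms_apply, ev_toGerm]
  simp [Wiener.coeff_algebraMap]

lemma pd_primGerms (ρ : ℝ) (d : (ι → ℂ) × (ι → Wiener)) (i : ι) :
    pd 1 (primGerms ι ρ d i) = (ρ : ℂ)⁻¹ • toGerm ρ (d.2 i) := by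
  rw [primGerms_apply, map_add, pd_add, pd_toGerm_prim, AlgHom.commutes, pd_algebraMap, zero_add]

lemma primGerms_injective {ρ : ℝ} (hρ : 0 < ρ) : Function.Injective (primGerms ι ρ) := by
  rw [← LinearMap.ker_eq_bot, LinearMap.ker_eq_bot']
  intro d h
  have hρ' : (ρ : ℂ)⁻¹ ≠ 0 := by simpa using hρ.ne'
  refine Prod.ext (funext fun i => ?_) (funext fun i => toGerm_injective hρ ?_)
  · rw [← ev_primGerms ρ d i, h]; simp
  · have := pd_primGerms ρ d i
    rw [h] at this
    have h0 : pd 1 (0 : Og ℂ) = 0 := (D (1 : ℂ)).map_zero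
    have := (smul_eq_zero.1 (this.symm.trans h0)).resolve_left hρ'
    rw [this]; simp

lemma ext_of_pd {a b : Og ℂ} (h : pd 1 a = pd 1 b) (h0 : ev a = ev b) : a = b := by
  have h1 : pd 1 (a - b) = 0 := by
    have := (D (1 : ℂ)).map_sub a b
    simpa [h] using this
  have := algebraMap_of_pd_eq_zero h1
  rw [map_sub, h0, sub_self, map_zero] at this
  exact sub_eq_zero.1 this.symm

variable [Fintype ι]

/-- The operator `a ↦ M a' + N a`. -/
noncomputable def ode (M N : Matrix ι ι (Og ℂ)) : (ι → Og ℂ) →ₗ[ℂ] (ι → Og ℂ) where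
  toFun a := M.mulVec (fun i => pd 1 (a i)) + N.mulVec a
  map_add' a b := by
    have : (fun i => pd 1 ((a + b) i)) = (fun i => pd 1 (a i)) + fun i => pd 1 (b i) :=
      funext fun i => pd_add _ _ _
    rw [this, Matrix.mulVec_add, Matrix.mulVec_add]; abel
  map_smul' r a := by
    have : (fun i => pd 1 ((r • a) i)) = r • fun i => pd 1 (a i) :=
      funext fun i => (D (1 : ℂ)).map_smul r (a i)
    rw [this, Matrix.mulVec_smul, Matrix.mulVec_smul]; simp

lemma ode_apply (M N : Matrix ι ι (Og ℂ)) (a : ι → Og ℂ) :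
    ode M N a = M.mulVec (fun i => pd 1 (a i)) + N.mulVec a := rfl

lemma eventually_germs (u : ι → Og ℂ) : ∀ᶠ ρ in 𝓝[>] (0 : ℝ), ∃ a, germs ι ρ a = u := by
  filter_upwards [eventually_all.2 fun i => eventually_mem_range_toGerm (u i)] with ρ h
  choose a ha using h
  exact ⟨a, funext ha⟩

lemma eventually_primGerms (u : ι → Og ℂ) : ∀ᶠ ρ in 𝓝[>] (0 : ℝ), ∃ d, primGerms ι ρ d = u := by
  filter_upwards [eventually_germs (fun i => pd 1 (u i)), self_mem_nhdsWithin] with ρ h hρ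
  have hρ' : (ρ : ℂ) ≠ 0 := by simpa using (ne_of_gt hρ)
  obtain ⟨a, ha⟩ := h
  refine ⟨(fun i => ev (u i), (ρ : ℂ) • a), funext fun i => ext_of_pd ?_ ?_⟩
  · rw [pd_primGerms, ← congrFun ha i]
    change (ρ : ℂ)⁻¹ • toGerm ρ ((ρ : ℂ) • a i) = toGerm ρ (a i)
    rw [map_smul, smul_smul, inv_mul_cancel₀ hρ', one_smul]
  · rw [ev_primGerms]

lemma eventually_matrix (N : Matrix ι ι (Og ℂ)) :
    ∀ᶠ ρ in 𝓝[>] (0 : ℝ), ∃ N' : Matrix ι ι Wiener, N'.map (toGerm ρ) = N := by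
  filter_upwards [eventually_all.2 fun i => eventually_germs (N i)] with ρ h
  choose a ha using h
  exact ⟨Matrix.of a, Matrix.ext fun i j => congrFun (ha i) j⟩

lemma map_mulVec_germs (ρ : ℝ) (N : Matrix ι ι Wiener) (a : ι → Wiener) :
    (N.map (toGerm ρ)).mulVec (germs ι ρ a) = germs ι ρ (N.mulVec a) :=
  funext fun i => (RingHom.map_mulVec (toGerm ρ).toRingHom N a i).symm

lemma x_pow_smul_one_mulVec [DecidableEq ι] (m : ℕ) (a : ι → Og ℂ) :
    ((x ^ m) • (1 : Matrix ι ι (Og ℂ))).mulVec a = fun i => x ^ m * a i := by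
  rw [Matrix.smul_mulVec, Matrix.one_mulVec]; rfl

lemma ode_primGerms [DecidableEq ι] {ρ : ℝ} (hρ : 0 < ρ) (m : ℕ) (N : Matrix ι ι Wiener)
    (d : (ι → ℂ) × (ι → Wiener)) :
    ode (x ^ m • 1) (N.map (toGerm ρ)) (primGerms ι ρ d) =
      germs ι ρ (Wiener.ode ((ρ : ℂ) ^ m * (ρ : ℂ)⁻¹) m N d) := by
  have h : primGerms ι ρ d =
    germs ι ρ (fun i => algebraMap ℂ _ (d.1 i) + Wiener.prim (d.2 i)) := rfl
  rw [ode_apply, x_pow_smul_one_mulVec]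
  conv_lhs => rw [h, map_mulVec_germs]
  funext i
  simp only [Wiener.ode, LinearMap.coe_mk, AddHom.coe_mk, map_add, Pi.add_apply, ← h,
    pd_primGerms, map_smul, Pi.smul_apply]
  congr 1
  rw [germs_apply, map_mul, map_pow, ← toGerm_X hρ, map_smul, smul_pow, mul_smul_comm,
    smul_mul_assoc, smul_smul, mul_comm]

lemma toGerm_dil {ρ ρ' : ℝ} (hs : ‖((ρ' / ρ : ℝ) : ℂ)‖ ≤ 1) (h : 0 < ρ') (a : Wiener) :
    toGerm ρ' (Wiener.dil ((ρ' / ρ : ℝ) : ℂ) hs a) = toGerm ρ a := by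
  rw [toGerm_apply, toGerm_apply]
  refine ofFun_eq_iff.2 ?_
  filter_upwards [eventually_norm_div_lt' ρ'] with z hz
  have : (ρ' : ℂ) ≠ 0 := by exact_mod_cast h.ne'
  rw [Wiener.eval_dil hs a hz]
  congr 2
  push_cast
  field_simp

/-- Solutions of a differential system converge where the system does. -/
lemma exists_primGerms_of_ode [DecidableEq ι] {ρ : ℝ} (hρ : 0 < ρ) (m : ℕ) (N : Matrix ι ι Wiener)
    {a : ι → Og ℂ} {u : ι → Wiener}
    (h : ode (x ^ m • 1) (N.map (toGerm ρ)) a = germs ι ρ u) : ∃ d, primGerms ι ρ d = a := by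
  obtain ⟨ρ', ⟨d', rfl⟩, h1, h2⟩ := ((eventually_primGerms a).and
    (Ioo_mem_nhdsGT hρ)).exists
  have hρ' : 0 < ρ' := h1
  have hs : ‖((ρ' / ρ : ℝ) : ℂ)‖ ≤ 1 := by
    rw [Complex.norm_real, Real.norm_of_nonneg (by positivity), div_le_one hρ]; exact h2.le
  have hs0 : ((ρ' / ρ : ℝ) : ℂ) ≠ 0 := by exact_mod_cast (div_pos hρ' hρ).ne'
  set s : ℂ := ((ρ' / ρ : ℝ) : ℂ) with hsdef
  let iB : (ι → Wiener) →ₗ[ℂ] (ι → Wiener) := (Wiener.dil s hs).compLeft ι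
  let iD : ((ι → ℂ) × (ι → Wiener)) →ₗ[ℂ] ((ι → ℂ) × (ι → Wiener)) :=
    LinearMap.prodMap LinearMap.id (s • iB)
  have hiB : ∀ b, germs ι ρ' (iB b) = germs ι ρ b := fun b =>
    funext fun i => toGerm_dil hs hρ' _
  have hiD : ∀ d, primGerms ι ρ' (iD d) = primGerms ι ρ d := fun d => by
    funext i
    rw [primGerms_apply, primGerms_apply, ← toGerm_dil hs hρ', map_add (Wiener.dil s hs)]
    congr 2
    · ext n
      simp only [Wiener.coeff_dil, Wiener.coeff_algebraMap]
      cases n <;> simp [iD]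
    · exact Wiener.prim_dil hs _
  let N' : Matrix ι ι Wiener := N.map (Wiener.dil s hs)
  have hN' : N'.map (toGerm ρ') = N.map (toGerm ρ) :=
    Matrix.ext fun i j => toGerm_dil hs hρ' _
  have hc : ∀ {r : ℝ}, 0 < r → (r : ℂ) ^ m * (r : ℂ)⁻¹ ≠ 0 := fun {r} hr => by
    have : (r : ℂ) ≠ 0 := by exact_mod_cast hr.ne'
    positivity
  obtain ⟨K, hK, hK'⟩ := ((Wiener.eventually_existsUnique_ode (hc hρ) m N).and
    (Wiener.eventually_existsUnique_ode (hc hρ') m N')).exists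
  obtain ⟨d, hd⟩ := exists_of_compatible_blocks
    (Wiener.ode ((ρ : ℂ) ^ m * (ρ : ℂ)⁻¹) m N) (Wiener.initial K) (Wiener.shifts ι (K + m))
    (Wiener.ode ((ρ' : ℂ) ^ m * (ρ' : ℂ)⁻¹) m N') (Wiener.initial K) (Wiener.shifts ι (K + m))
    iD iB (fun d => germs_injective hρ' (by
      rw [← ode_primGerms hρ', hiB, ← ode_primGerms hρ, hiD, hN']))
    (fun d' => ⟨(d'.1, fun i => Wiener.poly K fun j => s⁻¹ * (s ^ (j : ℕ))⁻¹ * (d'.2 i).coeff j), by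
      refine Prod.ext rfl (funext fun i => funext fun j => ?_)
      change (d'.2 i).coeff j = s * (s ^ (j : ℕ) * (Wiener.poly K _).coeff j)
      rw [Wiener.coeff_poly]
      simp only [Fin.is_lt, dite_true]
      field_simp⟩)
    (fun d hd => by
      refine Prod.ext (congrArg Prod.fst hd :) (funext fun i => funext fun j => ?_)
      have : (d.2 i).coeff j = 0 := congrFun (congrFun (congrArg Prod.snd hd) i) j
      change s * (s ^ (j : ℕ) * (d.2 i).coeff j) = 0
      rw [this]; simp)
    (fun b hb => funext fun i => by
      have h1 : Wiener.shift (K + m) (b i) = 0 := congrFun hb i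
      rw [Wiener.shift_eq_zero_iff] at h1
      change Wiener.shift (K + m) (Wiener.dil s hs (b i)) = 0
      rw [Wiener.shift_eq_zero_iff]
      intro n hn
      rw [Wiener.coeff_dil, h1 n hn, mul_zero])
    (fun w => (hK w).exists)
    (fun d' h1 h2 => (hK' 0).unique ⟨h1, h2⟩ ⟨map_zero _, by simp⟩)
    (d' := d') (u := u) (germs_injective hρ' (by
      rw [← ode_primGerms hρ', hN', h, hiB]))
  exact ⟨d, by rw [← hiD, hd]⟩

/-- The index of `x^m d/dx + N`. -/
theorem index_ode [DecidableEq ι] (m : ℕ) (N : Matrix ι ι (Og ℂ)) :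
    FiniteDimensional ℂ ((ι → Og ℂ) ⧸ LinearMap.range (ode (x ^ m • 1) N)) ∧
    FiniteDimensional ℂ (LinearMap.ker (ode (x ^ m • 1) N)) ∧
    Module.finrank ℂ ((ι → Og ℂ) ⧸ LinearMap.range (ode (x ^ m • 1) N)) + Fintype.card ι =
      Fintype.card ι * m + Module.finrank ℂ (LinearMap.ker (ode (x ^ m • 1) N)) := by
  set L := ode (x ^ m • 1) N with hL
  let γ : ℝ → (ι → Wiener) →ₗ[ℂ] ((ι → Og ℂ) ⧸ LinearMap.range L) := fun ρ =>
    (LinearMap.range L).mkQ ∘ₗ germs ι ρ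
  have key : ∀ {ρ : ℝ}, 0 < ρ → (∃ N' : Matrix ι ι Wiener, N'.map (toGerm ρ) = N) →
      FiniteDimensional ℂ (LinearMap.range (γ ρ)) ∧ FiniteDimensional ℂ (LinearMap.ker L) ∧
      Module.finrank ℂ (LinearMap.range (γ ρ)) + Fintype.card ι =
        Fintype.card ι * m + Module.finrank ℂ (LinearMap.ker L) := by
    rintro ρ hρ ⟨N', rfl⟩
    have hρ' : (ρ : ℂ) ≠ 0 := by exact_mod_cast hρ.ne'
    have hc : (ρ : ℂ) ^ m * (ρ : ℂ)⁻¹ ≠ 0 := by positivity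
    obtain ⟨K, hK⟩ := (Wiener.eventually_existsUnique_ode hc m N').exists
    have hγ : ∀ b, γ ρ b = 0 ↔ ∃ d, Wiener.ode ((ρ : ℂ) ^ m * (ρ : ℂ)⁻¹) m N' d = b := by
      intro b
      have : γ ρ b = 0 ↔ ∃ a, L a = germs ι ρ b := by
        simp [γ, Submodule.Quotient.mk_eq_zero]
      rw [this]
      constructor
      · rintro ⟨a, ha⟩
        obtain ⟨d, rfl⟩ := exists_primGerms_of_ode hρ m N' ha
        exact ⟨d, germs_injective hρ (by rw [← ha, hL, ode_primGerms hρ])⟩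
      · rintro ⟨d, rfl⟩
        exact ⟨primGerms ι ρ d, ode_primGerms hρ _ _ _⟩
    obtain ⟨h1, h2, h3⟩ := index_of_bijective_block _ _ _ _ (Wiener.initial_surjective K) hK hγ
    have h4 : (LinearMap.ker (Wiener.ode ((ρ : ℂ) ^ m * (ρ : ℂ)⁻¹) m N')).map (primGerms ι ρ) =
        LinearMap.ker L := by
      apply le_antisymm
      · rintro _ ⟨d, hd, rfl⟩
        rw [LinearMap.mem_ker, hL, ode_primGerms hρ, show _ = _ from hd, map_zero]
      · intro a ha
        obtain ⟨d, rfl⟩ := exists_primGerms_of_ode hρ m N' (a := a) (u := 0) (by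
          rw [map_zero]; exact ha)
        refine ⟨d, germs_injective hρ ?_, rfl⟩
        rw [← ode_primGerms hρ, map_zero]; exact ha
    refine ⟨h1, by rw [← h4]; infer_instance, ?_⟩
    rw [← h4, (LinearEquiv.finrank_eq (Submodule.equivMapOfInjective _
      (primGerms_injective hρ) _)).symm]
    rw [Wiener.finrank_ker_shifts] at h3
    simp only [Module.finrank_prod, Module.finrank_pi_fintype, Module.finrank_self, mul_one,
      Fintype.card_fin, Finset.sum_const, Finset.card_univ, smul_eq_mul] at h3
    rw [mul_add] at h3
    omega
  obtain ⟨ρ, hN, hρ⟩ := ((eventually_matrix N).and self_mem_nhdsWithin).exists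
  have hρ : 0 < ρ := hρ
  obtain ⟨h1, h2, h3⟩ := key hρ hN
  have htop : LinearMap.range (γ ρ) = ⊤ := by
    rw [eq_top_iff]
    rintro c -
    obtain ⟨u, rfl⟩ := Submodule.mkQ_surjective _ c
    obtain ⟨ρ', ⟨⟨a, ha⟩, hN'⟩, h1', hlt⟩ := (((eventually_germs u).and (eventually_matrix N)).and
      (Ioo_mem_nhdsGT hρ)).exists
    have hρ' : 0 < ρ' := h1'
    obtain ⟨k1, k2, k3⟩ := key hρ' hN'
    have hs : ‖((ρ' / ρ : ℝ) : ℂ)‖ ≤ 1 := by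
      rw [Complex.norm_real, Real.norm_of_nonneg (by positivity), div_le_one hρ]; exact hlt.le
    have hle : LinearMap.range (γ ρ) ≤ LinearMap.range (γ ρ') := by
      rintro _ ⟨b, rfl⟩
      refine ⟨(Wiener.dil _ hs).compLeft ι b, ?_⟩
      have : germs ι ρ' ((Wiener.dil _ hs).compLeft ι b) = germs ι ρ b :=
        funext fun i => toGerm_dil hs hρ' _
      simp only [γ, LinearMap.comp_apply, this]
    rw [Submodule.eq_of_le_of_finrank_eq hle (by omega)]
    exact ⟨a, by simp [γ, ha]⟩
  rw [htop] at h1 h3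
  rw [finrank_top] at h3
  exact ⟨Module.Finite.equiv (Submodule.topEquiv), h2, h3⟩

end Og

namespace Og

variable {ι : Type*} [Fintype ι] [DecidableEq ι]

/-- A matrix of one-variable germs with non-zero determinant can be multiplied into `x ^ m`. -/
lemma exists_mul_eq_x_pow {M : Matrix ι ι (Og ℂ)} (hM : M.det ≠ 0) :
    ∃ (m : ℕ) (A : Matrix ι ι (Og ℂ)), A * M = x ^ m • 1 ∧ M * A = x ^ m • 1 := by
  obtain ⟨m, ε, hε, h⟩ := exists_eq_x_pow_mul hM
  obtain ⟨ε', hε'⟩ := hε.exists_left_inv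
  have h' : ε' * M.det = x ^ m := by rw [h]; linear_combination x ^ m * hε'
  exact ⟨m, ε' • M.adjugate, by rw [Matrix.smul_mul, Matrix.adjugate_mul, smul_smul, h'],
    by rw [Matrix.mul_smul, Matrix.mul_adjugate, smul_smul, h']⟩

omit [DecidableEq ι] in
lemma mulVec_ode (A M N : Matrix ι ι (Og ℂ)) (a : ι → Og ℂ) :
    A.mulVec (ode M N a) = ode (A * M) (A * N) a := by
  simp only [ode_apply, Matrix.mulVec_add, Matrix.mulVec_mulVec]

/-- Solutions of a differential system with non-zero determinant converge where the system
does. -/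
lemma eventually_exists_primGerms {M : Matrix ι ι (Og ℂ)} (hM : M.det ≠ 0)
    (N : Matrix ι ι (Og ℂ)) : ∀ᶠ ρ in 𝓝[>] (0 : ℝ), ∀ (a : ι → Og ℂ) (u : ι → Wiener),
      ode M N a = germs ι ρ u → ∃ d, primGerms ι ρ d = a := by
  obtain ⟨m, A, hA, -⟩ := exists_mul_eq_x_pow hM
  filter_upwards [eventually_matrix A, eventually_matrix (A * N), self_mem_nhdsWithin]
    with ρ ⟨A', hA'⟩ ⟨N', hN'⟩ hρ a u h
  refine exists_primGerms_of_ode hρ m N' (u := A'.mulVec u) ?_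
  rw [← map_mulVec_germs, ← h, hA', mulVec_ode, hA, hN']

/-- The cokernel of a differential system with non-zero determinant is finite-dimensional. -/
lemma finiteDimensional_coker_ode {M : Matrix ι ι (Og ℂ)} (hM : M.det ≠ 0)
    (N : Matrix ι ι (Og ℂ)) :
    FiniteDimensional ℂ ((ι → Og ℂ) ⧸ LinearMap.range (ode M N)) := by
  obtain ⟨m, A, hA, hA'⟩ := exists_mul_eq_x_pow hM
  have := (index_ode m (A * N)).1
  let mA : (ι → Og ℂ) →ₗ[ℂ] (ι → Og ℂ) := (Matrix.mulVecLin A).restrictScalars ℂ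
  have hmA : ∀ a, mA a = A.mulVec a := fun _ => rfl
  have hle : LinearMap.range (ode M N) ≤
      (LinearMap.range (ode (x ^ m • 1) (A * N))).comap mA := by
    rintro _ ⟨a, rfl⟩
    exact ⟨a, by rw [hmA, mulVec_ode, hA]⟩
  refine FiniteDimensional.of_injective (Submodule.mapQ _ _ mA hle) ?_
  rw [← LinearMap.ker_eq_bot, Submodule.ker_mapQ, eq_bot_iff]
  rintro _ ⟨u, ⟨a, ha⟩, rfl⟩
  refine (Submodule.Quotient.mk_eq_zero _).2 ⟨a, ?_⟩
  rw [hmA, ← hA, ← mulVec_ode] at ha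
  have h : M.mulVec (A.mulVec (ode M N a)) = M.mulVec (A.mulVec u) := by rw [ha]
  rw [Matrix.mulVec_mulVec, Matrix.mulVec_mulVec, hA', x_pow_smul_one_mulVec,
    x_pow_smul_one_mulVec] at h
  funext i
  refine sub_eq_zero.1 (x_pow_mul_eq_zero (m := m) ?_)
  rw [mul_sub, sub_eq_zero]
  exact congrFun h i

end Og

/-! ### Linear differential systems depending on parameters -/

namespace Og

section Family

variable {P X Y : Type*} [NormedAddCommGroup P] [NormedSpace ℂ P] [NormedAddCommGroup X]
  [NormedSpace ℂ X] [NormedAddCommGroup Y] [NormedSpace ℂ Y]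

/-- Multiplication operators between two fixed operators. -/
noncomputable def mulBetween (J : Wiener →L[ℂ] Y) (B : X →L[ℂ] Wiener) :
    Wiener →L[ℂ] X →L[ℂ] Y :=
  (ContinuousLinearMap.compL ℂ X Wiener Y J).comp
    (((ContinuousLinearMap.compL ℂ X Wiener Wiener).flip B).comp (ContinuousLinearMap.mul ℂ Wiener))

lemma mulBetween_apply (J : Wiener →L[ℂ] Y) (B : X →L[ℂ] Wiener) (w : Wiener) (z : X) :
    mulBetween J B w z = J (w * B z) := rfl

end Family

variable {P : Type*} [NormedAddCommGroup P] [NormedSpace ℂ P] {ι : Type*} [Fintype ι]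
  [DecidableEq ι] {r : ℕ}

/-- The domain of the operator family of a differential system: initial values, derivatives, and
coefficients of a basis of the cokernel. -/
abbrev OdeDom (ι : Type*) (r : ℕ) := (ι → ℂ) × (ι → Wiener) × (Fin r → ℂ)

/-- The derivative component. -/
noncomputable def odeDer (ι : Type*) [Fintype ι] (r : ℕ) (ρ : ℝ) (j : ι) :
    OdeDom ι r →L[ℂ] Wiener :=
  (ρ : ℂ)⁻¹ • (ContinuousLinearMap.proj j).comp
    ((ContinuousLinearMap.fst ℂ _ _).comp (ContinuousLinearMap.snd ℂ _ _))

/-- The function component. -/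
noncomputable def odeFun (ι : Type*) [Fintype ι] (r : ℕ) (j : ι) : OdeDom ι r →L[ℂ] Wiener :=
  ((ContinuousLinearMap.proj (R := ℂ) j).comp (ContinuousLinearMap.fst ℂ _ _)).smulRight 1 +
    Wiener.prim.comp ((ContinuousLinearMap.proj j).comp
    ((ContinuousLinearMap.fst ℂ _ _).comp (ContinuousLinearMap.snd ℂ _ _)))

/-- The contribution of the cokernel. -/
noncomputable def odeCoker (ι : Type*) [Fintype ι] (r : ℕ) (E : Fin r → Wiener) :
    OdeDom ι r →L[ℂ] Wiener :=
  ∑ k, ((ContinuousLinearMap.proj (R := ℂ) k).comp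
    ((ContinuousLinearMap.snd ℂ _ _).comp (ContinuousLinearMap.snd ℂ _ _))).smulRight (E k)

/-- The inclusion of a component in the codomain of the operator family. -/
noncomputable def odeIncl (i : ι) : Wiener →L[ℂ] (ι → Wiener) × ℂ :=
  (ContinuousLinearMap.inl ℂ _ _).comp (ContinuousLinearMap.single ℂ (fun _ : ι => Wiener) i)

/-- The operator family of a differential system with parameters. -/
noncomputable def odeFamily (ρ : ℝ) (M N : ι → ι → P → Wiener) (E : Fin r → ι → Wiener) (i₀ : ι)
    (p : P) : OdeDom ι r →L[ℂ] (ι → Wiener) × ℂ :=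
  (∑ i, ∑ j, (mulBetween (odeIncl i) (odeDer ι r ρ j) (M i j p) +
      mulBetween (odeIncl i) (odeFun ι r j) (N i j p))) +
    (∑ i, (odeIncl i).comp (odeCoker ι r fun k => E k i) +
      (ContinuousLinearMap.inr ℂ _ _).comp ((ContinuousLinearMap.proj (R := ℂ) i₀).comp
        (ContinuousLinearMap.fst ℂ _ _)))

omit [NormedAddCommGroup P] [NormedSpace ℂ P] in
lemma odeFamily_apply (ρ : ℝ) (M N : ι → ι → P → Wiener) (E : Fin r → ι → Wiener) (i₀ : ι)
    (p : P) (c : ι → ℂ) (b : ι → Wiener) (s : Fin r → ℂ) :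
    odeFamily ρ M N E i₀ p (c, b, s) =
      (fun i => ∑ j, (M i j p * ((ρ : ℂ)⁻¹ • b j) +
        N i j p * (algebraMap ℂ Wiener (c j) + Wiener.prim (b j))) +
        ∑ k, algebraMap ℂ Wiener (s k) * E k i, c i₀) := by
  have h1 : ∀ (i : ι) (w : Wiener), odeIncl i w = (Pi.single i w, 0) := fun i w => rfl
  have h2 : ∀ j, odeDer ι r ρ j (c, b, s) = (ρ : ℂ)⁻¹ • b j := fun j => rfl
  have h3 : ∀ j, odeFun ι r j (c, b, s) = algebraMap ℂ Wiener (c j) + Wiener.prim (b j) :=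
    fun j => by rw [Algebra.algebraMap_eq_smul_one]; rfl
  have h4 : ∀ i, odeCoker ι r (fun k => E k i) (c, b, s) =
      ∑ k, algebraMap ℂ Wiener (s k) * E k i := fun i => by
    simp [odeCoker, sum_apply, Algebra.smul_def]
  simp only [odeFamily, add_apply, sum_apply, ContinuousLinearMap.comp_apply, mulBetween_apply,
    h1, h2, h3, h4]
  refine Prod.ext (funext fun i => ?_) ?_
  · simp [Prod.fst_sum, Finset.sum_apply, Pi.single_apply, Finset.sum_add_distrib,
      Finset.sum_ite_eq]
  · simp [Prod.snd_sum]

lemma analyticAt_odeFamily (ρ : ℝ) {M N : ι → ι → P → Wiener}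
    (hM : ∀ i j, AnalyticAt ℂ (M i j) 0) (hN : ∀ i j, AnalyticAt ℂ (N i j) 0)
    (E : Fin r → ι → Wiener) (i₀ : ι) : AnalyticAt ℂ (odeFamily ρ M N E i₀) 0 := by
  refine AnalyticAt.fun_add (Finset.analyticAt_fun_sum _ fun i _ =>
    Finset.analyticAt_fun_sum _ fun j _ => AnalyticAt.fun_add ?_ ?_) analyticAt_const
  · exact ((mulBetween (odeIncl i) (odeDer ι r ρ j)).analyticAt _).comp (hM i j)
  · exact ((mulBetween (odeIncl i) (odeFun ι r j)).analyticAt _).comp (hN i j)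

/-- A germ in the last variable, regarded as a germ on a product. -/
noncomputable abbrev outcl (P : Type*) [NormedAddCommGroup P] [NormedSpace ℂ P] :
    Og ℂ →+* Og (P × ℂ) := lpb (ContinuousLinearMap.snd ℂ P ℂ)

lemma Rep.snd_toGerm {ρ : ℝ} (a : Wiener) : Rep ρ (fun _ : P => a) (outcl P (toGerm ρ a)) := by
  refine ⟨analyticAt_const, ?_⟩
  rw [toGerm_apply, pb_ofFun]
  exact rep_ofFun _

lemma rep_odeFamily {ρ : ℝ} {M N : ι → ι → Og (P × ℂ)} {MU NU : ι → ι → P → Wiener}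
    (hM : ∀ i j, Rep ρ (MU i j) (M i j)) (hN : ∀ i j, Rep ρ (NU i j) (N i j))
    (E : Fin r → ι → Wiener) (i₀ : ι) (c : ι → Og P) {b : ι → P → Wiener}
    (hb : ∀ j, AnalyticAt ℂ (b j) 0) {w : ι → Og (P × ℂ)}
    (hw : ∀ j, Rep ρ (fun p => Wiener.prim (b j p)) (w j)) (s : Fin r → Og P) (i : ι) :
    Rep ρ (fun p => (odeFamily ρ MU NU E i₀ p
        (fun j => rep (c j) p, fun j => b j p, fun k => rep (s k) p)).1 i)
      (∑ j, (M i j * pd (0, 1) (w j) + N i j * (incl P (c j) + w j)) +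
        ∑ k, incl P (s k) * outcl P (toGerm ρ (E k i))) := by
  simp only [odeFamily_apply]
  exact (Rep.sum _ fun j _ => ((hM i j).mul ((hw j).pd_prim (hb j))).add
    ((hN i j).mul ((Rep.fst _).add (hw j)))).add
      (Rep.sum _ fun k _ => (Rep.fst _).mul (Rep.snd_toGerm _))

end Og

namespace Og

variable {P : Type*} [NormedAddCommGroup P] [NormedSpace ℂ P] {ι : Type*} [Fintype ι]
  [DecidableEq ι] {r : ℕ}

lemma ode_single {M N : Matrix ι ι (Og ℂ)} {i₀ : ι} (hN : ∀ i, N i i₀ = 0) (c : ℂ) :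
    ode M N (Pi.single i₀ (algebraMap ℂ _ c)) = 0 := by
  have h : (fun i => pd 1 ((Pi.single i₀ (algebraMap ℂ (Og ℂ) c) : ι → Og ℂ) i)) = 0 := by
    funext i
    by_cases hi : i = i₀
    · subst hi; simp [pd_algebraMap]
    · simp only [Pi.single_eq_of_ne hi]; exact (D (1 : ℂ)).map_zero
  rw [ode_apply, h, Matrix.mulVec_zero, zero_add, Matrix.mulVec_single]
  funext i
  simp [hN]

omit [Fintype ι] in
lemma primGerms_single (ρ : ℝ) (i₀ : ι) (c : ℂ) :
    primGerms ι ρ (Pi.single i₀ c, 0) = Pi.single i₀ (algebraMap ℂ _ c) := by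
  funext i
  by_cases hi : i = i₀
  · subst hi; simp [primGerms_apply]
  · simp [primGerms_apply, hi]

omit [NormedSpace ℂ P] in
lemma germs_odeFamily {ρ : ℝ} {M N : Matrix ι ι (Og ℂ)} {MU NU : ι → ι → P → Wiener}
    (hM : ∀ i j, toGerm ρ (MU i j 0) = M i j) (hN : ∀ i j, toGerm ρ (NU i j 0) = N i j)
    (E : Fin r → ι → Wiener) (i₀ : ι) (c : ι → ℂ) (b : ι → Wiener) (s : Fin r → ℂ) :
    germs ι ρ (odeFamily ρ MU NU E i₀ 0 (c, b, s)).1 =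
      ode M N (primGerms ι ρ (c, b)) + ∑ k, s k • germs ι ρ (E k) := by
  rw [odeFamily_apply]
  funext i
  have h1 : ∀ j, pd 1 (toGerm ρ (algebraMap ℂ _ (c j) + Wiener.prim (b j))) =
      toGerm ρ ((ρ : ℂ)⁻¹ • b j) := fun j => by
    rw [map_smul]; exact pd_primGerms ρ (c, b) j
  simp only [germs_apply, map_add, map_sum, map_mul, ode_apply, Pi.add_apply, Finset.sum_apply,
    Matrix.mulVec, dotProduct, Finset.sum_add_distrib, hM, hN, primGerms_apply] at h1 ⊢
  simp only [AlgHom.commutes] at h1 ⊢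
  simp only [h1, ← Algebra.smul_def]
  rfl

omit [NormedSpace ℂ P] in
lemma odeFamily_bijective {ρ : ℝ} (hρ : 0 < ρ) {M N : Matrix ι ι (Og ℂ)}
    {MU NU : ι → ι → P → Wiener}
    (hM : ∀ i j, toGerm ρ (MU i j 0) = M i j) (hN : ∀ i j, toGerm ρ (NU i j 0) = N i j)
    {i₀ : ι} (hN₀ : ∀ i, N i i₀ = 0)
    (hker : ∀ a, ode M N a = 0 → ∃ c : ℂ, a = Pi.single i₀ (algebraMap ℂ _ c))
    {e : Fin r → ι → Og ℂ} (he : ∀ u, ∃! c : Fin r → ℂ, ∃ a, u = ode M N a + ∑ k, c k • e k)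
    {E : Fin r → ι → Wiener} (hE : ∀ k, germs ι ρ (E k) = e k)
    (hreg : ∀ (a : ι → Og ℂ) (u : ι → Wiener), ode M N a = germs ι ρ u →
      ∃ d, primGerms ι ρ d = a) :
    Function.Bijective (odeFamily ρ MU NU E i₀ 0) := by
  constructor
  · refine (injective_iff_map_eq_zero _).2 ?_
    rintro ⟨c, b, s⟩ h
    have h1 := germs_odeFamily hM hN E i₀ c b s
    have h2 : c i₀ = 0 := by
      rw [odeFamily_apply] at h
      exact congrArg Prod.snd h
    simp only [h, hE] at h1
    rw [Prod.fst_zero, map_zero] at h1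
    have hs : s = 0 := (he 0).unique ⟨_, h1⟩ ⟨0, by simp⟩
    subst hs
    obtain ⟨c', hc'⟩ := hker (primGerms ι ρ (c, b)) (by simpa using h1.symm)
    have h3 := ev_primGerms ρ (c, b) i₀
    rw [hc', Pi.single_eq_same, ev_algebraMap] at h3
    rw [h3.trans h2, map_zero, Pi.single_zero] at hc'
    have h4 := primGerms_injective hρ (hc'.trans (map_zero _).symm)
    rw [show c = 0 from congrArg Prod.fst h4, show b = 0 from congrArg Prod.snd h4]
    rfl
  · rintro ⟨v, t⟩
    obtain ⟨s, ⟨a, ha⟩, -⟩ := he (germs ι ρ v)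
    obtain ⟨⟨c, b⟩, hd⟩ := hreg a (v - ∑ k, s k • E k) (by
      rw [map_sub, map_sum]
      simp only [map_smul, hE]
      rw [ha]; abel)
    refine ⟨(c + Pi.single i₀ (t - c i₀), b, s), Prod.ext (germs_injective hρ ?_) ?_⟩
    · rw [germs_odeFamily hM hN]
      have : ((c + Pi.single i₀ (t - c i₀), b) : (ι → ℂ) × (ι → Wiener)) =
        (c, b) + (Pi.single i₀ (t - c i₀), 0) := by simp
      rw [this, map_add, map_add, primGerms_single, ode_single hN₀, add_zero, hd, ha]
      simp only [hE]
    · rw [odeFamily_apply]; simp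

/-- A linear differential system depending on parameters whose restriction to the origin of the
parameter space has one-dimensional kernel and finite-dimensional cokernel: the cokernel is free
over the ring of germs in the parameters. -/
theorem existsUnique_ode_family [FiniteDimensional ℂ P] {M N : Matrix ι ι (Og (P × ℂ))} {i₀ : ι}
    (hN₀ : ∀ i, N i i₀ = 0) (hM₀ : (M.map (line P)).det ≠ 0)
    (hker : ∀ a, ode (M.map (line P)) (N.map (line P)) a = 0 →
      ∃ c : ℂ, a = Pi.single i₀ (algebraMap ℂ _ c))
    {e : Fin r → ι → Og ℂ}
    (he : ∀ u, ∃! c : Fin r → ℂ, ∃ a,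
      u = ode (M.map (line P)) (N.map (line P)) a + ∑ k, c k • e k)
    (u : ι → Og (P × ℂ)) :
    ∃! s : Fin r → Og P, ∃ a : ι → Og (P × ℂ), ∀ i,
      u i = ∑ j, (M i j * pd (0, 1) (a j) + N i j * a j) +
        ∑ k, incl P (s k) * outcl P (e k i) := by
  have good : ∀ᶠ ρ in 𝓝[>] (0 : ℝ), 0 < ρ ∧ ∃ (MU NU : ι → ι → P → Wiener)
      (E : Fin r → ι → Wiener), (∀ i j, Rep ρ (MU i j) (M i j)) ∧
      (∀ i j, Rep ρ (NU i j) (N i j)) ∧ (∀ k i, toGerm ρ (E k i) = e k i) ∧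
      Function.Bijective (odeFamily ρ MU NU E i₀ 0) := by
    filter_upwards [self_mem_nhdsWithin,
      eventually_all.2 fun i => eventually_all.2 fun j => eventually_exists_rep (M i j),
      eventually_all.2 fun i => eventually_all.2 fun j => eventually_exists_rep (N i j),
      eventually_all.2 fun k => eventually_germs (e k),
      eventually_exists_primGerms hM₀ (N.map (line P))] with ρ hρ h1 h2 h3 hreg
    choose MU hMU using h1
    choose NU hNU using h2
    choose E hE using h3
    exact ⟨hρ, MU, NU, E, hMU, hNU, fun k i => congrFun (hE k) i,
      odeFamily_bijective hρ (fun i j => (hMU i j).restrict.symm)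
        (fun i j => (hNU i j).restrict.symm) (fun i => by simp [hN₀]) hker he hE hreg⟩
  have hinit : ∀ (c : ι → Og P) (w : ι → Og (P × ℂ)) (i : ι),
      ∑ j, (M i j * pd (0, 1) (incl P (c j) + w j) + N i j * (incl P (c j) + w j)) =
        ∑ j, (M i j * pd (0, 1) (w j) + N i j * (incl P (c j) + w j)) := by
    intro c w i
    refine Finset.sum_congr rfl fun j _ => ?_
    rw [pd_add, pd_incl, zero_add]
  have hexists : ∃ s : Fin r → Og P, ∃ a : ι → Og (P × ℂ), ∀ i,
      u i = ∑ j, (M i j * pd (0, 1) (a j) + N i j * a j) +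
        ∑ k, incl P (s k) * outcl P (e k i) := by
    obtain ⟨ρ, ⟨hρ, MU, NU, E, hMU, hNU, hE, hb⟩, hU⟩ :=
      (good.and (eventually_all.2 fun i => eventually_exists_rep (u i))).exists
    choose U hU using hU
    have han := analyticAt_odeFamily ρ (fun i j => (hMU i j).1) (fun i j => (hNU i j).1) E i₀
    obtain ⟨h, hh, hs⟩ := (exists_analytic_solution han hb).2 (fun p => ((fun i => U i p), 0))
      (AnalyticAt.prod (AnalyticAt.pi fun i => (hU i).1) analyticAt_const)
    have h1 : ∀ j, AnalyticAt ℂ (fun p => (h p).1 j) 0 := fun j =>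
      ((ContinuousLinearMap.proj j : (ι → ℂ) →L[ℂ] ℂ).analyticAt _).comp
        (analyticAt_fst.comp hh)
    have h2 : ∀ j, AnalyticAt ℂ (fun p => (h p).2.1 j) 0 := fun j =>
      ((ContinuousLinearMap.proj j : (ι → Wiener) →L[ℂ] Wiener).analyticAt _).comp
        (analyticAt_fst.comp (analyticAt_snd.comp hh))
    have h3 : ∀ k, AnalyticAt ℂ (fun p => (h p).2.2 k) 0 := fun k =>
      ((ContinuousLinearMap.proj k : (Fin r → ℂ) →L[ℂ] ℂ).analyticAt _).comp
        (analyticAt_snd.comp (analyticAt_snd.comp hh))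
    have hw : ∀ j, ∃ w : Og (P × ℂ), Rep ρ (fun p => Wiener.prim ((h p).2.1 j)) w := fun j =>
      exists_of_family ρ ((Wiener.prim.analyticAt _).comp (h2 j))
    choose w hw using hw
    refine ⟨fun k => ofFun _ (h3 k), fun j => incl P (ofFun _ (h1 j)) + w j, fun i => ?_⟩
    rw [hinit]
    simp only [← hE]
    refine (hU i).congr (rep_odeFamily hMU hNU E i₀ (fun j => ofFun _ (h1 j)) h2 hw
      (fun k => ofFun _ (h3 k)) i) ?_
    filter_upwards [hs, eventually_all.2 fun j => rep_ofFun (h1 j),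
      eventually_all.2 fun k => rep_ofFun (h3 k)] with p h4 h5 h6
    rw [funext h5, funext h6]
    exact (congrFun (congrArg Prod.fst h4) i).symm
  obtain ⟨s, a, ha⟩ := hexists
  refine ⟨s, ⟨a, ha⟩, ?_⟩
  rintro s' ⟨a', ha'⟩
  obtain ⟨ρ, ⟨hρ, MU, NU, E, hMU, hNU, hE, hb⟩, hV⟩ :=
    (good.and (eventually_all.2 fun i => eventually_exists_rep (pd (0, 1) ((a' - a) i)))).exists
  choose V hV using hV
  have hρ0 : (ρ : ℂ) ≠ 0 := by exact_mod_cast hρ.ne'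
  have hρV : ∀ j, AnalyticAt ℂ (fun p => (ρ : ℂ) • V j p) 0 := fun j =>
    (analyticAt_const (v := (ρ : ℂ))).fun_smul (hV j).1
  have hw : ∀ j, ∃ w : Og (P × ℂ), Rep ρ (fun p => Wiener.prim ((ρ : ℂ) • V j p)) w := fun j =>
    exists_of_family ρ ((Wiener.prim.analyticAt _).comp (hρV j))
  choose w hw using hw
  have hpw : ∀ j, pd (0, 1) (w j) = pd (0, 1) ((a' - a) j) := fun j =>
    ((hw j).pd_prim (hρV j)).congr (hV j) (Eventually.of_forall fun p => by
      change (ρ : ℂ)⁻¹ • (ρ : ℂ) • V j p = V j p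
      rw [smul_smul, inv_mul_cancel₀ hρ0, one_smul])
  have hc : ∀ j, ∃ c : Og P, (a' - a) j = incl P c + w j := fun j => by
    refine ⟨_, sub_eq_iff_eq_add.1 (incl_of_pd_eq_zero (P := P) (g := (a' - a) j - w j) ?_).symm⟩
    have := (D ((0 : P), (1 : ℂ))).map_sub ((a' - a) j) (w j)
    simpa [hpw] using this
  choose c hc using hc
  have hsol : ∀ i, (0 : Og (P × ℂ)) = ∑ j, (M i j * pd (0, 1) (w j) +
      N i j * (incl P ((if j = i₀ then 0 else c j)) + w j)) +
      ∑ k, incl P ((s' - s) k) * outcl P (toGerm ρ (E k i)) := by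
    intro i
    have h1 : ∀ j, M i j * pd (0, 1) (w j) + N i j * (incl P ((if j = i₀ then 0 else c j)) + w j)
        = (M i j * pd (0, 1) (a' j) + N i j * a' j) -
          (M i j * pd (0, 1) (a j) + N i j * a j) := by
      intro j
      have hsub : pd (0, 1) (w j) = pd (0, 1) (a' j) - pd (0, 1) (a j) := by
        have := (D ((0 : P), (1 : ℂ))).map_sub (a' j) (a j)
        rw [hpw]; simpa using this
      have h2 : N i j * (incl P ((if j = i₀ then 0 else c j)) + w j) = N i j * (a' j - a j) := by
        by_cases hj : j = i₀
        · subst hj; rw [hN₀]; simp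
        · rw [if_neg hj, ← hc]; rfl
      rw [hsub, h2]; ring
    have h2 : ∑ k, incl P ((s' - s) k) * outcl P (toGerm ρ (E k i)) =
        ∑ k, incl P (s' k) * outcl P (e k i) - ∑ k, incl P (s k) * outcl P (e k i) := by
      rw [← Finset.sum_sub_distrib]
      refine Finset.sum_congr rfl fun k _ => ?_
      rw [hE, Pi.sub_apply, map_sub, sub_mul]
    rw [Finset.sum_congr rfl fun j _ => h1 j, h2, Finset.sum_sub_distrib]
    linear_combination ha' i - ha i
  have hfam := fun i => Rep.unique hρ Rep.zero (hsol i ▸ rep_odeFamily hMU hNU E i₀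
    (fun j => if j = i₀ then 0 else c j) hρV hw (s' - s) i)
  have hinj := (exists_analytic_solution
    (analyticAt_odeFamily ρ (fun i j => (hMU i j).1) (fun i j => (hNU i j).1) E i₀) hb).1
  have hrep0 : ∀ᶠ p in 𝓝 (0 : P), rep (0 : Og P) p = 0 :=
    rep_ofFun (analyticAt_const (v := (0 : ℂ)) (x := (0 : P)))
  refine sub_eq_zero.1 (funext fun k => ext_rep ?_)
  filter_upwards [eventually_all.2 hfam, hinj, hrep0] with p h1 h2 h3
  have := h2 _ (Prod.ext (funext fun i => (h1 i).symm) (by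
    rw [odeFamily_apply]
    simpa using h3))
  rw [Pi.zero_apply, h3]
  exact congrFun (congrArg (fun z => z.2.2) this) k

end Og

/-! ### Division by a regular germ -/

namespace Og

variable {Z : Type*} [NormedAddCommGroup Z] [NormedSpace ℂ Z] {n : ℕ}

/-- A germ that is regular of order `n` in the last variable. -/
def IsRegular (n : ℕ) (Φ : Og (Z × ℂ)) : Prop := ∃ ε : Og ℂ, IsUnit ε ∧ line Z Φ = x ^ n * ε

/-- The polynomial in the last variable with given coefficients. -/
noncomputable def polyLast (Z : Type*) [NormedAddCommGroup Z] [NormedSpace ℂ Z] (n : ℕ) :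
    (Fin n → Og Z) →+ Og (Z × ℂ) where
  toFun a := ∑ j, incl Z (a j) * last Z ^ (j : ℕ)
  map_zero' := by simp
  map_add' a b := by simp [add_mul, Finset.sum_add_distrib]

lemma polyLast_apply (a : Fin n → Og Z) :
    polyLast Z n a = ∑ j, incl Z (a j) * last Z ^ (j : ℕ) := rfl

lemma polyLast_single (j : Fin n) (c : Og Z) :
    polyLast Z n (Pi.single j c) = incl Z c * last Z ^ (j : ℕ) := by
  rw [polyLast_apply, Finset.sum_eq_single j]
  · simp
  · intro i _ hi; simp [hi]
  · simp

lemma polyLast_mul (c : Og Z) (a : Fin n → Og Z) :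
    polyLast Z n (fun j => c * a j) = incl Z c * polyLast Z n a := by
  rw [polyLast_apply, polyLast_apply, Finset.mul_sum]
  exact Finset.sum_congr rfl fun j _ => by rw [map_mul, mul_assoc]

lemma polyLast_mulVec (M : Matrix (Fin n) (Fin n) (Og Z)) (a : Fin n → Og Z) :
    polyLast Z n (M.mulVec a) = ∑ j, incl Z (a j) * polyLast Z n (fun i => M i j) := by
  have : M.mulVec a = ∑ j, fun i => a j * M i j := by
    funext i
    simp only [Finset.sum_apply, Matrix.mulVec, dotProduct, mul_comm]
  rw [this, map_sum]
  exact Finset.sum_congr rfl fun j _ => polyLast_mul _ _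

lemma pd_last_pow (v : Z) (j : ℕ) : pd (v, 0) (last Z ^ j) = 0 := by
  have h : pd (v, (0 : ℂ)) (last Z) = 0 := by
    rw [last, pd_lpb]
    have : pd (ContinuousLinearMap.snd ℂ Z ℂ (v, 0)) x = 0 := by
      rw [show ContinuousLinearMap.snd ℂ Z ℂ (v, 0) = (0 : ℂ) from rfl, pd_apply]
      exact (ofFun_eq_iff (hh := analyticAt_const (v := (0 : ℂ)))).2
        (Eventually.of_forall fun z => map_zero _)
    rw [this, map_zero]
  induction j with
  | zero => rw [pow_zero, ← map_one (algebraMap ℂ (Og (Z × ℂ)))]; exact pd_algebraMap _ _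
  | succ j ih => rw [pow_succ, pd_mul, ih, h]; simp

lemma pd_fst_polyLast (v : Z) (a : Fin n → Og Z) :
    pd (v, 0) (polyLast Z n a) = polyLast Z n (fun j => pd v (a j)) := by
  rw [polyLast_apply, ← D_apply, map_sum]
  refine Finset.sum_congr rfl fun j _ => ?_
  rw [D_apply, pd_mul, pd_last_pow, pd_lpb]
  rw [show ContinuousLinearMap.fst ℂ Z ℂ (v, 0) = v from rfl]
  ring

lemma pd_snd_polyLast (a : Fin n → Og Z) :
    pd (0, 1) (polyLast Z n a) = ∑ j, incl Z (a j) * pd (0, 1) (last Z ^ (j : ℕ)) := by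
  rw [polyLast_apply, ← D_apply, map_sum]
  refine Finset.sum_congr rfl fun j _ => ?_
  rw [D_apply, pd_mul, pd_incl]
  ring

/-- The Poisson bracket in a direction of the base and the last direction. -/
noncomputable def poisson (v : Z) (Φ g : Og (Z × ℂ)) : Og (Z × ℂ) :=
  pd (v, 0) Φ * pd (0, 1) g - pd (0, 1) Φ * pd (v, 0) g

lemma poisson_mul (v : Z) (Φ a b : Og (Z × ℂ)) :
    poisson v Φ (a * b) = a * poisson v Φ b + b * poisson v Φ a := by
  simp only [poisson, pd_mul]; ring

lemma poisson_add (v : Z) (Φ a b : Og (Z × ℂ)) :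
    poisson v Φ (a + b) = poisson v Φ a + poisson v Φ b := by
  simp only [poisson, pd_add]; ring

lemma poisson_sub (v : Z) (Φ a b : Og (Z × ℂ)) :
    poisson v Φ (a - b) = poisson v Φ a - poisson v Φ b := by
  rw [eq_sub_iff_add_eq, ← poisson_add, sub_add_cancel]

lemma poisson_self (v : Z) (Φ : Og (Z × ℂ)) : poisson v Φ Φ = 0 := by
  simp only [poisson]; ring

lemma poisson_self_mul (v : Z) (Φ g : Og (Z × ℂ)) : poisson v Φ (Φ * g) = Φ * poisson v Φ g := by
  rw [poisson_mul, poisson_self]; ring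

/-- The matrices of the differential system describing the Poisson bracket with `Φ` modulo `Φ`. -/
structure IsSystem (v : Z) (Φ : Og (Z × ℂ)) (M N : Matrix (Fin n) (Fin n) (Og Z)) : Prop where
  der : ∀ j : Fin n, Φ ∣ -pd (0, 1) Φ * last Z ^ (j : ℕ) - polyLast Z n fun i => M i j
  coef : ∀ j : Fin n, Φ ∣ pd (v, 0) Φ * pd (0, 1) (last Z ^ (j : ℕ)) - polyLast Z n fun i => N i j

lemma dvd_mul_polyLast {Φ g : Og (Z × ℂ)} {M : Matrix (Fin n) (Fin n) (Og Z)}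
    {b : Fin n → Og (Z × ℂ)}
    (h : ∀ j, Φ ∣ g * b j - polyLast Z n fun i => M i j) (a : Fin n → Og Z) :
    Φ ∣ g * ∑ j, incl Z (a j) * b j - polyLast Z n (M.mulVec a) := by
  rw [polyLast_mulVec, Finset.mul_sum, ← Finset.sum_sub_distrib]
  refine Finset.dvd_sum fun j _ => ?_
  convert (h j).mul_left (incl Z (a j)) using 1
  ring

lemma IsSystem.dvd {v : Z} {Φ : Og (Z × ℂ)} {M N : Matrix (Fin n) (Fin n) (Og Z)}
    (h : IsSystem v Φ M N) (a : Fin n → Og Z) :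
    Φ ∣ poisson v Φ (polyLast Z n a) -
      polyLast Z n (M.mulVec (fun j => pd v (a j)) + N.mulVec a) := by
  rw [poisson, pd_fst_polyLast, pd_snd_polyLast, map_add]
  have h1 := dvd_mul_polyLast h.der fun j => pd v (a j)
  have h2 := dvd_mul_polyLast h.coef a
  rw [← polyLast_apply] at h1
  convert h1.add h2 using 1
  ring

section

variable [FiniteDimensional ℂ Z] {Φ : Og (Z × ℂ)}

lemma IsRegular.exists_polyLast (h : IsRegular n Φ) (u : Og (Z × ℂ)) :
    ∃ a : Fin n → Og Z, Φ ∣ u - polyLast Z n a := by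
  obtain ⟨ε, hε, hΦ⟩ := h
  obtain ⟨⟨q, a⟩, hqa, -⟩ := weierstrass_division hε hΦ u
  exact ⟨a, q, by rw [polyLast_apply]; linear_combination hqa⟩

lemma IsRegular.polyLast_eq_zero (h : IsRegular n Φ) {a : Fin n → Og Z}
    (ha : Φ ∣ polyLast Z n a) : a = 0 := by
  obtain ⟨ε, hε, hΦ⟩ := h
  obtain ⟨q, hq⟩ := ha
  have := (weierstrass_division hε hΦ (polyLast Z n a)).unique (y₁ := (0, a)) (y₂ := (q, 0))
    (by simp [polyLast_apply]) (by simp [hq])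
  exact congrArg Prod.snd this

lemma IsRegular.eq_zero_of_mul (h : IsRegular n Φ) {q : Og (Z × ℂ)} (hq : Φ * q = 0) : q = 0 := by
  obtain ⟨ε, hε, hΦ⟩ := h
  have := (weierstrass_division hε hΦ 0).unique (y₁ := (q, 0)) (y₂ := (0, 0))
    (by simp [hq]) (by simp)
  exact congrArg Prod.fst this

lemma IsRegular.exists_isSystem (h : IsRegular n Φ) (v : Z) :
    ∃ M N : Matrix (Fin n) (Fin n) (Og Z), IsSystem v Φ M N := by
  choose M hM using fun j : Fin n => h.exists_polyLast (-pd (0, 1) Φ * last Z ^ (j : ℕ))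
  choose N hN using fun j : Fin n =>
    h.exists_polyLast (pd (v, 0) Φ * pd (0, 1) (last Z ^ (j : ℕ)))
  exact ⟨Matrix.of fun i j => M j i, Matrix.of fun i j => N j i, hM, hN⟩

lemma IsSystem.coef_zero {v : Z} {M N : Matrix (Fin n) (Fin n) (Og Z)} (h : IsRegular n Φ)
    (hs : IsSystem v Φ M N) {i₀ : Fin n} (hi₀ : (i₀ : ℕ) = 0) (i : Fin n) : N i i₀ = 0 := by
  have h1 := hs.coef i₀
  have h2 : pd (0, 1) (last Z ^ (i₀ : ℕ)) = 0 := by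
    rw [hi₀, pow_zero, ← map_one (algebraMap ℂ (Og (Z × ℂ)))]; exact pd_algebraMap _ _
  rw [h2, mul_zero, zero_sub, dvd_neg] at h1
  exact congrFun (h.polyLast_eq_zero h1) i

end

end Og

/-! ### Weierstrass polynomials -/

lemma _root_.Polynomial.squarefree_map_of_monic {R K : Type*} [CommRing R] [IsDomain R]
    [IsIntegrallyClosed R] [Field K] [Algebra R K] [IsFractionRing R K] {w : Polynomial R}
    (hw : w.Monic) (h : ∀ p : Polynomial R, p.Monic → p * p ∣ w → p = 1) :
    Squarefree (w.map (algebraMap R K)) := by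
  intro p hp
  have hinj := IsFractionRing.injective R K
  have hW : w.map (algebraMap R K) ≠ 0 := (hw.map _).ne_zero
  have hp0 : p ≠ 0 := by
    rintro rfl
    exact hW (by simpa using hp)
  have hlc : p.leadingCoeff ≠ 0 := Polynomial.leadingCoeff_ne_zero.2 hp0
  obtain ⟨q, hq⟩ := IsIntegrallyClosed.eq_map_mul_C_of_dvd K hw (dvd_of_mul_left_dvd hp)
  have hqm : q.Monic := by
    refine hinj.monic_map_iff.2 ?_
    have h1 := congrArg Polynomial.leadingCoeff hq
    rw [Polynomial.leadingCoeff_mul, Polynomial.leadingCoeff_C] at h1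
    exact mul_right_cancel₀ hlc (by rw [h1, one_mul])
  have hqp : q.map (algebraMap R K) * q.map (algebraMap R K) ∣ w.map (algebraMap R K) := by
    refine (mul_dvd_mul ?_ ?_).trans hp <;> exact ⟨_, hq.symm⟩
  rw [← Polynomial.map_mul, Polynomial.map_dvd_map _ hinj (hqm.mul hqm)] at hqp
  rw [h q hqm hqp] at hq
  rw [← hq]
  simpa using hlc

namespace Og

/-- Polynomials in the second variable as germs. -/
noncomputable def polyGerm : Polynomial (Og ℂ) →+* Og (ℂ × ℂ) :=
  Polynomial.eval₂RingHom (incl ℂ) (last ℂ)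

@[simp] lemma polyGerm_C (a : Og ℂ) : polyGerm (Polynomial.C a) = incl ℂ a :=
  Polynomial.eval₂_C _ _

@[simp] lemma polyGerm_X : polyGerm Polynomial.X = last ℂ := Polynomial.eval₂_X _ _

lemma polyGerm_of_natDegree_lt {n : ℕ} {g : Polynomial (Og ℂ)} (hg : g.natDegree < n) :
    polyGerm g = polyLast ℂ n fun j => g.coeff j := by
  conv_lhs => rw [g.as_sum_range_C_mul_X_pow' hg]
  rw [map_sum, polyLast_apply, Finset.sum_range]
  simp

lemma pd_polyGerm (g : Polynomial (Og ℂ)) :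
    pd (0, 1) (polyGerm g) = polyGerm (Polynomial.derivative g) := by
  induction g using Polynomial.induction_on' with
  | add p q hp hq => rw [map_add, pd_add, hp, hq, Polynomial.derivative_add, map_add]
  | monomial j a =>
    rw [← Polynomial.C_mul_X_pow_eq_monomial, Polynomial.derivative_C_mul_X_pow]
    simp only [map_mul, map_pow, polyGerm_C, polyGerm_X, map_natCast]
    rw [pd_mul, pd_incl, mul_zero, add_zero]
    have h := (D ((0 : ℂ), (1 : ℂ))).leibniz_pow (last ℂ) j
    rw [D_apply, D_apply, pd_last] at h
    rw [h, nsmul_eq_mul, smul_eq_mul]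
    ring

instance : ValuationRing (Og ℂ) where
  cond' a b := by
    by_cases ha : a = 0
    · exact ⟨0, Or.inr (by simp [ha])⟩
    by_cases hb : b = 0
    · exact ⟨0, Or.inl (by simp [hb])⟩
    obtain ⟨m, ε, hε, rfl⟩ := exists_eq_x_pow_mul ha
    obtain ⟨k, δ, hδ, rfl⟩ := exists_eq_x_pow_mul hb
    obtain ⟨ε', hε'⟩ := hε.exists_right_inv
    obtain ⟨δ', hδ'⟩ := hδ.exists_right_inv
    rcases le_total m k with h | h
    · obtain ⟨l, rfl⟩ := Nat.exists_eq_add_of_le h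
      exact ⟨x ^ l * δ * ε', Or.inl (by linear_combination x ^ m * x ^ l * δ * hε')⟩
    · obtain ⟨l, rfl⟩ := Nat.exists_eq_add_of_le h
      exact ⟨x ^ l * ε * δ', Or.inr (by linear_combination x ^ k * x ^ l * ε * hδ')⟩

instance : CharZero (Og ℂ) :=
  charZero_of_injective_algebraMap (algebraMap ℂ (Og ℂ)).injective

lemma line_incl {Z : Type*} [NormedAddCommGroup Z] [NormedSpace ℂ Z] (c : Og Z) :
    line Z (incl Z c) = algebraMap ℂ _ (ev c) := by
  obtain ⟨g, hg, rfl⟩ := exists_ofFun c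
  rw [lpb_lpb, pb_ofFun, ev_ofFun, algebraMap_eq]
  exact ofFun_eq_iff.2 (Eventually.of_forall fun z => rfl)

lemma line_last {Z : Type*} [NormedAddCommGroup Z] [NormedSpace ℂ Z] : line Z (last Z) = x := by
  rw [last, lpb_lpb]; exact lpb_id x

/-- The Weierstrass polynomial of a regular germ. -/
lemma IsRegular.exists_monic {n : ℕ} {f : Og (ℂ × ℂ)} (hf : IsRegular n f) :
    ∃ w : Polynomial (Og ℂ), w.Monic ∧ w.natDegree = n ∧ Associated f (polyGerm w) := by
  obtain ⟨ε, hε, hΦ⟩ := hf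
  obtain ⟨⟨q, a⟩, hqa, -⟩ := weierstrass_division hε hΦ (last ℂ ^ n)
  dsimp only at hqa
  have hq : IsUnit q := by
    have h1 := congrArg (outcl ℂ) (congrArg (line ℂ) hqa)
    simp only [map_add, map_sum, map_mul, map_pow, line_incl, line_last, hΦ, pb_algebraMap] at h1
    have h2 := (weierstrass_division (P := ℂ) (n := n) (Φ := last ℂ ^ n) isUnit_one
      (by rw [map_pow, line_last, mul_one]) (last ℂ ^ n)).unique (y₁ := (1, 0))
      (y₂ := (outcl ℂ (ε * line ℂ q), fun j => algebraMap ℂ _ (ev (a j)))) (by simp) (by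
        simp only [pb_algebraMap, map_mul]
        rw [← mul_assoc]; exact h1)
    have h3 := congrArg ev (congrArg Prod.fst h2)
    simp only [map_mul, ev_pb, map_one] at h3
    rw [isUnit_iff]
    exact right_ne_zero_of_mul (h3 ▸ one_ne_zero)
  have hdeg : (-∑ j : Fin n, Polynomial.C (a j) * Polynomial.X ^ (j : ℕ)).degree <
      (n : WithBot ℕ) := by
    rw [Polynomial.degree_neg]; exact Polynomial.degree_sum_fin_lt a
  refine ⟨Polynomial.X ^ n + -∑ j : Fin n, Polynomial.C (a j) * Polynomial.X ^ (j : ℕ),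
    Polynomial.monic_X_pow_add hdeg, ?_, hq.unit, ?_⟩
  · exact Polynomial.natDegree_eq_of_degree_eq_some (by
      rw [Polynomial.degree_add_eq_left_of_degree_lt (by simpa using hdeg), Polynomial.degree_X_pow])
  · rw [map_add, map_neg, map_sum]
    simp only [map_mul, map_pow, polyGerm_C, polyGerm_X]
    rw [hqa]
    simp

/-- Divisibility by a regular germ is divisibility by its Weierstrass polynomial. -/
lemma IsRegular.dvd_polyGerm_iff {n : ℕ} {f : Og (ℂ × ℂ)} (hf : IsRegular n f) (hn : n ≠ 0)
    {w : Polynomial (Og ℂ)} (hw : w.Monic) (hwn : w.natDegree = n)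
    (hwf : Associated f (polyGerm w)) (g : Polynomial (Og ℂ)) :
    f ∣ polyGerm g ↔ w ∣ g := by
  constructor
  · intro h
    rw [← Polynomial.modByMonic_eq_zero_iff_dvd hw]
    have hd : (g %ₘ w).natDegree < n := by
      rw [← hwn]; exact Polynomial.natDegree_modByMonic_lt _ hw (by
      rintro rfl; simp at hwn; exact hn hwn.symm)
    have h1 : f ∣ polyGerm (g %ₘ w) := by
      have := Polynomial.modByMonic_add_div g w
      rw [← eq_sub_iff_add_eq] at this
      rw [this, map_sub, map_mul]
      exact dvd_sub h (hwf.dvd.mul_right _)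
    rw [polyGerm_of_natDegree_lt hd] at h1
    have h2 := hf.polyLast_eq_zero h1
    ext1 k
    by_cases hk : k < n
    · exact congrFun h2 ⟨k, hk⟩
    · rw [Polynomial.coeff_eq_zero_of_natDegree_lt (by omega), Polynomial.coeff_zero]
  · intro h
    exact hwf.dvd.trans (map_dvd polyGerm h)

lemma exists_polyGerm {n : ℕ} {f : Og (ℂ × ℂ)} (hf : IsRegular n f) (u : Og (ℂ × ℂ)) :
    ∃ g : Polynomial (Og ℂ), f ∣ u - polyGerm g := by
  obtain ⟨a, ha⟩ := hf.exists_polyLast u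
  refine ⟨∑ j : Fin n, Polynomial.C (a j) * Polynomial.X ^ (j : ℕ), ?_⟩
  simpa [polyLast_apply] using ha

lemma x_ne_zero : (x : Og ℂ) ≠ 0 := fun h => by
  have h0 := pd_x
  rw [h] at h0
  exact zero_ne_one ((D (1 : ℂ)).map_zero.symm.trans h0)

/-- The Weierstrass polynomial of an isolated critical point is squarefree. -/
lemma IsRegular.squarefree {n N : ℕ} {f α β : Og (ℂ × ℂ)} (hf : IsRegular n f) (hn : n ≠ 0)
    (hJ : incl ℂ x ^ N = α * pd (1, 0) f + β * pd (0, 1) f)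
    {w : Polynomial (Og ℂ)} (hw : w.Monic) (hwn : w.natDegree = n)
    (hwf : Associated f (polyGerm w)) :
    Squarefree (w.map (algebraMap (Og ℂ) (FractionRing (Og ℂ)))) := by
  refine Polynomial.squarefree_map_of_monic hw fun p hp ⟨s, hs⟩ => ?_
  obtain ⟨T, hT⟩ : polyGerm p ∣ incl ℂ x ^ N := by
    obtain ⟨η, hη⟩ := hwf.symm
    have h1 : ∀ v, polyGerm p ∣ pd v f := by
      intro v
      rw [← hη, hs, map_mul, map_mul, mul_assoc, mul_assoc, pd_mul, pd_mul]
      exact dvd_add (dvd_mul_right _ _) ((dvd_mul_right _ _).mul_right _)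
    rw [hJ]
    exact dvd_add ((h1 _).mul_left _) ((h1 _).mul_left _)
  obtain ⟨t, ht⟩ := exists_polyGerm hf T
  have h1 : w ∣ Polynomial.C (x ^ N) - p * t := by
    rw [← hf.dvd_polyGerm_iff hn hw hwn hwf]
    convert ht.mul_left (polyGerm p) using 1
    rw [map_sub, map_mul, polyGerm_C, map_pow, hT]; ring
  have h2 : p ∣ Polynomial.C (x ^ N) := by
    have h0 : p ∣ w := ⟨p * s, by rw [hs, mul_assoc]⟩
    have := dvd_add (h0.trans h1) (dvd_mul_right p t)
    simpa using this
  have h3 := Polynomial.natDegree_le_of_dvd h2 (by simpa using pow_ne_zero N x_ne_zero)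
  rw [Polynomial.natDegree_C] at h3
  exact hp.natDegree_eq_zero.1 (by omega)

end Og

/-! ### Functions of two variables with an isolated critical point -/

namespace Og

lemma IsRegular.dvd_of_dvd_incl_mul {n : ℕ} {f : Og (ℂ × ℂ)} (hf : IsRegular n f) {d : Og ℂ}
    (hd : d ≠ 0) {h : Og (ℂ × ℂ)} (hh : f ∣ incl ℂ d * h) : f ∣ h := by
  obtain ⟨a, ha⟩ := hf.exists_polyLast h
  have h1 : f ∣ polyLast ℂ n fun j => d * a j := by
    rw [polyLast_mul]
    convert dvd_sub hh (ha.mul_left (incl ℂ d)) using 1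
    ring
  have h2 : a = 0 := funext fun j =>
    (mul_eq_zero.1 (congrFun (hf.polyLast_eq_zero h1) j)).resolve_left hd
  simpa [h2] using ha

section

variable {n N : ℕ} {f α β : Og (ℂ × ℂ)}

lemma IsRegular.exists_incl_eq (hf : IsRegular n f) (hn : n ≠ 0)
    (hJ : incl ℂ x ^ N = α * pd (1, 0) f + β * pd (0, 1) f) :
    ∃ d : Og ℂ, d ≠ 0 ∧ ∃ a b, incl ℂ d = a * f + b * pd (0, 1) f := by
  obtain ⟨w, hw, hwn, hwf⟩ := hf.exists_monic
  have hsq := hf.squarefree hn hJ hw hwn hwf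
  have hinj := IsFractionRing.injective (Og ℂ) (FractionRing (Og ℂ))
  have : CharZero (FractionRing (Og ℂ)) := IsFractionRing.charZero_of_isFractionRing (Og ℂ)
  obtain ⟨a, b, hab⟩ := PerfectField.separable_iff_squarefree.2 hsq
  obtain ⟨c, hc, hA⟩ := IsLocalization.integerNormalization_spec (nonZeroDivisors (Og ℂ)) a
  obtain ⟨d, hd, hB⟩ := IsLocalization.integerNormalization_spec (nonZeroDivisors (Og ℂ)) b
  set A := IsLocalization.integerNormalization (nonZeroDivisors (Og ℂ)) a
  set B := IsLocalization.integerNormalization (nonZeroDivisors (Og ℂ)) b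
  have key : Polynomial.C d * A * w + Polynomial.C c * B * Polynomial.derivative w =
      Polynomial.C (c * d) := by
    apply Polynomial.map_injective _ hinj
    simp only [Polynomial.map_add, Polynomial.map_mul, Polynomial.map_C, hA, hB, map_mul]
    rw [Polynomial.derivative_map] at hab
    rw [← algebraMap_smul (FractionRing (Og ℂ)) c, ← algebraMap_smul (FractionRing (Og ℂ)) d,
      Polynomial.smul_eq_C_mul, Polynomial.smul_eq_C_mul]
    linear_combination (Polynomial.C (algebraMap (Og ℂ) (FractionRing (Og ℂ)) c) *
      Polynomial.C (algebraMap (Og ℂ) (FractionRing (Og ℂ)) d)) * hab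
  obtain ⟨η, hη⟩ := hwf
  have h1 := congrArg polyGerm key
  simp only [map_add, map_mul, polyGerm_C] at h1
  rw [← pd_polyGerm, ← hη, pd_mul] at h1
  refine ⟨c * d, mul_ne_zero (nonZeroDivisors.ne_zero hc) (nonZeroDivisors.ne_zero hd),
    incl ℂ d * polyGerm A * η + incl ℂ c * polyGerm B * pd (0, 1) (η : Og (ℂ × ℂ)),
    incl ℂ c * polyGerm B * η, ?_⟩
  rw [map_mul, ← h1]
  ring

lemma IsRegular.dvd_of_dvd_pd_mul (hf : IsRegular n f) (hn : n ≠ 0)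
    (hJ : incl ℂ x ^ N = α * pd (1, 0) f + β * pd (0, 1) f) {h : Og (ℂ × ℂ)}
    (hh : f ∣ pd (0, 1) f * h) : f ∣ h := by
  obtain ⟨d, hd, a, b, hab⟩ := hf.exists_incl_eq hn hJ
  refine hf.dvd_of_dvd_incl_mul hd ?_
  rw [hab]
  convert dvd_add (dvd_mul_right f (a * h)) (hh.mul_left b) using 1
  ring

lemma IsRegular.dvd_of_dvd_pow (hf : IsRegular n f) (hn : n ≠ 0)
    (hJ : incl ℂ x ^ N = α * pd (1, 0) f + β * pd (0, 1) f) {g : Og (ℂ × ℂ)} {e : ℕ}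
    (he : e ≠ 0) (hg : f ∣ g ^ e) : f ∣ g := by
  obtain ⟨w, hw, hwn, hwf⟩ := hf.exists_monic
  have hsq := hf.squarefree hn hJ hw hwn hwf
  have hinj := IsFractionRing.injective (Og ℂ) (FractionRing (Og ℂ))
  obtain ⟨p, hp⟩ := exists_polyGerm hf g
  have h1 : w ∣ p ^ e := by
    rw [← hf.dvd_polyGerm_iff hn hw hwn hwf, map_pow]
    convert dvd_sub hg (hp.trans (sub_dvd_pow_sub_pow g (polyGerm p) e)) using 1
    ring
  have h2 := Polynomial.map_dvd (algebraMap (Og ℂ) (FractionRing (Og ℂ))) h1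
  rw [Polynomial.map_pow, hsq.dvd_pow_iff_dvd he, Polynomial.map_dvd_map _ hinj hw,
    ← hf.dvd_polyGerm_iff hn hw hwn hwf] at h2
  convert dvd_add hp h2 using 1
  ring

lemma IsSystem.det_ne_zero (hf : IsRegular n f) (hn : n ≠ 0)
    (hJ : incl ℂ x ^ N = α * pd (1, 0) f + β * pd (0, 1) f)
    {M₀ N₀ : Matrix (Fin n) (Fin n) (Og ℂ)} (hs : IsSystem 1 f M₀ N₀) : M₀.det ≠ 0 := by
  intro h
  obtain ⟨a, ha, hMa⟩ := Matrix.exists_mulVec_eq_zero_iff.2 h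
  have h1 := dvd_mul_polyLast hs.der a
  rw [hMa, map_zero, sub_zero, ← polyLast_apply, neg_mul, dvd_neg] at h1
  exact ha (hf.polyLast_eq_zero (hf.dvd_of_dvd_pd_mul hn hJ h1))

lemma finiteDimensional_ker_ode {ι : Type*} [Fintype ι] [DecidableEq ι] {M : Matrix ι ι (Og ℂ)}
    (hM : M.det ≠ 0) (N : Matrix ι ι (Og ℂ)) :
    FiniteDimensional ℂ (LinearMap.ker (ode M N)) := by
  obtain ⟨m, A, hA, -⟩ := exists_mul_eq_x_pow hM
  have := (index_ode m (A * N)).2.1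
  refine Submodule.finiteDimensional_of_le (S₂ := LinearMap.ker (ode (x ^ m • 1) (A * N)))
    fun a ha => ?_
  rw [LinearMap.mem_ker] at ha ⊢
  rw [← hA, ← mulVec_ode, ha, Matrix.mulVec_zero]

lemma poisson_pow_dvd {Z : Type*} [NormedAddCommGroup Z] [NormedSpace ℂ Z] {v : Z}
    {f g : Og (Z × ℂ)} (hg : f ∣ poisson v f g) (i : ℕ) : f ∣ poisson v f (g ^ i) := by
  induction i with
  | zero =>
    rw [pow_zero, poisson, ← map_one (algebraMap ℂ (Og (Z × ℂ))), pd_algebraMap, pd_algebraMap]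
    simp
  | succ i ih =>
    rw [pow_succ, poisson_mul]
    exact dvd_add (hg.mul_left _) (ih.mul_left _)

lemma IsSystem.ode_eq_zero_iff (hf : IsRegular n f) {M₀ N₀ : Matrix (Fin n) (Fin n) (Og ℂ)}
    (hs : IsSystem 1 f M₀ N₀) (a : Fin n → Og ℂ) :
    ode M₀ N₀ a = 0 ↔ f ∣ poisson 1 f (polyLast ℂ n a) := by
  have h1 := hs.dvd a
  rw [← ode_apply] at h1
  constructor
  · intro h
    simpa [h] using h1
  · intro h
    refine hf.polyLast_eq_zero ?_
    simpa using dvd_sub h h1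

lemma exists_const_of_dvd_poisson (hf : IsRegular n f) (hn : n ≠ 0)
    (hJ : incl ℂ x ^ N = α * pd (1, 0) f + β * pd (0, 1) f) {g : Og (ℂ × ℂ)}
    (hg : f ∣ poisson 1 f g) : f ∣ g - algebraMap ℂ _ (ev g) := by
  obtain ⟨M₀, N₀, hs⟩ := hf.exists_isSystem 1
  have := finiteDimensional_ker_ode (hs.det_ne_zero hf hn hJ) N₀
  let Q := Og (ℂ × ℂ) ⧸ Ideal.span {f}
  let T : (Fin n → Og ℂ) →ₗ[ℂ] Q :=
    { toFun := fun a => Ideal.Quotient.mk _ (polyLast ℂ n a)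
      map_add' := fun a b => by rw [map_add, map_add]
      map_smul' := fun c a => by
        have : c • a = fun j => algebraMap ℂ _ c * a j := funext fun j => by
          rw [Pi.smul_apply, Algebra.smul_def]
        rw [this, polyLast_mul, pb_algebraMap, ← Algebra.smul_def]
        rfl }
  let φ : Polynomial ℂ →ₗ[ℂ] Q :=
    ((Ideal.Quotient.mkₐ ℂ (Ideal.span {f})).comp (Polynomial.aeval g)).toLinearMap
  have hφ : ∀ p, φ p = Ideal.Quotient.mk _ (Polynomial.aeval g p) := fun p => rfl
  let R := (LinearMap.ker (ode M₀ N₀)).map T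
  have hR : ∀ p, φ p ∈ R := by
    intro p
    induction p using Polynomial.induction_on' with
    | add p q hp hq => rw [map_add]; exact R.add_mem hp hq
    | monomial i c =>
      rw [← Polynomial.smul_X_eq_monomial, map_smul]
      refine R.smul_mem _ ?_
      obtain ⟨a, q, ha⟩ := hf.exists_polyLast (g ^ i)
      refine ⟨a, ?_, ?_⟩
      · change ode M₀ N₀ a = 0
        rw [hs.ode_eq_zero_iff hf, show polyLast ℂ n a = g ^ i - f * q by rw [← ha]; ring,
          poisson_sub, poisson_self_mul]
        exact dvd_sub (poisson_pow_dvd hg i) (dvd_mul_right _ _)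
      · rw [hφ, map_pow, Polynomial.aeval_X]
        exact (Ideal.Quotient.eq.2 (Ideal.mem_span_singleton'.2 ⟨q, by rw [ha]; ring⟩)).symm
  obtain ⟨p, hp, hp0⟩ : ∃ p, φ p = 0 ∧ p ≠ 0 := by
    by_contra! h
    have hinj : Function.Injective (φ.codRestrict R hR) := by
      refine (injective_iff_map_eq_zero _).2 fun p hp => h p ?_
      exact congrArg Subtype.val hp
    exact Polynomial.not_finite (FiniteDimensional.of_injective _ hinj)
  have hfp : f ∣ Polynomial.aeval g p := by
    rw [hφ, Ideal.Quotient.eq_zero_iff_mem, Ideal.mem_span_singleton] at hp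
    exact hp
  obtain ⟨s, hs1, hs2⟩ := Polynomial.exists_eq_pow_rootMultiplicity_mul_and_not_dvd p hp0 (ev g)
  have hu : IsUnit (Polynomial.aeval g s) := by
    rw [isUnit_iff, Polynomial.aeval_def, Polynomial.hom_eval₂,
      show ev.comp (algebraMap ℂ (Og (ℂ × ℂ))) = RingHom.id ℂ from RingHom.ext fun c => by simp]
    rw [Polynomial.dvd_iff_isRoot] at hs2
    exact hs2
  rw [hs1, map_mul, map_pow, hu.dvd_mul_right, map_sub, Polynomial.aeval_X,
    Polynomial.aeval_C] at hfp
  by_cases he : p.rootMultiplicity (ev g) = 0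
  · rw [he, pow_zero] at hfp
    exact hfp.trans (one_dvd _)
  · exact hf.dvd_of_dvd_pow hn hJ he hfp

lemma IsSystem.ker (hf : IsRegular n f) (hn : n ≠ 0)
    (hJ : incl ℂ x ^ N = α * pd (1, 0) f + β * pd (0, 1) f)
    {M₀ N₀ : Matrix (Fin n) (Fin n) (Og ℂ)} (hs : IsSystem 1 f M₀ N₀) {i₀ : Fin n}
    (hi₀ : (i₀ : ℕ) = 0) (a : Fin n → Og ℂ) (ha : ode M₀ N₀ a = 0) :
    ∃ c : ℂ, a = Pi.single i₀ (algebraMap ℂ _ c) := by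
  rw [hs.ode_eq_zero_iff hf] at ha
  refine ⟨ev (polyLast ℂ n a), sub_eq_zero.1 (hf.polyLast_eq_zero ?_)⟩
  rw [map_sub, polyLast_single, hi₀, pow_zero, mul_one, pb_algebraMap]
  exact exists_const_of_dvd_poisson hf hn hJ ha

lemma IsRegular.pd_isRegular (hf : IsRegular n f) (hn : n ≠ 0) :
    IsRegular (n - 1) (pd (0, 1) f) := by
  obtain ⟨ε, hε, h⟩ := hf
  obtain ⟨n, rfl⟩ := Nat.exists_eq_succ_of_ne_zero hn
  refine ⟨(n + 1 : ℕ) * ε + x * pd 1 ε, ?_, ?_⟩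
  · rw [isUnit_iff] at hε ⊢
    simpa using ⟨by exact_mod_cast n.succ_ne_zero, hε⟩
  · have h1 := congrArg (pd (1 : ℂ)) h
    have h2 := (D (1 : ℂ)).leibniz_pow x (n + 1)
    rw [D_apply, D_apply, pd_x] at h2
    rw [pd_lpb, pd_mul, h2] at h1
    rw [show ContinuousLinearMap.inr ℂ ℂ ℂ (1 : ℂ) = (0, 1) from rfl] at h1
    rw [h1]
    simp only [nsmul_eq_mul, smul_eq_mul, Nat.succ_eq_add_one, Nat.add_sub_cancel]
    ring

/-- The partial derivatives at an isolated critical point form a regular sequence. -/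
lemma IsRegular.koszul (hf : IsRegular n f) (hn : n ≠ 0)
    (hJ : incl ℂ x ^ N = α * pd (1, 0) f + β * pd (0, 1) f) {a b : Og (ℂ × ℂ)}
    (hab : a * pd (1, 0) f + b * pd (0, 1) f = 0) :
    ∃ h, a = pd (0, 1) f * h ∧ b = -(pd (1, 0) f * h) := by
  have hy := hf.pd_isRegular hn
  obtain ⟨h, hh⟩ : pd (0, 1) f ∣ a := by
    refine hy.dvd_of_dvd_incl_mul (pow_ne_zero N x_ne_zero) ⟨β * a - α * b, ?_⟩
    rw [map_pow, hJ]
    linear_combination α * hab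
  refine ⟨h, hh, eq_neg_of_add_eq_zero_left (hy.eq_zero_of_mul ?_)⟩
  rw [← hab, hh]; ring

end

end Og

/-! ### The graph of a function -/

namespace Og

section

variable {Λ : Type*} [NormedAddCommGroup Λ] [NormedSpace ℂ Λ]

/-- The projection of the graph space to the source. -/
noncomputable def graphProj (Λ : Type*) [NormedAddCommGroup Λ] [NormedSpace ℂ Λ] :
    (((Λ × ℂ) × ℂ) × ℂ) →L[ℂ] Λ × (ℂ × ℂ) :=
  ((ContinuousLinearMap.fst ℂ Λ ℂ).comp ((ContinuousLinearMap.fst ℂ (Λ × ℂ) ℂ).comp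
    (ContinuousLinearMap.fst ℂ ((Λ × ℂ) × ℂ) ℂ))).prod
  (((ContinuousLinearMap.snd ℂ (Λ × ℂ) ℂ).comp (ContinuousLinearMap.fst ℂ ((Λ × ℂ) × ℂ) ℂ)).prod
    (ContinuousLinearMap.snd ℂ ((Λ × ℂ) × ℂ) ℂ))

/-- The coordinate on the target in the graph space. -/
noncomputable def graphCoord (Λ : Type*) [NormedAddCommGroup Λ] [NormedSpace ℂ Λ] :
    (((Λ × ℂ) × ℂ) × ℂ) →L[ℂ] ℂ :=
  (ContinuousLinearMap.snd ℂ Λ ℂ).comp ((ContinuousLinearMap.fst ℂ (Λ × ℂ) ℂ).comp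
    (ContinuousLinearMap.fst ℂ ((Λ × ℂ) × ℂ) ℂ))

/-- The parametrisation of the graph space by source and target. -/
noncomputable def graphParam (Λ : Type*) [NormedAddCommGroup Λ] [NormedSpace ℂ Λ] :
    ((Λ × (ℂ × ℂ)) × ℂ) →L[ℂ] ((Λ × ℂ) × ℂ) × ℂ :=
  let p := ContinuousLinearMap.fst ℂ (Λ × (ℂ × ℂ)) ℂ
  let q := (ContinuousLinearMap.snd ℂ Λ (ℂ × ℂ)).comp p
  ((((ContinuousLinearMap.fst ℂ Λ (ℂ × ℂ)).comp p).prod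
    (ContinuousLinearMap.snd ℂ (Λ × (ℂ × ℂ)) ℂ)).prod
      ((ContinuousLinearMap.fst ℂ ℂ ℂ).comp q)).prod ((ContinuousLinearMap.snd ℂ ℂ ℂ).comp q)

/-- The equation of the graph of a germ. -/
noncomputable def graphEq (F : Og (Λ × (ℂ × ℂ))) : Og (((Λ × ℂ) × ℂ) × ℂ) :=
  lpb (graphProj Λ) F - lpb (graphCoord Λ) x

/-- The map to the graph of a germ. -/
noncomputable def graphMap (F : Og (Λ × (ℂ × ℂ))) (z : Λ × (ℂ × ℂ)) : ((Λ × ℂ) × ℂ) × ℂ :=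
  (((z.1, rep F z), z.2.1), z.2.2)

lemma analyticAt_graphMap (F : Og (Λ × (ℂ × ℂ))) : AnalyticAt ℂ (graphMap F) 0 :=
  ((analyticAt_fst.prod (analyticAt_rep F)).prod (analyticAt_fst.comp analyticAt_snd)).prod
    (analyticAt_snd.comp analyticAt_snd)

variable {F : Og (Λ × (ℂ × ℂ))}

lemma graphMap_zero (hF : ev F = 0) : graphMap F 0 = 0 := by
  rw [ev_apply] at hF
  simp [graphMap, hF]

/-- Restriction of germs to the graph. -/
noncomputable abbrev graphRes (F : Og (Λ × (ℂ × ℂ))) (hF : ev F = 0) :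
    Og (((Λ × ℂ) × ℂ) × ℂ) →+* Og (Λ × (ℂ × ℂ)) :=
  pb (graphMap F) (analyticAt_graphMap F) (graphMap_zero hF)

lemma graphRes_proj (hF : ev F = 0) (u : Og (Λ × (ℂ × ℂ))) :
    graphRes F hF (lpb (graphProj Λ) u) = u := by
  obtain ⟨g, hg, rfl⟩ := exists_ofFun u
  rw [pb_ofFun, pb_ofFun]
  rfl

lemma graphRes_coord (hF : ev F = 0) : graphRes F hF (lpb (graphCoord Λ) x) = F := by
  conv_rhs => rw [← ofFun_rep F]
  rw [x, pb_ofFun, pb_ofFun]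
  rfl

lemma graphRes_graphEq (hF : ev F = 0) : graphRes F hF (graphEq F) = 0 := by
  rw [graphEq, map_sub, graphRes_proj, graphRes_coord, sub_self]

lemma compPair_eq (hF : ev F = 0) (c : Og (Λ × ℂ)) :
    compPair c F = graphRes F hF (incl ((Λ × ℂ) × ℂ) (incl (Λ × ℂ) c)) := by
  have h : compPair c F = ofFun (fun z : Λ × (ℂ × ℂ) => rep c (z.1, rep F z)) (by
      refine AnalyticAt.comp_of_eq (g := rep c) (analyticAt_rep c)
        (analyticAt_fst.prod (analyticAt_rep F)) ?_
      rw [ev_apply] at hF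
      simp [hF]) := by
    rw [compPair, dif_pos (show ev0 F = 0 from hF)]
    rfl
  rw [h]
  conv_rhs => rw [← ofFun_rep c]
  rw [pb_ofFun, pb_ofFun, pb_ofFun]
  rfl

/-- A germ vanishing on the graph is a multiple of the equation of the graph. -/
lemma graphEq_dvd [FiniteDimensional ℂ Λ] (hF : ev F = 0) {w : Og (((Λ × ℂ) × ℂ) × ℂ)}
    (hw : graphRes F hF w = 0) : graphEq F ∣ w := by
  have h1 : lpb (graphParam Λ) (graphEq F) = incl _ F - last _ := by
    rw [graphEq, map_sub, lpb_lpb, lpb_lpb]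
    rfl
  have h2 : line (Λ × (ℂ × ℂ)) (lpb (graphParam Λ) (graphEq F)) = x ^ 1 * (-1) := by
    rw [h1, map_sub, line_incl, line_last, hF]; simp
  obtain ⟨⟨q, r⟩, h, -⟩ := weierstrass_division isUnit_one.neg h2 (lpb (graphParam Λ) w)
  have h3 := congrArg (lpb ((graphProj Λ).prod (graphCoord Λ))) h
  have h4 : ∀ u, lpb ((graphProj Λ).prod (graphCoord Λ)) (lpb (graphParam Λ) u) = u := fun u => by
    rw [lpb_lpb]; exact lpb_id u
  simp only [Fin.sum_univ_one, Fin.val_zero, pow_zero, mul_one, map_add, map_mul, h4] at h3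
  rw [lpb_lpb] at h3
  change w = _ + lpb (graphProj Λ) (r 0) at h3
  have h5 := congrArg (graphRes F hF) h3
  rw [hw, map_add, map_mul, graphRes_graphEq, zero_mul, zero_add, graphRes_proj] at h5
  rw [← h5, map_zero, add_zero] at h3
  exact ⟨_, h3⟩

lemma pd_graphRes [CompleteSpace Λ] (hF : ev F = 0) (v : ℂ × ℂ) (w : Og (((Λ × ℂ) × ℂ) × ℂ)) :
    pd (0, v) (graphRes F hF w) = graphRes F hF (pd (((0, 0), v.1), v.2) w) +
      pd (0, v) F * graphRes F hF (pd (((0, 1), 0), 0) w) := by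
  refine pd_pb _ _ _ _ ?_
  filter_upwards [eventually_differentiableAt (analyticAt_rep F), rep_pd (0, v) F] with z hz h1
  rw [h1]
  have h2 := (((hasFDerivAt_fst (𝕜 := ℂ) (p := z)).prodMk hz.hasFDerivAt).prodMk
    (hasFDerivAt_fst.comp z hasFDerivAt_snd)).prodMk
    (hasFDerivAt_snd.comp z (hasFDerivAt_snd (𝕜 := ℂ) (p := z)))
  have h3 : fderiv ℂ (graphMap F) z = _ := h2.fderiv
  rw [h3]
  simp

/-- The fibrewise bracket with `F` is the restriction of a bracket in the graph space. -/
lemma bracket_graphRes [CompleteSpace Λ] (hF : ev F = 0) (w : Og (((Λ × ℂ) × ℂ) × ℂ)) :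
    dxP F * dyP (graphRes F hF w) - dyP F * dxP (graphRes F hF w) =
      graphRes F hF (poisson ((0, 1) : (Λ × ℂ) × ℂ) (graphEq F) w) := by
  have h : ∀ a b : ℂ, graphRes F hF (pd (((0, 0), a), b) (graphEq F)) = pd (0, (a, b)) F := by
    intro a b
    have h1 := (D ((((0 : Λ), (0 : ℂ)), a), b)).map_sub (lpb (graphProj Λ) F) (lpb (graphCoord Λ) x)
    rw [D_apply, D_apply, D_apply, pd_lpb, pd_lpb] at h1
    have h2 : pd (graphCoord Λ ((((0 : Λ), (0 : ℂ)), a), b)) x = 0 := by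
      rw [show graphCoord Λ ((((0 : Λ), (0 : ℂ)), a), b) = (0 : ℂ) from rfl, pd_apply]
      exact (ofFun_eq_iff (hh := analyticAt_const (v := (0 : ℂ)))).2
        (Eventually.of_forall fun z => map_zero _)
    rw [h2, map_zero, sub_zero] at h1
    rw [graphEq, h1, graphRes_proj]
    rfl
  rw [poisson, map_sub, map_mul, map_mul, dxP, dyP, dxP, dyP, pd_graphRes, pd_graphRes]
  have hx := h 1 0
  have hy := h 0 1
  rw [show ((0, 1) : (Λ × ℂ) × ℂ) = ((0, 0), 1) from rfl,
    show ((0, 1) : ((Λ × ℂ) × ℂ) × ℂ) = (((0, 0), 0), 1) from rfl, hx, hy]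
  ring

end

end Og

/-! ### Freeness of the relative Brieskorn lattice -/

namespace Og

section

variable {P : Type*} [NormedAddCommGroup P] [NormedSpace ℂ P] {n : ℕ}

/-- Restriction of a differential system to the origin of the parameter space. -/
lemma IsSystem.restrict {Φ : Og ((P × ℂ) × ℂ)} {M N : Matrix (Fin n) (Fin n) (Og (P × ℂ))}
    (h : IsSystem ((0, 1) : P × ℂ) Φ M N) :
    IsSystem 1 (lpb ((ContinuousLinearMap.inr ℂ P ℂ).prodMap (ContinuousLinearMap.id ℂ ℂ)) Φ)
      (M.map (line P)) (N.map (line P)) := by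
  set R : ℂ × ℂ →L[ℂ] (P × ℂ) × ℂ :=
    (ContinuousLinearMap.inr ℂ P ℂ).prodMap (ContinuousLinearMap.id ℂ ℂ)
  have h1 : lpb R (last (P × ℂ)) = last ℂ := lpb_lpb _ _ _
  have h2 : ∀ a : Fin n → Og (P × ℂ),
      lpb R (polyLast _ n a) = polyLast ℂ n fun j => line P (a j) := by
    intro a
    simp only [polyLast_apply, map_sum, map_mul, map_pow, h1]
    refine Finset.sum_congr rfl fun j _ => ?_
    rw [lpb_lpb, lpb_lpb]
    rfl
  have h3 : ∀ u, lpb R (pd (0, 1) u) = pd (0, 1) (lpb R u) := by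
    intro u
    rw [pd_lpb]
    congr 2
  have h4 : ∀ u, lpb R (pd ((0, 1), 0) u) = pd (1, 0) (lpb R u) := by
    intro u
    rw [pd_lpb]
    congr 2
  constructor
  · intro j
    have := map_dvd (lpb R) (h.der j)
    simp only [map_sub, map_mul, map_neg, map_pow, h1, h2, h3] at this
    exact this
  · intro j
    have := map_dvd (lpb R) (h.coef j)
    simp only [map_sub, map_mul, map_pow, h1, h2, h3, h4] at this
    exact this

end

/-- A basis of the quotient of the ring by the ideal of `f` and the brackets with `f`. -/
def IsBracketBasis {r : ℕ} (f : Og (ℂ × ℂ)) (e : Fin r → Og (ℂ × ℂ)) : Prop :=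
  ∀ u, ∃! c : Fin r → ℂ, ∃ g, f ∣ u - poisson 1 f g - ∑ k, algebraMap ℂ _ (c k) * e k

section

variable {n r : ℕ} {f : Og (ℂ × ℂ)}

lemma polyLast_smul {Z : Type*} [NormedAddCommGroup Z] [NormedSpace ℂ Z] (c : ℂ)
    (a : Fin n → Og Z) : polyLast Z n (c • a) = algebraMap ℂ _ c * polyLast Z n a := by
  rw [← pb_algebraMap (ContinuousLinearMap.analyticAt (ContinuousLinearMap.fst ℂ Z ℂ) 0)
    (map_zero _) c, ← polyLast_mul]
  congr 1

lemma IsSystem.exists_eq_ode_iff (hf : IsRegular n f) {M₀ N₀ : Matrix (Fin n) (Fin n) (Og ℂ)}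
    (hs : IsSystem 1 f M₀ N₀) {e : Fin r → Og (ℂ × ℂ)} {e₀ : Fin r → Fin n → Og ℂ}
    (he : ∀ k, f ∣ e k - polyLast ℂ n (e₀ k)) {u : Og (ℂ × ℂ)} {u₀ : Fin n → Og ℂ}
    (hu : f ∣ u - polyLast ℂ n u₀) (c : Fin r → ℂ) :
    (∃ a, u₀ = ode M₀ N₀ a + ∑ k, c k • e₀ k) ↔
      ∃ g, f ∣ u - poisson 1 f g - ∑ k, algebraMap ℂ _ (c k) * e k := by
  have h1 : f ∣ ∑ k, algebraMap ℂ _ (c k) * e k - polyLast ℂ n (∑ k, c k • e₀ k) := by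
    rw [map_sum, ← Finset.sum_sub_distrib]
    refine Finset.dvd_sum fun k _ => ?_
    rw [polyLast_smul, ← mul_sub]
    exact (he k).mul_left _
  constructor
  · rintro ⟨a, rfl⟩
    refine ⟨polyLast ℂ n a, ?_⟩
    have h2 := hs.dvd a
    rw [← ode_apply] at h2
    rw [map_add] at hu
    convert dvd_sub hu (dvd_add h2 h1) using 1
    ring
  · rintro ⟨g, hg⟩
    obtain ⟨a, q, ha⟩ := hf.exists_polyLast g
    refine ⟨a, sub_eq_zero.1 (hf.polyLast_eq_zero ?_)⟩
    have h2 := hs.dvd a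
    rw [← ode_apply] at h2
    have h3 : f ∣ poisson 1 f g - poisson 1 f (polyLast ℂ n a) := by
      rw [← poisson_sub, ha, poisson_self_mul]
      exact dvd_mul_right _ _
    rw [map_sub, map_add]
    convert dvd_add (dvd_sub (dvd_add (dvd_add hg h3) (dvd_add h2 h1)) hu) (dvd_zero f) using 1
    ring

lemma exists_isBracketBasis {N : ℕ} {α β : Og (ℂ × ℂ)} (hf : IsRegular n f) (hn : n ≠ 0)
    (hJ : incl ℂ x ^ N = α * pd (1, 0) f + β * pd (0, 1) f) :
    ∃ r, ∃ e : Fin r → Og (ℂ × ℂ), IsBracketBasis f e := by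
  obtain ⟨M₀, N₀, hs⟩ := hf.exists_isSystem 1
  have := finiteDimensional_coker_ode (hs.det_ne_zero hf hn hJ) N₀
  set S := LinearMap.range (ode M₀ N₀)
  let b := Module.finBasis ℂ ((Fin n → Og ℂ) ⧸ S)
  choose e₀ he₀ using fun k => S.mkQ_surjective (b k)
  refine ⟨_, fun k => polyLast ℂ n (e₀ k), fun u => ?_⟩
  obtain ⟨u₀, hu⟩ := hf.exists_polyLast u
  simp only [← hs.exists_eq_ode_iff hf (e := fun k => polyLast ℂ n (e₀ k)) (e₀ := e₀)
    (fun k => by rw [sub_self]; exact dvd_zero f) hu]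
  have key : ∀ c : Fin (Module.finrank ℂ ((Fin n → Og ℂ) ⧸ S)) → ℂ,
      (∃ a, u₀ = ode M₀ N₀ a + ∑ k, c k • e₀ k) ↔ b.equivFun.symm c = S.mkQ u₀ := by
    intro c
    have h1 : b.equivFun.symm c = S.mkQ (∑ k, c k • e₀ k) := by
      rw [map_sum, Module.Basis.equivFun_symm_apply]
      exact Finset.sum_congr rfl fun k _ => by rw [map_smul, he₀]
    rw [h1, eq_comm, ← sub_eq_zero, ← map_sub, ← LinearMap.mem_ker, Submodule.ker_mkQ,
      LinearMap.mem_range]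
    exact exists_congr fun a => by rw [eq_sub_iff_add_eq, eq_comm]
  simp only [key]
  exact b.equivFun.symm.bijective.existsUnique _

variable {Λ : Type*} [NormedAddCommGroup Λ] [NormedSpace ℂ Λ]

lemma lpb_inr_prodMap_graphEq (F : Og (Λ × (ℂ × ℂ))) :
    lpb ((ContinuousLinearMap.inr ℂ (Λ × ℂ) ℂ).prodMap (ContinuousLinearMap.id ℂ ℂ)) (graphEq F) =
      lpb (ContinuousLinearMap.inr ℂ Λ (ℂ × ℂ)) F := by
  rw [graphEq, map_sub, lpb_lpb, lpb_lpb]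
  have : lpb ((graphCoord Λ).comp
      ((ContinuousLinearMap.inr ℂ (Λ × ℂ) ℂ).prodMap (ContinuousLinearMap.id ℂ ℂ))) x = 0 := by
    rw [x, pb_ofFun]
    rfl
  rw [this, sub_zero]
  rfl

lemma poisson_sum_incl {P : Type*} [NormedAddCommGroup P] [NormedSpace ℂ P]
    (d : Fin r → Og P) (e₀ : Fin r → Fin n → Og ℂ) :
    ∑ k, incl (P × ℂ) (incl P (d k)) * polyLast (P × ℂ) n (fun i => outcl P (e₀ k i)) =
      polyLast (P × ℂ) n fun i => ∑ k, incl P (d k) * outcl P (e₀ k i) := by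
  have : (fun i => ∑ k, incl P (d k) * outcl P (e₀ k i)) =
      ∑ k, fun i => incl P (d k) * outcl P (e₀ k i) := by
    funext i; simp
  rw [this, map_sum]
  exact Finset.sum_congr rfl fun k _ => (polyLast_mul _ _).symm

/-- The relative Brieskorn lattice is free, with a basis lifting any basis of the fibre. -/
theorem exists_basis_relBrieskorn [FiniteDimensional ℂ Λ] {N : ℕ} {α β : Og (ℂ × ℂ)}
    (hf : IsRegular n f) (hn : n ≠ 0)
    (hJ : incl ℂ x ^ N = α * pd (1, 0) f + β * pd (0, 1) f)
    {e₀ : Fin r → Og (ℂ × ℂ)} (he₀ : IsBracketBasis f e₀)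
    {F : Og (Λ × (ℂ × ℂ))} (hF : ev F = 0)
    (hFf : lpb (ContinuousLinearMap.inr ℂ Λ (ℂ × ℂ)) F = f) :
    ∃ e : Fin r → Og (Λ × (ℂ × ℂ)), ∀ u : Og (Λ × (ℂ × ℂ)),
      ∃! c : Fin r → Og (Λ × ℂ), u - (∑ i, compPair (c i) F * e i) ∈ relBrieskornRel F := by
  have : CompleteSpace Λ := FiniteDimensional.complete ℂ Λ
  have hΦf := (lpb_inr_prodMap_graphEq F).trans hFf
  have hΦ : IsRegular n (graphEq F) := by
    obtain ⟨ε, hε, h⟩ := hf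
    refine ⟨ε, hε, ?_⟩
    rw [← h, ← hΦf, lpb_lpb]
    congr 1
  obtain ⟨M, N', hs⟩ := hΦ.exists_isSystem ((0, 1) : (Λ × ℂ) × ℂ)
  have hs₀ := hs.restrict
  rw [hΦf] at hs₀
  let i₀ : Fin n := ⟨0, Nat.pos_of_ne_zero hn⟩
  choose b hb using fun k => hf.exists_polyLast (e₀ k)
  have hode := existsUnique_ode_family (hs.coef_zero hΦ (i₀ := i₀) rfl)
    (hs₀.det_ne_zero hf hn hJ) (hs₀.ker hf hn hJ rfl) (e := b) (fun u => by
      simp only [hs₀.exists_eq_ode_iff hf hb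
        (show f ∣ polyLast ℂ n u - polyLast ℂ n u by rw [sub_self]; exact dvd_zero f)]
      exact he₀ _)
  let E : Fin r → Og (((Λ × ℂ) × ℂ) × ℂ) := fun k => polyLast _ n fun i => outcl _ (b k i)
  have hD : ∀ a : Fin n → Og ((Λ × ℂ) × ℂ),
      (M.mulVec (fun j => pd ((0, 1) : (Λ × ℂ) × ℂ) (a j)) + N'.mulVec a) =
        fun i => ∑ j, (M i j * pd (0, 1) (a j) + N' i j * a j) := by
    intro a
    funext i
    simp only [Pi.add_apply, Matrix.mulVec, dotProduct, Finset.sum_add_distrib]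
  refine ⟨fun k => graphRes F hF (E k), fun u => ?_⟩
  simp only [compPair_eq hF, ← map_mul, ← map_sum]
  have hex : ∀ u, ∃ c : Fin r → Og (Λ × ℂ), u - graphRes F hF (∑ i,
      incl ((Λ × ℂ) × ℂ) (incl (Λ × ℂ) (c i)) * E i) ∈ relBrieskornRel F := by
    intro u
    obtain ⟨a, q, ha⟩ := hΦ.exists_polyLast (lpb (graphProj Λ) u)
    obtain ⟨s, ⟨d, hd⟩, -⟩ := hode a
    obtain ⟨q', hq'⟩ := hs.dvd d
    refine ⟨s, graphRes F hF (polyLast _ n d), ?_⟩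
    rw [bracket_graphRes]
    have h1 : polyLast ((Λ × ℂ) × ℂ) n a =
        polyLast _ n (M.mulVec (fun j => pd ((0, 1) : (Λ × ℂ) × ℂ) (d j)) + N'.mulVec d) +
          ∑ i, incl ((Λ × ℂ) × ℂ) (incl (Λ × ℂ) (s i)) * E i := by
      rw [poisson_sum_incl, ← map_add, hD]
      exact congrArg _ (funext hd)
    have h2 : lpb (graphProj Λ) u - ∑ i, incl ((Λ × ℂ) × ℂ) (incl (Λ × ℂ) (s i)) * E i =
        poisson ((0, 1) : (Λ × ℂ) × ℂ) (graphEq F) (polyLast _ n d) +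
          graphEq F * (q - q') := by
      linear_combination ha + h1 - hq'
    have h3 := congrArg (graphRes F hF) h2
    rwa [map_sub, graphRes_proj, map_add, map_mul, graphRes_graphEq, zero_mul, add_zero] at h3
  obtain ⟨c, hc⟩ := hex u
  refine ⟨c, hc, fun c' hc' => ?_⟩
  obtain ⟨G, hG⟩ := hc
  obtain ⟨G', hG'⟩ := hc'
  obtain ⟨a, q, ha⟩ := hΦ.exists_polyLast (lpb (graphProj Λ) (G - G'))
  have h1 : graphRes F hF ((∑ i, incl ((Λ × ℂ) × ℂ) (incl (Λ × ℂ) ((c' - c) i)) * E i) -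
      poisson ((0, 1) : (Λ × ℂ) × ℂ) (graphEq F) (lpb (graphProj Λ) (G - G'))) = 0 := by
    rw [map_sub, ← bracket_graphRes, graphRes_proj]
    have h2 : ∀ v, pd v (G - G') = pd v G - pd v G' := fun v => (D v).map_sub G G'
    simp only [dxP, dyP, Pi.sub_apply, map_sub, sub_mul, Finset.sum_sub_distrib, h2] at hG hG' ⊢
    linear_combination hG - hG'
  have h2 := graphEq_dvd hF h1
  have h3 : graphEq F ∣ polyLast ((Λ × ℂ) × ℂ) n
      ((fun i => ∑ k, incl (Λ × ℂ) ((c' - c) k) * outcl (Λ × ℂ) (b k i)) -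
        (M.mulVec (fun j => pd ((0, 1) : (Λ × ℂ) × ℂ) (a j)) + N'.mulVec a)) := by
    rw [map_sub, ← poisson_sum_incl]
    have h4 : graphEq F ∣ poisson ((0, 1) : (Λ × ℂ) × ℂ) (graphEq F) (lpb (graphProj Λ) (G - G')) -
        poisson ((0, 1) : (Λ × ℂ) × ℂ) (graphEq F) (polyLast _ n a) := by
      rw [← poisson_sub, ha, poisson_self_mul]
      exact dvd_mul_right _ _
    convert dvd_add h2 (dvd_add h4 (hs.dvd a)) using 1
    ring
  have h5 := hΦ.polyLast_eq_zero h3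
  rw [hD, sub_eq_zero] at h5
  have h6 := (hode 0).unique (y₁ := c' - c) (y₂ := 0) ⟨-a, fun i => ?_⟩ ⟨0, fun i => ?_⟩
  · exact sub_eq_zero.1 h6
  · have h7 : ∀ j, pd ((0, 1) : (Λ × ℂ) × ℂ) ((-a) j) = -pd (0, 1) (a j) :=
      fun j => (D _).map_neg _
    have h8 : ∑ k, incl (Λ × ℂ) ((c' - c) k) * outcl (Λ × ℂ) (b k i) =
      ∑ j, (M i j * pd (0, 1) (a j) + N' i j * a j) := congrFun h5 i
    rw [h8, ← Finset.sum_add_distrib]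
    symm
    refine Finset.sum_eq_zero fun j _ => ?_
    rw [h7, Pi.neg_apply]; ring
  · have h7 : pd ((0, 1) : (Λ × ℂ) × ℂ) 0 = 0 := (D _).map_zero
    simp [h7]

end

end Og

/-! ### The rank -/

namespace Og

lemma exists_pd_one_eq (c : Og ℂ) : ∃ C : Og ℂ, pd 1 C = c := by
  obtain ⟨W, hW⟩ := exists_primitive (P := ℂ) (outcl ℂ c)
  refine ⟨line ℂ W, ?_⟩
  rw [pd_lpb]
  change line ℂ (pd (0, 1) W) = c
  rw [hW, lpb_lpb]
  exact lpb_id c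

lemma exists_pd_fst_eq (w : Og (ℂ × ℂ)) : ∃ W : Og (ℂ × ℂ), pd (1, 0) W = w := by
  let σ : ℂ × ℂ →L[ℂ] ℂ × ℂ :=
    (ContinuousLinearMap.snd ℂ ℂ ℂ).prod (ContinuousLinearMap.fst ℂ ℂ ℂ)
  obtain ⟨W, hW⟩ := exists_primitive (P := ℂ) (lpb σ w)
  refine ⟨lpb σ W, ?_⟩
  rw [pd_lpb]
  change lpb σ (pd (0, 1) W) = w
  rw [hW, lpb_lpb]
  exact lpb_id w

lemma pd_neg (v : E) (a : Og E) : pd v (-a) = -pd v a := (D v).map_neg a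

lemma pd_sub (v : E) (a b : Og E) : pd v (a - b) = pd v a - pd v b := (D v).map_sub a b

lemma pd_zero (v : E) : pd v (0 : Og E) = 0 := (D v).map_zero

/-- A divergence-free vector field on the plane is Hamiltonian. -/
lemma exists_hamiltonian {a b : Og (ℂ × ℂ)} (h : pd (1, 0) a + pd (0, 1) b = 0) :
    ∃ g, a = pd (0, 1) g ∧ b = -pd (1, 0) g := by
  obtain ⟨w, hw⟩ := exists_primitive a
  have h1 : pd (0, 1) (pd (1, 0) w + b) = 0 := by
    rw [pd_add, pd_pd_comm, hw, h]
  obtain ⟨c, hc⟩ := exists_pd_one_eq (lpb (ContinuousLinearMap.inl ℂ ℂ ℂ) (pd (1, 0) w + b))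
  have h2 := incl_of_pd_eq_zero h1
  rw [← hc] at h2
  refine ⟨w - incl ℂ c, ?_, ?_⟩
  · rw [pd_sub, pd_incl, sub_zero, hw]
  · have h3 : pd (1, 0) (incl ℂ c) = incl ℂ (pd 1 c) := pd_lpb _ _ _
    rw [pd_sub, h3, h2]
    ring

section

variable {n N : ℕ} {f α β : Og (ℂ × ℂ)}

/-- A differential form is exact along the fibres if and only if its differential is. -/
lemma exists_poisson_iff (hf : IsRegular n f) (hn : n ≠ 0)
    (hJ : incl ℂ x ^ N = α * pd (1, 0) f + β * pd (0, 1) f) (p q : Og (ℂ × ℂ)) :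
    (∃ g, poisson 1 f g = p * pd (1, 0) f + q * pd (0, 1) f) ↔
      ∃ g, poisson 1 f g = pd (1, 0) p + pd (0, 1) q := by
  constructor
  · rintro ⟨g, hg⟩
    obtain ⟨h, h1, h2⟩ := hf.koszul hn hJ (a := p - pd (0, 1) g) (b := q + pd (1, 0) g) (by
      rw [poisson] at hg
      linear_combination -hg)
    refine ⟨-h, ?_⟩
    have h3 := congrArg (pd (1, 0)) h1
    have h4 := congrArg (pd (0, 1)) h2
    rw [pd_sub, pd_mul] at h3
    rw [pd_add, pd_neg, pd_mul] at h4
    rw [poisson, pd_neg, pd_neg]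
    linear_combination -h3 - h4 + pd_pd_comm (0, 1) (1, 0) g + h * pd_pd_comm (0, 1) (1, 0) f
  · rintro ⟨h, hh⟩
    obtain ⟨g, h1, h2⟩ := exists_hamiltonian (a := p + pd (0, 1) f * h) (b := q - pd (1, 0) f * h) (by
      rw [poisson] at hh
      rw [pd_add, pd_sub, pd_mul, pd_mul]
      linear_combination -hh - h * pd_pd_comm (0, 1) (1, 0) f)
    refine ⟨g, ?_⟩
    rw [poisson]
    linear_combination -pd (1, 0) f * h1 - pd (0, 1) f * h2

end

end Og

namespace Og

section

variable {ι : Type*} [Fintype ι] [DecidableEq ι]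

/-- The colength of an operator whose product with `x^m d/dx + N` is `x^m`. -/
lemma finrank_coker_of_comp_ode (m : ℕ) (N : Matrix ι ι (Og ℂ))
    (A : (ι → Og ℂ) →ₗ[ℂ] (ι → Og ℂ)) (hA : Function.Injective A)
    [FiniteDimensional ℂ ((ι → Og ℂ) ⧸ LinearMap.range A)]
    (h : ∀ c, A (ode (x ^ m • 1) N c) = fun i => x ^ m * c i) :
    Module.finrank ℂ ((ι → Og ℂ) ⧸ LinearMap.range A) = Fintype.card ι := by
  have hd := index_ode (ι := ι) 0 0
  have hB := index_ode m N
  have hX := index_ode (ι := ι) m 0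
  obtain ⟨_, _, hd⟩ := hd
  obtain ⟨_, _, hB⟩ := hB
  obtain ⟨_, _, hX⟩ := hX
  have hkA : LinearMap.ker A = ⊥ := LinearMap.ker_eq_bot.2 hA
  have : FiniteDimensional ℂ (LinearMap.ker A) := by rw [hkA]; infer_instance
  have h1 : A ∘ₗ ode (x ^ m • 1) N ∘ₗ ode (x ^ 0 • 1) 0 = ode (x ^ m • 1) 0 := by
    refine LinearMap.ext fun c => ?_
    rw [LinearMap.comp_apply, LinearMap.comp_apply, h, ode_apply, ode_apply,
      x_pow_smul_one_mulVec, x_pow_smul_one_mulVec]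
    funext i
    simp
  have : FiniteDimensional ℂ (LinearMap.ker (ode (x ^ m • 1) N ∘ₗ ode (x ^ 0 • 1) 0)) := by
    rw [LinearMap.ker_comp]; infer_instance
  have : FiniteDimensional ℂ
      ((ι → Og ℂ) ⧸ LinearMap.range (ode (x ^ m • 1) N ∘ₗ ode (x ^ 0 • 1) 0)) := by
    rw [LinearMap.range_comp]; infer_instance
  have h2 := congrArg LinearMap.index h1
  rw [LinearMap.index_comp, LinearMap.index_comp, LinearMap.index_of_injective hA] at h2
  simp only [LinearMap.index_eq_finrank_sub] at h2
  zify at hd hB hX ⊢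
  linarith

end

/-- Coordinates modulo a subspace. -/
lemma exists_coordinates {V W : Type*} [AddCommGroup V] [Module ℂ V] [AddCommGroup W] [Module ℂ W]
    (Ψ : V →ₗ[ℂ] W) (S : Submodule ℂ W) (h : ∀ u, ∃! c, u - Ψ c ∈ S) :
    ∃ q : W →ₗ[ℂ] V, ∀ u c, q u = c ↔ u - Ψ c ∈ S := by
  have hb : Function.Bijective (S.mkQ ∘ₗ Ψ) := by
    constructor
    · intro c c' hc
      refine (h (Ψ c)).unique (by simp) ?_
      exact (Submodule.Quotient.eq S).1 hc
    · intro v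
      obtain ⟨u, rfl⟩ := S.mkQ_surjective v
      obtain ⟨c, hc, -⟩ := h u
      exact ⟨c, ((Submodule.Quotient.eq S).2 hc).symm⟩
  refine ⟨(LinearEquiv.ofBijective _ hb).symm.toLinearMap ∘ₗ S.mkQ, fun u c => ?_⟩
  rw [LinearMap.comp_apply, LinearEquiv.coe_coe, LinearEquiv.symm_apply_eq]
  exact Submodule.Quotient.eq S

section

/-- The bracket with `f` as a linear map. -/
noncomputable def bracket (f : Og (ℂ × ℂ)) : Og (ℂ × ℂ) →ₗ[ℂ] Og (ℂ × ℂ) where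
  toFun g := poisson 1 f g
  map_add' := poisson_add 1 f
  map_smul' r g := by
    have h : ∀ v : ℂ × ℂ, pd v (r • g) = r • pd v g := fun v => (D v).map_smul r g
    simp only [poisson, h]
    simp only [Algebra.smul_def, RingHom.id_apply]
    ring

lemma bracket_apply (f g : Og (ℂ × ℂ)) :
    bracket f g = pd (1, 0) f * pd (0, 1) g - pd (0, 1) f * pd (1, 0) g := rfl

/-- Substitution of a plane germ into a one-variable germ. -/
noncomputable def substitution (f : Og (ℂ × ℂ)) (hf : ev f = 0) : Og ℂ →+* Og (ℂ × ℂ) :=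
  pb (rep f) (analyticAt_rep f) ((ev_apply f).symm.trans hf)

variable {f : Og (ℂ × ℂ)} {hf0 : ev f = 0}

lemma substitution_x : substitution f hf0 x = f := by
  rw [substitution, x]
  exact (pb_ofFun _ _ _).trans (ofFun_rep f)

lemma pd_substitution (v : ℂ × ℂ) (a : Og ℂ) :
    pd v (substitution f hf0 a) = substitution f hf0 (pd 1 a) * pd v f := by
  have := pd_pb (analyticAt_rep f) hf0 v a (z₁ := 0) (z₂ := 1) (s := pd v f) (by
    filter_upwards [rep_pd v f] with z hz
    rw [hz]; simp)
  have h0 : pd (0 : ℂ) a = 0 := by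
    rw [pd_apply]
    exact (ofFun_eq_iff (hh := analyticAt_const (v := (0 : ℂ)))).2
      (Eventually.of_forall fun z => map_zero _)
  rw [h0, map_zero, zero_add, mul_comm] at this
  exact this

lemma bracket_substitution_mul (a : Og ℂ) (g : Og (ℂ × ℂ)) :
    bracket f (substitution f hf0 a * g) = substitution f hf0 a * bracket f g := by
  rw [bracket_apply, bracket_apply, pd_mul, pd_mul, pd_substitution, pd_substitution]
  ring

lemma substitution_mul_mem (a : Og ℂ) {u : Og (ℂ × ℂ)} (hu : u ∈ LinearMap.range (bracket f)) :
    substitution f hf0 a * u ∈ LinearMap.range (bracket f) := by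
  obtain ⟨g, rfl⟩ := hu
  exact ⟨_, bracket_substitution_mul a g⟩

lemma substitution_algebraMap (c : ℂ) : substitution f hf0 (algebraMap ℂ _ c) = algebraMap ℂ _ c :=
  pb_algebraMap _ _ _

/-- Combinations of given germs with coefficients that are functions of `f`. -/
noncomputable def combination (f : Og (ℂ × ℂ)) (hf0 : ev f = 0) {r : ℕ} (e : Fin r → Og (ℂ × ℂ)) :
    (Fin r → Og ℂ) →ₗ[ℂ] Og (ℂ × ℂ) where
  toFun c := ∑ i, substitution f hf0 (c i) * e i
  map_add' c d := by simp [add_mul, Finset.sum_add_distrib]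
  map_smul' t c := by
    simp only [Pi.smul_apply, Algebra.smul_def, map_mul, substitution_algebraMap, Finset.mul_sum,
      RingHom.id_apply, mul_assoc]

lemma combination_apply {r : ℕ} (e : Fin r → Og (ℂ × ℂ)) (c : Fin r → Og ℂ) :
    combination f hf0 e c = ∑ i, substitution f hf0 (c i) * e i := rfl

lemma combination_mul {r : ℕ} (e : Fin r → Og (ℂ × ℂ)) (a : Og ℂ) (c : Fin r → Og ℂ) :
    combination f hf0 e (fun i => a * c i) = substitution f hf0 a * combination f hf0 e c := by
  simp only [combination_apply, map_mul, Finset.mul_sum, mul_assoc]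

/-- The Jacobian ideal as a subspace. -/
noncomputable def jacobian (f : Og (ℂ × ℂ)) : Submodule ℂ (Og (ℂ × ℂ)) :=
  (Ideal.span {pd (1, 0) f, pd (0, 1) f}).restrictScalars ℂ

lemma mem_jacobian {u : Og (ℂ × ℂ)} :
    u ∈ jacobian f ↔ ∃ p q, p * pd (1, 0) f + q * pd (0, 1) f = u := by
  rw [jacobian, Submodule.restrictScalars_mem, Ideal.mem_span_pair]

lemma range_bracket_le : LinearMap.range (bracket f) ≤ jacobian f := by
  rintro _ ⟨g, rfl⟩
  rw [mem_jacobian]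
  exact ⟨pd (0, 1) g, -pd (1, 0) g, by rw [bracket_apply]; ring⟩

/-- The rank of the Brieskorn lattice is the Milnor number. -/
theorem finrank_jacobian {n N m r : ℕ} {α β α' β' : Og (ℂ × ℂ)}
    (hf : IsRegular n f) (hn : n ≠ 0) (hf0 : ev f = 0)
    (hJ : incl ℂ x ^ N = α' * pd (1, 0) f + β' * pd (0, 1) f)
    (hm : f ^ m = α * pd (1, 0) f + β * pd (0, 1) f)
    [FiniteDimensional ℂ (Og (ℂ × ℂ) ⧸ jacobian f)] {e : Fin r → Og (ℂ × ℂ)}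
    (he : ∀ u, ∃! c, u - combination f hf0 e c ∈ LinearMap.range (bracket f)) :
    Module.finrank ℂ (Og (ℂ × ℂ) ⧸ jacobian f) = r := by
  set S := LinearMap.range (bracket f) with hS
  set Ψ := combination f hf0 e with hΨ
  obtain ⟨q, hq⟩ := exists_coordinates Ψ S he
  have hqΨ : ∀ c, q (Ψ c) = c := fun c => (hq _ _).2 (by simp)
  have hqS : ∀ {u}, q u = 0 ↔ u ∈ S := fun {u} => by rw [hq, map_zero, sub_zero]
  obtain ⟨I, hI⟩ := (D ((1, 0) : ℂ × ℂ)).toLinearMap.exists_rightInverse_of_surjective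
    (LinearMap.range_eq_top.2 exists_pd_fst_eq)
  have hI' : ∀ u, pd (1, 0) (I u) = u := fun u => LinearMap.congr_fun hI u
  let A : (Fin r → Og ℂ) →ₗ[ℂ] (Fin r → Og ℂ) :=
    q ∘ₗ LinearMap.mulRight ℂ (pd (1, 0) f) ∘ₗ I ∘ₗ Ψ
  have hA : ∀ P Q c, Ψ c - (pd (1, 0) P + pd (0, 1) Q) ∈ S ↔
      A c = q (P * pd (1, 0) f + Q * pd (0, 1) f) := by
    intro P Q c
    have h1 := exists_poisson_iff hf hn hJ (I (Ψ c) - P) (-Q)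
    rw [pd_sub, pd_neg, hI'] at h1
    have h2 : A c = q (I (Ψ c) * pd (1, 0) f) := rfl
    rw [h2, ← sub_eq_zero, ← map_sub, hqS]
    convert h1.symm using 1
    · rw [hS, LinearMap.mem_range, sub_add_eq_sub_sub, ← sub_eq_add_neg]; rfl
    · rw [hS, LinearMap.mem_range]
      refine exists_congr fun g => ?_
      rw [show I (Ψ c) * pd (1, 0) f - (P * pd (1, 0) f + Q * pd (0, 1) f) =
        (I (Ψ c) - P) * pd (1, 0) f + -Q * pd (0, 1) f by ring]
      rfl
  have hAinj : Function.Injective A := by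
    rw [← LinearMap.ker_eq_bot, LinearMap.ker_eq_bot']
    intro c hc
    have := (hA 0 0 c).2 (by rw [hc]; simp)
    rw [pd_zero, pd_zero, add_zero, sub_zero, ← hqS, hqΨ] at this
    exact this
  have hker : LinearMap.ker ((LinearMap.range A).mkQ ∘ₗ q) = jacobian f := by
    ext u
    rw [LinearMap.mem_ker, LinearMap.comp_apply, Submodule.mkQ_apply,
      Submodule.Quotient.mk_eq_zero]
    constructor
    · rintro ⟨c, hc⟩
      have h1 : I (Ψ c) * pd (1, 0) f - u ∈ S := by
        rw [← hqS, map_sub, sub_eq_zero]; exact hc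
      have h2 : I (Ψ c) * pd (1, 0) f ∈ jacobian f := mem_jacobian.2 ⟨I (Ψ c), 0, by ring⟩
      simpa using (jacobian f).sub_mem h2 (range_bracket_le h1)
    · intro hu
      obtain ⟨P, Q, rfl⟩ := mem_jacobian.1 hu
      refine ⟨q (pd (1, 0) P + pd (0, 1) Q), (hA _ _ _).1 ?_⟩
      rw [← neg_mem_iff, neg_sub]
      exact (hq _ _).1 rfl
  have hsurj : Function.Surjective ((LinearMap.range A).mkQ ∘ₗ q) :=
    (Submodule.mkQ_surjective _).comp fun c => ⟨_, hqΨ c⟩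
  let eqv : (Og (ℂ × ℂ) ⧸ jacobian f) ≃ₗ[ℂ] (Fin r → Og ℂ) ⧸ LinearMap.range A :=
    (Submodule.quotEquivOfEq _ _ hker.symm).trans
      (LinearMap.quotKerEquivOfSurjective _ hsurj)
  have : FiniteDimensional ℂ ((Fin r → Og ℂ) ⧸ LinearMap.range A) := eqv.finiteDimensional
  rw [eqv.finrank_eq]
  let Θ : Og (ℂ × ℂ) → Og (ℂ × ℂ) := fun h => pd (1, 0) (α * h) + pd (0, 1) (β * h)
  have hΘ : ∀ a h, Θ (substitution f hf0 a * h) =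
      substitution f hf0 a * Θ h + substitution f hf0 (x ^ m * pd 1 a) * h := by
    intro a h
    simp only [Θ]
    rw [map_mul, map_pow, substitution_x, hm, mul_left_comm α, mul_left_comm β,
      pd_mul (1, 0) (substitution f hf0 a), pd_mul (0, 1) (substitution f hf0 a),
      pd_substitution, pd_substitution]
    ring
  let M : Matrix (Fin r) (Fin r) (Og ℂ) := Matrix.of fun j i => q (Θ (e i)) j
  have hM : ∀ c, Ψ (M.mulVec c) = ∑ i, substitution f hf0 (c i) * Ψ (q (Θ (e i))) := by
    intro c
    simp only [hΨ, combination_apply, Matrix.mulVec, dotProduct, map_sum, map_mul, Finset.mul_sum,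
      Finset.sum_mul]
    rw [Finset.sum_comm]
    exact Finset.sum_congr rfl fun i _ => Finset.sum_congr rfl fun j _ => by
      simp only [M, Matrix.of_apply]; ring
  have hΘΨ : ∀ c, Θ (Ψ c) = ∑ i, Θ (substitution f hf0 (c i) * e i) := by
    intro c
    simp only [Θ, hΨ, combination_apply, Finset.mul_sum]
    rw [← D_apply, ← D_apply, map_sum, map_sum, ← Finset.sum_add_distrib]
    rfl
  refine (finrank_coker_of_comp_ode m M A hAinj fun c => ?_).trans (Fintype.card_fin r)
  have h1 : Ψ (ode (x ^ m • 1) M c) - Θ (Ψ c) ∈ S := by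
    rw [ode_apply, map_add, x_pow_smul_one_mulVec, hM, hΘΨ]
    simp only [hΘ, Finset.sum_add_distrib]
    have h2 : Ψ (fun i => x ^ m * pd 1 (c i)) =
        ∑ i, substitution f hf0 (x ^ m * pd 1 (c i)) * e i := rfl
    rw [h2, ← neg_mem_iff]
    have h3 : ∑ i, substitution f hf0 (c i) * (Θ (e i) - Ψ (q (Θ (e i)))) ∈ S :=
      sum_mem fun i _ => substitution_mul_mem _ ((hq _ _).1 rfl)
    simp only [mul_sub, Finset.sum_sub_distrib] at h3
    convert h3 using 1
    ring
  rw [(hA (α * Ψ c) (β * Ψ c) _).1 h1, hq]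
  have h4 : Ψ (fun i => x ^ m * c i) = f ^ m * Ψ c := by
    rw [hΨ, combination_mul, map_pow, substitution_x]
  rw [h4, hm]
  convert S.zero_mem using 1
  ring

end

end Og

/-! ### Reduction to a regular germ -/

namespace Og

lemma pb_congr {φ ψ : E → F} {hφ : AnalyticAt ℂ φ 0} {h0 : φ 0 = 0} {hψ : AnalyticAt ℂ ψ 0}
    {h0' : ψ 0 = 0} (h : φ =ᶠ[𝓝 0] ψ) (u : Og F) : pb φ hφ h0 u = pb ψ hψ h0' u := by
  rw [pb_apply, pb_apply]
  refine ofFun_eq_iff.2 ?_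
  filter_upwards [h] with z hz
  rw [hz]

lemma pd_add_smul (v w : E) (a : ℂ) (u : Og E) :
    pd (v + a • w) u = pd v u + algebraMap ℂ _ a * pd w u := by
  rw [pd_apply, pd_apply, pd_apply, algebraMap_eq, ofFun_mul, ofFun_add]
  refine ofFun_eq_iff.2 (Eventually.of_forall fun z => ?_)
  simp

section

variable {Λ W W' : Type*} [NormedAddCommGroup Λ] [NormedSpace ℂ Λ] [NormedAddCommGroup W]
  [NormedSpace ℂ W] [NormedAddCommGroup W'] [NormedSpace ℂ W']

lemma analyticAt_unfolding (F : Og (Λ × W)) : AnalyticAt ℂ (fun z : Λ × W => (z.1, rep F z)) 0 :=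
  analyticAt_fst.prod (analyticAt_rep F)

lemma unfolding_zero {F : Og (Λ × W)} (hF : ev F = 0) :
    (fun z : Λ × W => (z.1, rep F z)) 0 = 0 := by
  rw [ev_apply] at hF
  simp [hF]

lemma compPair_eq_pb {F : Og (Λ × W)} (hF : ev F = 0) (c : Og (Λ × ℂ)) :
    compPair c F = pb _ (analyticAt_unfolding F) (unfolding_zero hF) c := by
  rw [compPair, dif_pos (show ev0 F = 0 from hF)]
  rfl

lemma lpb_compPair {F : Og (Λ × W)} (hF : ev F = 0) (c : Og (Λ × ℂ)) (L : W' →L[ℂ] W) :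
    compPair c (lpb ((ContinuousLinearMap.id ℂ Λ).prodMap L) F) =
      lpb ((ContinuousLinearMap.id ℂ Λ).prodMap L) (compPair c F) := by
  rw [compPair_eq_pb hF, compPair_eq_pb ((ev_pb _ _ _).trans hF), pb_pb]
  refine pb_congr ?_ c
  filter_upwards [rep_pb (((ContinuousLinearMap.id ℂ Λ).prodMap L).analyticAt 0) (map_zero _) F]
    with z hz
  exact Prod.ext rfl hz

end

section

variable (Λ : Type*) [NormedAddCommGroup Λ] [NormedSpace ℂ Λ]

/-- A shear of the plane. -/
noncomputable def shear (a : ℂ) : ℂ × ℂ →L[ℂ] ℂ × ℂ :=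
  (ContinuousLinearMap.fst ℂ ℂ ℂ + a • ContinuousLinearMap.snd ℂ ℂ ℂ).prod
    (ContinuousLinearMap.snd ℂ ℂ ℂ)

lemma shear_apply (a : ℂ) (z : ℂ × ℂ) : shear a z = (z.1 + a * z.2, z.2) := rfl

/-- A shear of the fibres. -/
noncomputable def fibreShear (a : ℂ) : Λ × (ℂ × ℂ) →L[ℂ] Λ × (ℂ × ℂ) :=
  (ContinuousLinearMap.id ℂ Λ).prodMap (shear a)

variable {Λ}

lemma shear_neg_comp (a : ℂ) (u : Og (ℂ × ℂ)) : lpb (shear (-a)) (lpb (shear a) u) = u := by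
  rw [lpb_lpb]
  convert lpb_id u
  ext <;> simp [shear_apply]

lemma fibreShear_neg_comp (a : ℂ) (u : Og (Λ × (ℂ × ℂ))) :
    lpb (fibreShear Λ (-a)) (lpb (fibreShear Λ a) u) = u := by
  rw [lpb_lpb]
  convert lpb_id u
  ext <;> simp [fibreShear, shear_apply]

lemma lpb_shear_surjective (a : ℂ) (u : Og (ℂ × ℂ)) : ∃ w, lpb (shear a) w = u := by
  have := shear_neg_comp (-a) u
  rw [neg_neg] at this
  exact ⟨_, this⟩

lemma lpb_fibreShear_surjective (a : ℂ) (u : Og (Λ × (ℂ × ℂ))) :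
    ∃ w, lpb (fibreShear Λ a) w = u := by
  have := fibreShear_neg_comp (-a) u
  rw [neg_neg] at this
  exact ⟨_, this⟩

lemma pd_shear_fst (a : ℂ) (u : Og (ℂ × ℂ)) :
    pd (1, 0) (lpb (shear a) u) = lpb (shear a) (pd (1, 0) u) := by
  rw [pd_lpb]
  congr 2
  simp [shear_apply]

lemma pd_shear_snd (a : ℂ) (u : Og (ℂ × ℂ)) : pd (0, 1) (lpb (shear a) u) =
    lpb (shear a) (pd (0, 1) u) + algebraMap ℂ _ a * lpb (shear a) (pd (1, 0) u) := by
  have h : shear a (0, 1) = (0, 1) + a • (1, 0) := by simp [shear_apply]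
  rw [pd_lpb, h, pd_add_smul, map_add, map_mul, pb_algebraMap]

lemma dxP_fibreShear (a : ℂ) (u : Og (Λ × (ℂ × ℂ))) :
    dxP (lpb (fibreShear Λ a) u) = lpb (fibreShear Λ a) (dxP u) := by
  have h : fibreShear Λ a (0, (1, 0)) = (0, (1, 0)) := by simp [fibreShear, shear_apply]
  rw [dxP, pd_lpb, h]

lemma dyP_fibreShear (a : ℂ) (u : Og (Λ × (ℂ × ℂ))) : dyP (lpb (fibreShear Λ a) u) =
    lpb (fibreShear Λ a) (dyP u) + algebraMap ℂ _ a * lpb (fibreShear Λ a) (dxP u) := by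
  have h : fibreShear Λ a (0, (0, 1)) = (0, (0, 1)) + a • (0, (1, 0)) := by
    simp [fibreShear, shear_apply]
  rw [dyP, pd_lpb, h, pd_add_smul, map_add, map_mul, pb_algebraMap]

lemma shear_mem_jacobianSet (a : ℂ) {f w : Og (ℂ × ℂ)} :
    lpb (shear a) w ∈ jacobianSet (lpb (shear a) f) ↔ w ∈ jacobianSet f := by
  have key : ∀ (a : ℂ) {f w : Og (ℂ × ℂ)}, w ∈ jacobianSet f →
      lpb (shear a) w ∈ jacobianSet (lpb (shear a) f) := by
    rintro a f _ ⟨g, h, rfl⟩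
    refine ⟨lpb (shear a) g - algebraMap ℂ _ a * lpb (shear a) h, lpb (shear a) h, ?_⟩
    rw [pd_shear_fst, pd_shear_snd, map_add, map_mul, map_mul]
    ring
  refine ⟨fun h => ?_, key a⟩
  have := key (-a) h
  rwa [shear_neg_comp, shear_neg_comp] at this

lemma fibreShear_mem_relBrieskornRel (a : ℂ) {F w : Og (Λ × (ℂ × ℂ))} :
    lpb (fibreShear Λ a) w ∈ relBrieskornRel (lpb (fibreShear Λ a) F) ↔ w ∈ relBrieskornRel F := by
  have key : ∀ (a : ℂ) {F w : Og (Λ × (ℂ × ℂ))}, w ∈ relBrieskornRel F →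
      lpb (fibreShear Λ a) w ∈ relBrieskornRel (lpb (fibreShear Λ a) F) := by
    rintro a F _ ⟨G, rfl⟩
    refine ⟨lpb (fibreShear Λ a) G, ?_⟩
    rw [dxP_fibreShear, dyP_fibreShear, dxP_fibreShear, dyP_fibreShear, map_sub, map_mul, map_mul]
    ring
  refine ⟨fun h => ?_, key a⟩
  have := key (-a) h
  rwa [fibreShear_neg_comp, fibreShear_neg_comp] at this

lemma hasMilnorNumber_shear (a : ℂ) {f : Og (ℂ × ℂ)} {μ : ℕ} (h : HasMilnorNumber f μ) :
    HasMilnorNumber (lpb (shear a) f) μ := by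
  obtain ⟨b, hb⟩ := h
  refine ⟨fun i => lpb (shear a) (b i), fun u => ?_⟩
  obtain ⟨w, rfl⟩ := lpb_shear_surjective a u
  refine (existsUnique_congr fun c => ?_).1 (hb w)
  rw [← shear_mem_jacobianSet a, map_sub, map_sum]
  simp only [map_mul, const_eq, pb_algebraMap]

end

/-- A non-zero germ is regular after a shear. -/
lemma exists_isRegular_shear {f : Og (ℂ × ℂ)} (hf : f ≠ 0) :
    ∃ a n, IsRegular n (lpb (shear a) f) := by
  by_contra! hcon
  have h0 : ∀ a : ℂ, line ℂ (lpb (shear a) f) = 0 := by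
    intro a
    by_contra h
    obtain ⟨n, ε, hε, h⟩ := exists_eq_x_pow_mul h
    exact hcon a n ⟨ε, hε, h⟩
  obtain ⟨ε, hε, hball⟩ := Metric.eventually_nhds_iff_ball.1
    (analyticAt_rep f).eventually_analyticAt
  have hline : ∀ a y : ℂ, ‖a‖ ≤ 1 → ‖y‖ < ε → rep f (a * y, y) = 0 := by
    intro a y ha hy
    let l : ℂ →L[ℂ] ℂ × ℂ := (shear a).comp (ContinuousLinearMap.inr ℂ ℂ ℂ)
    have hl : ∀ t, l t = (a * t, t) := fun t => by simp [l, shear_apply]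
    have h1 : ∀ᶠ t in 𝓝 (0 : ℂ), rep f (l t) = 0 := by
      have h := h0 a
      rw [lpb_lpb, pb_apply] at h
      exact (ofFun_eq_iff (hh := analyticAt_const (v := (0 : ℂ)))).1 h
    have h2 : AnalyticOnNhd ℂ (fun t => rep f (l t)) (Metric.ball 0 ε) := by
      intro t ht
      rw [mem_ball_zero_iff] at ht
      refine (hball _ ?_).comp (l.analyticAt t)
      rw [mem_ball_zero_iff, hl, Prod.norm_def, norm_mul]
      exact max_lt (lt_of_le_of_lt (mul_le_of_le_one_left (norm_nonneg _) ha) ht) ht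
    have h3 := h2.eqOn_zero_of_preconnected_of_eventuallyEq_zero
      (convex_ball _ _).isPreconnected (Metric.mem_ball_self hε) h1
      (mem_ball_zero_iff.2 hy)
    rw [← hl]
    exact h3
  have h1 : AnalyticOnNhd ℂ (rep f) (Metric.ball 0 ε) := hball
  have hp : ((0 : ℂ), ((ε / 2 : ℝ) : ℂ)) ∈ Metric.ball (0 : ℂ × ℂ) ε := by
    rw [mem_ball_zero_iff, Prod.norm_def, norm_zero, Complex.norm_real,
      Real.norm_of_nonneg (by positivity)]
    exact max_lt hε (by linarith)
  have h2 : rep f =ᶠ[𝓝 ((0 : ℂ), ((ε / 2 : ℝ) : ℂ))] 0 := by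
    have ho : IsOpen {z : ℂ × ℂ | ‖z.1‖ < ‖z.2‖} := isOpen_lt (by fun_prop) (by fun_prop)
    have hm : ((0 : ℂ), ((ε / 2 : ℝ) : ℂ)) ∈ {z : ℂ × ℂ | ‖z.1‖ < ‖z.2‖} := by
      rw [Set.mem_ofPred_eq, norm_zero, Complex.norm_real, Real.norm_of_nonneg (by positivity)]
      positivity
    filter_upwards [ho.mem_nhds hm, Metric.isOpen_ball.mem_nhds hp] with z hz hz'
    have hz2 : z.2 ≠ 0 := fun h => by
      rw [h, norm_zero] at hz
      exact absurd hz (not_lt.2 (norm_nonneg _))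
    rw [mem_ball_zero_iff, Prod.norm_def] at hz'
    have h := hline (z.1 / z.2) z.2 (by
      rw [norm_div]
      exact div_le_one_of_le₀ hz.le (norm_nonneg _)) ((le_max_right _ _).trans_lt hz')
    rwa [div_mul_cancel₀ _ hz2] at h
  have h3 := h1.eqOn_zero_of_preconnected_of_eventuallyEq_zero
    (convex_ball _ _).isPreconnected hp h2
  refine hf ?_
  rw [← ofFun_rep f]
  exact (ofFun_eq_iff (hh := analyticAt_const (v := (0 : ℂ)))).2
    (Filter.eventually_of_mem (Metric.ball_mem_nhds _ hε) h3)

section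

variable {f : Og (ℂ × ℂ)}

lemma HasMilnorNumber.finrank {μ : ℕ} (h : HasMilnorNumber f μ) :
    FiniteDimensional ℂ (Og (ℂ × ℂ) ⧸ jacobian f) ∧
      Module.finrank ℂ (Og (ℂ × ℂ) ⧸ jacobian f) = μ := by
  obtain ⟨b, hb⟩ := h
  have hmem : ∀ u c, u - Fintype.linearCombination ℂ b c ∈ jacobian f ↔
      u - ∑ i, Og.const (c i) * b i ∈ jacobianSet f := by
    intro u c
    rw [mem_jacobian, Fintype.linearCombination_apply]
    simp only [const_eq, Algebra.smul_def]
    exact exists_congr fun p => exists_congr fun q => eq_comm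
  obtain ⟨q, hq⟩ := exists_coordinates (Fintype.linearCombination ℂ b) (jacobian f)
    (fun u => (existsUnique_congr fun c => hmem u c).2 (hb u))
  have hker : LinearMap.ker q = jacobian f := by
    ext u
    rw [LinearMap.mem_ker, hq, map_zero, sub_zero]
  have hsurj : Function.Surjective q := fun c =>
    ⟨Fintype.linearCombination ℂ b c, (hq _ c).2 (by rw [sub_self]; exact zero_mem _)⟩
  let eqv : (Og (ℂ × ℂ) ⧸ jacobian f) ≃ₗ[ℂ] (Fin μ → ℂ) :=
    (Submodule.quotEquivOfEq _ _ hker.symm).trans (LinearMap.quotKerEquivOfSurjective _ hsurj)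
  exact ⟨eqv.symm.finiteDimensional, by rw [eqv.finrank_eq]; simp⟩

/-- An ideal of finite codimension contains a power of every germ vanishing at the origin. -/
lemma exists_pow_mem (I : Ideal (Og E)) [Module.Finite ℂ (Og E ⧸ I)] {g : Og E} (hg : ev g = 0) :
    ∃ m, g ^ m ∈ I := by
  obtain ⟨p, hp, h⟩ := IsIntegral.of_finite ℂ (Ideal.Quotient.mk I g)
  obtain ⟨s, hs, hs'⟩ := Polynomial.exists_eq_pow_rootMultiplicity_mul_and_not_dvd p hp.ne_zero 0
  rw [map_zero, sub_zero] at hs hs'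
  refine ⟨p.rootMultiplicity 0, ?_⟩
  have h1 : Polynomial.aeval g p ∈ I := by
    rw [← Ideal.Quotient.eq_zero_iff_mem]
    have := Polynomial.aeval_algHom_apply (Ideal.Quotient.mkₐ ℂ I) g p
    exact this.symm.trans h
  have h2 : IsUnit (Polynomial.aeval g s) := by
    rw [isUnit_iff]
    have h3 : ev (Polynomial.aeval g s) = s.eval 0 := by
      rw [Polynomial.aeval_def, Polynomial.hom_eval₂, hg]
      have : (ev : Og E →+* ℂ).comp (algebraMap ℂ (Og E)) = RingHom.id ℂ :=
        RingHom.ext ev_algebraMap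
      rw [this, Polynomial.eval₂_id]
    rw [h3]
    intro h4
    exact hs' (by rw [Polynomial.X_dvd_iff, Polynomial.coeff_zero_eq_eval_zero, h4])
  rw [hs, map_mul, map_pow, Polynomial.aeval_X] at h1
  exact (Ideal.mul_unit_mem_iff_mem I h2).1 h1

lemma exists_pow_mem_jacobian [FiniteDimensional ℂ (Og (ℂ × ℂ) ⧸ jacobian f)] {g : Og (ℂ × ℂ)}
    (hg : ev g = 0) : ∃ m α β, g ^ m = α * pd (1, 0) f + β * pd (0, 1) f := by
  have : Module.Finite ℂ (Og (ℂ × ℂ) ⧸ Ideal.span {pd (1, 0) f, pd (0, 1) f}) := by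
    have h : Module.Finite ℂ (Og (ℂ × ℂ) ⧸
        (Ideal.span {pd (1, 0) f, pd (0, 1) f}).restrictScalars ℂ) :=
      ‹FiniteDimensional ℂ (Og (ℂ × ℂ) ⧸ jacobian f)›
    exact Module.Finite.equiv (Submodule.Quotient.restrictScalarsEquiv ℂ
      (Ideal.span {pd (1, 0) f, pd (0, 1) f}))
  obtain ⟨m, h⟩ := exists_pow_mem (Ideal.span {pd (1, 0) f, pd (0, 1) f}) hg
  obtain ⟨α, β, h⟩ := Ideal.mem_span_pair.1 h
  exact ⟨m, α, β, h.symm⟩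

/-- A basis of the Brieskorn lattice of a germ without parameters. -/
lemma exists_basis_bracket {n N r : ℕ} {α β : Og (ℂ × ℂ)} (hf : IsRegular n f) (hn : n ≠ 0)
    (hf0 : ev f = 0) (hJ : incl ℂ x ^ N = α * pd (1, 0) f + β * pd (0, 1) f)
    {e₀ : Fin r → Og (ℂ × ℂ)} (he₀ : IsBracketBasis f e₀) :
    ∃ e : Fin r → Og (ℂ × ℂ),
      ∀ u, ∃! c, u - combination f hf0 e c ∈ LinearMap.range (bracket f) := by
  let Λ := Fin 0 → ℂ
  have hS : ∀ {W : Type} [NormedAddCommGroup W] [NormedSpace ℂ W] (u : Og (Λ × W)),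
      lpb (ContinuousLinearMap.snd ℂ Λ W) (lpb (ContinuousLinearMap.inr ℂ Λ W) u) = u := by
    intro W _ _ u
    rw [lpb_lpb]
    convert lpb_id u
    refine ContinuousLinearMap.ext fun z => ?_
    exact Prod.ext (Subsingleton.elim _ _) rfl
  have hR : ∀ {W : Type} [NormedAddCommGroup W] [NormedSpace ℂ W] (u : Og W),
      lpb (ContinuousLinearMap.inr ℂ Λ W) (lpb (ContinuousLinearMap.snd ℂ Λ W) u) = u := by
    intro W _ _ u
    rw [lpb_lpb]
    exact lpb_id u
  set F : Og (Λ × (ℂ × ℂ)) := lpb (ContinuousLinearMap.snd ℂ Λ (ℂ × ℂ)) f with hFdef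
  have hF : ev F = 0 := (ev_pb _ _ _).trans hf0
  obtain ⟨e, he⟩ := exists_basis_relBrieskorn hf hn hJ he₀ hF (hR f)
  have hc : ∀ c : Og ℂ, compPair (lpb (ContinuousLinearMap.snd ℂ Λ ℂ) c) F =
      lpb (ContinuousLinearMap.snd ℂ Λ (ℂ × ℂ)) (substitution f hf0 c) := by
    intro c
    rw [compPair_eq_pb hF, substitution, pb_pb, pb_pb]
    refine pb_congr ?_ c
    exact rep_pb _ _ _
  have hd : ∀ (v : ℂ × ℂ) u, pd ((0 : Λ), v) (lpb (ContinuousLinearMap.snd ℂ Λ (ℂ × ℂ)) u) =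
      lpb (ContinuousLinearMap.snd ℂ Λ (ℂ × ℂ)) (pd v u) := fun v u => pd_lpb _ _ _
  let eqv : (Fin r → Og ℂ) ≃ (Fin r → Og (Λ × ℂ)) :=
    { toFun := fun c i => lpb (ContinuousLinearMap.snd ℂ Λ ℂ) (c i)
      invFun := fun c i => lpb (ContinuousLinearMap.inr ℂ Λ ℂ) (c i)
      left_inv := fun c => funext fun i => hR _
      right_inv := fun c => funext fun i => hS _ }
  refine ⟨fun i => lpb (ContinuousLinearMap.inr ℂ Λ (ℂ × ℂ)) (e i), fun u => ?_⟩
  refine (eqv.existsUnique_congr fun {c} => ?_).2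
    (he (lpb (ContinuousLinearMap.snd ℂ Λ (ℂ × ℂ)) u))
  have h1 : lpb (ContinuousLinearMap.snd ℂ Λ (ℂ × ℂ)) u - (∑ i, compPair (eqv c i) F * e i) =
      lpb (ContinuousLinearMap.snd ℂ Λ (ℂ × ℂ)) (u - combination f hf0
        (fun i => lpb (ContinuousLinearMap.inr ℂ Λ (ℂ × ℂ)) (e i)) c) := by
    rw [map_sub, combination_apply, map_sum]
    congr 1
    refine Finset.sum_congr rfl fun i _ => ?_
    rw [map_mul, hS]
    exact congrArg (· * e i) (hc (c i))
  rw [h1]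
  constructor
  · rintro ⟨g, hg⟩
    refine ⟨lpb (ContinuousLinearMap.snd ℂ Λ (ℂ × ℂ)) g, ?_⟩
    rw [← hg, bracket_apply, dxP, dyP, dxP, dyP, hFdef, hd, hd, hd, hd, map_sub, map_mul, map_mul]
  · rintro ⟨G, hG⟩
    refine ⟨lpb (ContinuousLinearMap.inr ℂ Λ (ℂ × ℂ)) G, ?_⟩
    rw [← hS G, dxP, dyP, dxP, dyP, hFdef, hd, hd, hd, hd] at hG
    have h2 := congrArg (lpb (ContinuousLinearMap.inr ℂ Λ (ℂ × ℂ))) hG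
    rw [hR, map_sub, map_mul, map_mul, hR, hR, hR, hR] at h2
    rw [h2, bracket_apply]

end

/-- The relative Brieskorn–Greuel theorem for a regular germ. -/
theorem exists_basis_of_isRegular {Λ : Type*} [NormedAddCommGroup Λ] [NormedSpace ℂ Λ]
    [FiniteDimensional ℂ Λ] {n μ : ℕ} {f : Og (ℂ × ℂ)} (hf : IsRegular n f) (hf0 : ev f = 0)
    (hμ : HasMilnorNumber f μ) {F : Og (Λ × (ℂ × ℂ))}
    (hFf : lpb (ContinuousLinearMap.inr ℂ Λ (ℂ × ℂ)) F = f) :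
    ∃ e : Fin μ → Og (Λ × (ℂ × ℂ)), ∀ u : Og (Λ × (ℂ × ℂ)),
      ∃! c : Fin μ → Og (Λ × ℂ), u - (∑ i, compPair (c i) F * e i) ∈ relBrieskornRel F := by
  have hn : n ≠ 0 := by
    rintro rfl
    obtain ⟨ε, hε, h⟩ := hf
    rw [pow_zero, one_mul] at h
    rw [isUnit_iff, ← h, ev_pb] at hε
    exact hε hf0
  obtain ⟨_, hrank⟩ := HasMilnorNumber.finrank hμ
  obtain ⟨N, α', β', hJ⟩ := exists_pow_mem_jacobian (f := f) (g := incl ℂ x)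
    ((ev_pb _ _ _).trans ev_x)
  obtain ⟨m, α, β, hm⟩ := exists_pow_mem_jacobian (f := f) hf0
  obtain ⟨r, e₀, he₀⟩ := exists_isBracketBasis hf hn hJ
  obtain ⟨e, he⟩ := exists_basis_bracket hf hn hf0 hJ he₀
  obtain rfl : r = μ := (finrank_jacobian hf hn hf0 hJ hm he).symm.trans hrank
  exact exists_basis_relBrieskorn hf hn hJ he₀
    ((ev_pb _ _ _).symm.trans ((congrArg ev hFf).trans hf0)) hFf

lemma HasMilnorNumber.ne_zero {f : Og (ℂ × ℂ)} {μ : ℕ} (h : HasMilnorNumber f μ) : f ≠ 0 := by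
  rintro rfl
  obtain ⟨_, -⟩ := HasMilnorNumber.finrank h
  obtain ⟨N, α, β, hJ⟩ := exists_pow_mem_jacobian (f := 0) (g := incl ℂ x)
    ((ev_pb _ _ _).trans ev_x)
  rw [pd_zero, pd_zero, mul_zero, mul_zero, add_zero] at hJ
  have h1 := congrArg (lpb (ContinuousLinearMap.inl ℂ ℂ ℂ)) hJ
  rw [map_pow, inl_incl, map_zero] at h1
  exact pow_ne_zero _ x_ne_zero h1

end Og

/-- **The relative Brieskorn–Greuel theorem.**  Let `f : (ℂ²,0) → (ℂ,0)` have an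
isolated critical point with Milnor number `μ`, and let
`F : (ℂ^k × ℂ²,0) → (ℂ,0)` be a deformation of `f`.  Then the relative Brieskorn
lattice `H''_F = 𝒪_{k+2}/{∂_x F ∂_y G - ∂_y F ∂_x G}` is a free module of rank `μ`
over `𝒪_{k+1} = ℂ{λ₁,…,λ_k,t}`, where `λ_i` acts as multiplication by `λ_i` and `t`
as multiplication by `F`. -/
theorem relative_brieskorn_greuel {k : ℕ}
    (f : Og (ℂ × ℂ)) (hf0 : Og.ev0 f = 0) (μ : ℕ) (hμ : HasMilnorNumber f μ)
    (F : Og ((Fin k → ℂ) × (ℂ × ℂ)))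
    (hF : Og.pull (fun z : ℂ × ℂ => ((0 : Fin k → ℂ), z)) F = f) :
    ∃ e : Fin μ → Og ((Fin k → ℂ) × (ℂ × ℂ)),
      ∀ u : Og ((Fin k → ℂ) × (ℂ × ℂ)),
        ∃! c : Fin μ → Og ((Fin k → ℂ) × ℂ),
          u - (∑ i, Og.compPair (c i) F * e i) ∈ relBrieskornRel F := by
  obtain ⟨a, n, hreg⟩ := Og.exists_isRegular_shear (Og.HasMilnorNumber.ne_zero hμ)
  have hFf : Og.lpb (ContinuousLinearMap.inr ℂ (Fin k → ℂ) (ℂ × ℂ)) F = f := by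
    rw [← hF, Og.pull, dif_pos ⟨(ContinuousLinearMap.inr ℂ (Fin k → ℂ) (ℂ × ℂ)).analyticAt 0, rfl⟩]
    rfl
  have hF0 : Og.ev F = 0 := (Og.ev_pb _ _ _).symm.trans ((congrArg Og.ev hFf).trans hf0)
  obtain ⟨e, he⟩ := Og.exists_basis_of_isRegular (F := Og.lpb (Og.fibreShear (Fin k → ℂ) a) F) hreg
    ((Og.ev_pb _ _ _).trans hf0) (Og.hasMilnorNumber_shear a hμ) (by
      rw [← hFf, Og.lpb_lpb, Og.lpb_lpb]
      congr 1)
  choose e' he' using fun i => Og.lpb_fibreShear_surjective a (e i)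
  refine ⟨e', fun u => ?_⟩
  refine (existsUnique_congr fun c => ?_).1 (he (Og.lpb (Og.fibreShear (Fin k → ℂ) a) u))
  refine Iff.trans ?_ (Og.fibreShear_mem_relBrieskornRel a)
  rw [map_sub, map_sum]
  simp only [map_mul, he']
  have h : ∀ i, Og.compPair (c i) (Og.lpb (Og.fibreShear (Fin k → ℂ) a) F) =
      Og.lpb (Og.fibreShear (Fin k → ℂ) a) (Og.compPair (c i) F) :=
    fun i => Og.lpb_compPair hF0 (c i) (Og.shear a)
  simp only [h]
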